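/- Let $p$ be a prime power and $t, n$ positive integers with $p^{t/2 - 2} > (2n+1)\, 2^{2\omega(p^t-1)}$, where $\omega(p^t-1)$ is the number of distinct primes dividing $p^t - 1$. Then for every rational function $f = f_1/f_2$ over $\mathbb{F}_{p^t}$ with $f_1, f_2$ coprime irreducible polynomials satisfying $\deg f_1 + \deg f_2 = n$, and every $a, b \in \mathbb{F}_p$, there exists $\epsilon \in \mathbb{F}_{p^t}$ (not a zero or pole of $f$) such that both $\epsilon$ and $f(\epsilon)$ are primitive elements of $\mathbb{F}_{p^t}$, $\mathrm{Tr}_{\mathbb{F}_{p^t}/\mathbb{F}_p}(\epsilon) = a$, and $\mathrm{Tr}_{\mathbb{F}_{p^t}/\mathbb{F}_p}(f(\epsilon)) = b$. -/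

import Mathlib

open Polynomial

section DegreeBounds

variable {L R κ : Type*} [Field L] [CommRing R] [Algebra L[X] R]

/-- All coordinates of `v` in the basis `b` are polynomials of degree at most `n`. -/
def HasDegLE (b : Module.Basis κ L[X] R) (n : ℕ) (v : R) : Prop :=
  ∀ i, (b.repr v i).natDegree ≤ n

theorem HasDegLE.mono {b : Module.Basis κ L[X] R} {n m : ℕ} {v : R} (h : HasDegLE b n v)
    (hnm : n ≤ m) : HasDegLE b m v := fun i => (h i).trans hnm

theorem HasDegLE.sum {b : Module.Basis κ L[X] R} {ι : Type*} {s : Finset ι} {n : ℕ}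
    {v : ι → R} (h : ∀ i ∈ s, HasDegLE b n (v i)) : HasDegLE b n (∑ i ∈ s, v i) := by
  intro k
  rw [map_sum, Finsupp.finsetSum_apply]
  exact natDegree_sum_le_of_forall_le _ _ fun i hi => h i hi k

theorem HasDegLE.smul {b : Module.Basis κ L[X] R} {n m : ℕ} {v : R} {P : L[X]}
    (hP : P.natDegree ≤ m) (h : HasDegLE b n v) : HasDegLE b (m + n) (P • v) := by
  intro k
  rw [map_smul, Finsupp.smul_apply, smul_eq_mul]
  exact natDegree_mul_le.trans (add_le_add hP (h k))

theorem HasDegLE.pow {b : Module.Basis κ L[X] R} {c : ℕ}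
    (hc : ∀ n m v w, HasDegLE b n v → HasDegLE b m w → HasDegLE b (n + m + c) (v * w))
    {n : ℕ} {v : R} (hv : HasDegLE b n v) (r : ℕ) (hr : r ≠ 0) :
    HasDegLE b (r * (n + c)) (v ^ r) := by
  induction r with
  | zero => exact absurd rfl hr
  | succ r ih =>
    rcases eq_or_ne r 0 with rfl | h
    · simpa using hv.mono (by omega)
    · rw [pow_succ]
      exact (hc _ _ _ _ (ih h) hv).mono (by rw [Nat.succ_mul]; omega)

variable [Fintype κ]

theorem exists_hasDegLE {ι : Type*} [Fintype ι] (b : Module.Basis κ L[X] R) (v : ι → R) :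
    ∃ n, ∀ i, HasDegLE b n (v i) := by
  refine ⟨∑ i, ∑ k, (b.repr (v i) k).natDegree, fun i k => ?_⟩
  exact (Finset.single_le_sum (f := fun k => (b.repr (v i) k).natDegree)
    (fun _ _ => Nat.zero_le _) (Finset.mem_univ k)).trans
    (Finset.single_le_sum (f := fun i => ∑ k, (b.repr (v i) k).natDegree)
    (fun _ _ => Nat.zero_le _) (Finset.mem_univ i))

theorem exists_hasDegLE_mul (b : Module.Basis κ L[X] R) :
    ∃ c, ∀ n m v w, HasDegLE b n v → HasDegLE b m w → HasDegLE b (n + m + c) (v * w) := by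
  obtain ⟨c, hc⟩ := exists_hasDegLE b fun q : κ × κ => b q.1 * b q.2
  refine ⟨c, fun n m v w hv hw => ?_⟩
  rw [← b.sum_repr v, ← b.sum_repr w, Finset.sum_mul_sum]
  refine HasDegLE.sum fun i _ => HasDegLE.sum fun j _ => ?_
  rw [smul_mul_smul_comm]
  exact HasDegLE.smul (natDegree_mul_le.trans (add_le_add (hv i) (hw j))) (hc (i, j))

/-- Siegel's lemma over a field: more unknowns than equations. -/
theorem exists_ne_zero_sum_smul_eq_zero {ι : Type*} [Fintype ι] (b : Module.Basis κ L[X] R)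
    {n : ℕ} {v : ι → R} (hv : ∀ i, HasDegLE b n (v i))
    (hcard : Fintype.card κ * (n + 1) < Fintype.card ι) :
    ∃ t : ι → L, t ≠ 0 ∧ ∑ i, C (t i) • v i = 0 := by
  let T : (ι → L) →ₗ[L] (κ × Fin (n + 1) → L) :=
    { toFun := fun t q => ∑ i, t i * (b.repr (v i) q.1).coeff q.2
      map_add' := fun s t => by ext q; simp [add_mul, Finset.sum_add_distrib]
      map_smul' := fun s t => by ext q; simp [Finset.mul_sum, mul_assoc] }
  have hker : LinearMap.ker T ≠ ⊥ := LinearMap.ker_ne_bot_of_finrank_lt (by simpa using hcard)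
  obtain ⟨t, ht, ht0⟩ := (Submodule.ne_bot_iff _).mp hker
  refine ⟨t, ht0, b.ext_elem fun k => Polynomial.ext fun j => ?_⟩
  have hsum : (b.repr (∑ i, C (t i) • v i) k).coeff j = ∑ i, t i * (b.repr (v i) k).coeff j := by
    simp [map_sum, Finsupp.finsetSum_apply]
  rw [hsum]
  rw [map_zero, Finsupp.zero_apply, coeff_zero]
  by_cases hj : j < n + 1
  · exact congrFun (LinearMap.mem_ker.mp ht) (k, ⟨j, hj⟩)
  · refine Finset.sum_eq_zero fun i _ => ?_
    rw [coeff_eq_zero_of_natDegree_lt ((hv i k).trans_lt (by omega)), mul_zero]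

end DegreeBounds

section ZeroEstimate

variable {L R κ : Type*} [Field L] [CommRing R] [Algebra L[X] R] [Fintype κ]

theorem natDegree_det_le {κ : Type*} [Fintype κ] [DecidableEq κ] (M : Matrix κ κ L[X]) {n : ℕ}
    (h : ∀ i j, (M i j).natDegree ≤ n) : M.det.natDegree ≤ Fintype.card κ * n := by
  rw [Matrix.det_apply]
  refine natDegree_sum_le_of_forall_le _ _ fun g _ => ?_
  refine (natDegree_smul_le _ _).trans ((natDegree_prod_le _ _).trans ?_)
  exact (Finset.sum_le_card_nsmul _ _ n fun i _ => h _ _).trans (by simp)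

theorem dvd_algebraMap_norm [IsDomain R] (b : Module.Basis κ L[X] R) (v : R) :
    v ∣ algebraMap L[X] R (Algebra.norm L[X] v) := by
  classical
  have : Module.Free L[X] R := .of_basis b
  have : Module.Finite L[X] R := .of_basis b
  have h := LinearMap.aeval_self_charpoly (Algebra.lmul L[X] R v)
  have h2 : aeval v (Algebra.lmul L[X] R v).charpoly = 0 := by
    rw [Polynomial.aeval_algHom_apply] at h
    simpa using congrArg (fun f : Module.End L[X] R => f 1) h
  rw [Algebra.norm_apply, LinearMap.det_eq_sign_charpoly_coeff, map_mul]
  refine Dvd.dvd.mul_left ?_ _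
  rw [← dvd_neg]
  refine (dvd_add_right (a := v) (b := aeval v (Algebra.lmul L[X] R v).charpoly)
    (by rw [h2]; exact dvd_zero _)).mp ?_
  generalize (Algebra.lmul L[X] R v).charpoly = P
  obtain ⟨Q, hQ⟩ := X_dvd_sub_C (p := P)
  refine ⟨aeval v Q, ?_⟩
  have := congrArg (aeval v) hQ
  rw [map_sub, map_mul, aeval_X, aeval_C] at this
  rw [← this, ← sub_eq_add_neg]

theorem le_natDegree_of_X_pow_dvd {P : L[X]} (hP : P ≠ 0) {N : ℕ}
    (h : (PowerSeries.X : PowerSeries L) ^ N ∣ (P : PowerSeries L)) : N ≤ P.natDegree := by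
  by_contra hlt
  push Not at hlt
  have := PowerSeries.X_pow_dvd_iff.mp h P.natDegree hlt
  rw [Polynomial.coeff_coe] at this
  exact hP (leadingCoeff_eq_zero.mp this)

theorem zero_estimate (b : Module.Basis κ L[X] R) (Φ : R →+* PowerSeries L)
    (hΦ : Function.Injective Φ) (x₀ : L)
    (hΦX : ∀ P : L[X], Φ (algebraMap L[X] R P) = ((taylor x₀ P : L[X]) : PowerSeries L)) {c : ℕ}
    (hc : ∀ n m v w, HasDegLE b n v → HasDegLE b m w → HasDegLE b (n + m + c) (v * w)) {e : ℕ}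
    (he : ∀ i, HasDegLE b e (b i)) {n N : ℕ} {v : R} (hv : HasDegLE b n v) (hv0 : v ≠ 0)
    (hdvd : PowerSeries.X ^ N ∣ Φ v) : N ≤ Fintype.card κ * (n + e + c) := by
  classical
  have : IsDomain R := hΦ.isDomain Φ
  have : Module.Free L[X] R := .of_basis b
  have : Module.Finite L[X] R := .of_basis b
  have hnorm : Algebra.norm L[X] v ≠ 0 := Algebra.norm_ne_zero_iff.mpr hv0
  have h1 : PowerSeries.X ^ N ∣ ((taylor x₀ (Algebra.norm L[X] v) : L[X]) : PowerSeries L) := by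
    rw [← hΦX]
    exact hdvd.trans (map_dvd Φ (dvd_algebraMap_norm b v))
  have h2 := le_natDegree_of_X_pow_dvd (by simpa using hnorm) h1
  rw [natDegree_taylor] at h2
  refine h2.trans ?_
  rw [Algebra.norm_eq_matrix_det b]
  refine natDegree_det_le _ fun i j => ?_
  rw [Algebra.leftMulMatrix_eq_repr_mul]
  exact hc n e v (b j) hv (he j) i

end ZeroEstimate

section Stepanov

theorem eq_zero_of_sum_mul_pow_eq_zero {L : Type*} [Field L] {p : ℕ} [Fact p.Prime] [CharP L p]
    {J : Type*} [Fintype J] {μ : ℕ} (v u : J → PowerSeries L)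
    (hv : ∀ t : J → L, PowerSeries.X ^ p ^ μ ∣ ∑ j, PowerSeries.C (t j) * v j → t = 0)
    (h : ∑ j, v j * u j ^ p ^ μ = 0) : u = 0 := by
  have : CharP (PowerSeries L) p := charP_of_injective_ringHom (PowerSeries.C_injective) p
  have key : ∀ l, ∀ j, PowerSeries.coeff l (u j) = 0 := by
    intro l
    induction l using Nat.strong_induction_on with
    | _ l ih =>
      have h1 : ∀ j, ∃ u' : PowerSeries L,
          u j = PowerSeries.X ^ l * (PowerSeries.C (PowerSeries.coeff l (u j)) +
            PowerSeries.X * u') := by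
        intro j
        obtain ⟨w, hw⟩ := PowerSeries.X_pow_dvd_iff.mpr fun m hm => ih m hm j
        have hc : PowerSeries.coeff l (u j) = PowerSeries.constantCoeff w := by
          rw [hw, PowerSeries.coeff_X_pow_mul', if_pos le_rfl, Nat.sub_self,
            PowerSeries.coeff_zero_eq_constantCoeff_apply]
        obtain ⟨w', hw'⟩ := PowerSeries.X_dvd_iff.mpr
          (show PowerSeries.constantCoeff (w - PowerSeries.C (PowerSeries.constantCoeff w)) = 0 by
            simp)
        refine ⟨w', ?_⟩
        rw [hc, ← hw', add_sub_cancel, ← hw]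
      choose u' hu' using h1
      have h2 : (PowerSeries.X : PowerSeries L) ^ (l * p ^ μ) *
          ∑ j, v j * (PowerSeries.C (PowerSeries.coeff l (u j) ^ p ^ μ) +
            PowerSeries.X ^ p ^ μ * u' j ^ p ^ μ) = 0 := by
        rw [← h, Finset.mul_sum]
        refine Finset.sum_congr rfl fun j _ => ?_
        conv_rhs => rw [hu' j]
        rw [mul_pow, add_pow_char_pow, mul_pow, ← pow_mul, map_pow]
        ring
      have h3 := (mul_eq_zero.mp h2).resolve_left (pow_ne_zero _ PowerSeries.X_ne_zero)
      have h4 := hv (fun j => PowerSeries.coeff l (u j) ^ p ^ μ) ⟨-∑ j, v j * u' j ^ p ^ μ, by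
        rw [mul_neg, eq_neg_iff_add_eq_zero, ← h3, Finset.mul_sum, ← Finset.sum_add_distrib]
        exact Finset.sum_congr rfl fun j _ => by ring⟩
      exact fun j => pow_eq_zero_iff (pow_ne_zero _ (Fact.out : p.Prime).ne_zero) |>.mp
        (congrFun h4 j)
  ext j l
  simpa using key l j

/-- An admissible choice of the degree parameters in Stepanov's method. -/
theorem exists_stepanov_parameters {D : ℕ} (hD : 0 < D) (e : ℕ) :
    ∃ r₀ E : ℕ, ∀ r ≥ r₀, ∃ A B : ℕ, D * (A + e) < r ∧
      A * r + r * e + B + e + 1 ≤ B * (D * A) ∧ D * B ≤ r + D * E := by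
  refine ⟨2 * D * (e + 1) + 3 * e + 6, 2 * e + 5, fun r hr => ?_⟩
  have h1 := Nat.div_add_mod (r - 1 - D * e) D
  have h2 := Nat.mod_lt (r - 1 - D * e) hD
  have h3 := Nat.div_add_mod r D
  have h4 := Nat.mod_lt r hD
  have h0 : 2 * D * (e + 1) = 2 * (D * e) + 2 * D := by ring
  refine ⟨(r - 1 - D * e) / D, r / D + (2 * e + 5), ?_, ?_, ?_⟩
  · rw [mul_add]; omega
  · generalize (r - 1 - D * e) / D = A at *
    generalize hB : r / D = B at *
    have hBr : B ≤ r := hB ▸ Nat.div_le_self r D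
    have h5 : r ≤ 2 * (D * A) := by omega
    have h6 : r + 1 ≤ D * B + D := by omega
    have h7 : D * A ≤ r := by omega
    nlinarith [Nat.mul_le_mul_left A h6, Nat.mul_le_mul_left (2 * e + 4) h5,
      Nat.mul_le_mul_left e h5]
  · rw [mul_add]; omega

variable {L R κ : Type*} [Field L] [CommRing R] [Algebra L[X] R] [Fintype κ]

theorem eq_zero_of_sum_C_mul_X_pow_smul (b : Module.Basis κ L[X] R) {N : ℕ}
    (t : Fin N × κ → L) (h : ∑ q, (C (t q) * X ^ (q.1 : ℕ)) • b q.2 = 0) : t = 0 := by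
  classical
  rw [Fintype.sum_prod_type_right] at h
  simp_rw [← Finset.sum_smul] at h
  ext ⟨i, k⟩
  have h1 := congrArg (fun P : L[X] => P.coeff i) (Fintype.linearIndependent_iff.mp
    b.linearIndependent _ h k)
  simpa [finsetSum_coeff, coeff_X_pow, Fin.val_inj] using h1

theorem stepanov_bound [IsAlgClosed L] {p : ℕ} [Fact p.Prime] [CharP L p] [Nonempty κ]
    (b : Module.Basis κ L[X] R) (Φ : R →+* PowerSeries L)
    (hΦ : Function.Injective Φ) (x₀ : L)
    (hΦX : ∀ P : L[X], Φ (algebraMap L[X] R P) = ((taylor x₀ P : L[X]) : PowerSeries L))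
    (σ : R ≃ₗ[L[X]] R) :
    ∃ c : ℕ, ∀ μ : ℕ, μ ≠ 0 → ∀ s : Finset L,
      (∀ a ∈ s, a ^ (p ^ μ) ^ 2 = a ∧
        ∀ k, algebraMap L[X] R (X - C a) ∣ b k ^ (p ^ μ) ^ 2 - σ (b k)) →
      Fintype.card κ * s.card ≤ (p ^ μ) ^ 2 + c * p ^ μ := by
  classical
  have hR : IsDomain R := hΦ.isDomain Φ
  have hinj : Function.Injective (algebraMap L[X] R) := by
    intro P Q h
    have := congrArg Φ h
    rw [hΦX, hΦX] at this
    exact taylor_injective x₀ (Polynomial.coe_injective L this)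
  have : CharP R p := charP_of_injective_ringHom
    (f := (algebraMap L[X] R).comp C) (hinj.comp C_injective) p
  have hsmul : ∀ (P : L[X]) (v : R), Φ (P • v) = ((taylor x₀ P : L[X]) : PowerSeries L) * Φ v := by
    intro P v
    rw [Algebra.smul_def, map_mul, hΦX]
  obtain ⟨c, hc⟩ := exists_hasDegLE_mul b
  obtain ⟨c₁, hc₁⟩ := exists_hasDegLE b b
  obtain ⟨c₂, hc₂⟩ := exists_hasDegLE b fun k => σ (b k)
  set D := Fintype.card κ with hDdef
  have hD : 0 < D := Fintype.card_pos
  set e := 2 * c₁ + c₂ + c with he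
  obtain ⟨r₀, E, hpar⟩ := exists_stepanov_parameters hD e
  refine ⟨D * r₀ + D * E + D * e + 1 + D * e, fun μ hμ s hs => ?_⟩
  have hr1 : 1 < p ^ μ := Nat.one_lt_pow hμ (Fact.out : p.Prime).one_lt
  have hrr : (p ^ μ) ^ 2 = p ^ (μ * 2) := (pow_mul _ _ _).symm
  obtain ⟨r, hr⟩ : ∃ r, r = p ^ μ := ⟨_, rfl⟩
  rw [← hr] at hs hr1 hrr ⊢
  have hr0 : r ≠ 0 := by omega
  have hroots : s.card ≤ r ^ 2 := by
    have h2 : 1 < r ^ 2 := Nat.one_lt_pow two_ne_zero hr1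
    rw [← FiniteField.X_pow_card_sub_X_natDegree_eq L h2]
    refine card_le_degree_of_subset_roots fun a ha => ?_
    rw [mem_roots (FiniteField.X_pow_card_sub_X_ne_zero L h2), IsRoot.def]
    simp [(hs a ha).1]
  rcases Nat.lt_or_ge r r₀ with hlt | hge
  · nlinarith [Nat.mul_le_mul_left D hroots, Nat.mul_le_mul_left (D * r) hlt.le]
  obtain ⟨A, B, hA, hAB, hB⟩ := hpar r hge
  have hA1 : 0 < A * r := by
    refine Nat.mul_pos (Nat.pos_of_ne_zero ?_) (by omega)
    rintro rfl
    simp at hAB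
  obtain ⟨t, ht0, ht⟩ := exists_ne_zero_sum_smul_eq_zero (ι := (Fin A × κ) × (Fin B × κ)) b
    (n := A * r + B + r * e + e - 1)
    (v := fun q => (X : L[X]) ^ ((q.1.1 : ℕ) * r + q.2.1) • (b q.1.2 ^ r * σ (b q.2.2)))
    (fun q => by
      have h1 := hc _ _ _ _ ((hc₁ q.1.2).pow hc r hr0) (hc₂ q.2.2)
      have h2 := h1.smul (natDegree_X_pow_le (R := L) ((q.1.1 : ℕ) * r + q.2.1))
      refine h2.mono ?_
      have h3 := Nat.mul_le_mul_right r q.1.1.2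
      have h4 := q.2.1.2
      have h5 : r * (c₁ + c) ≤ r * e := Nat.mul_le_mul_left r (by omega)
      rw [Nat.succ_mul] at h3
      omega)
    (by
      simp only [Fintype.card_prod, Fintype.card_fin]
      have : A * r + B + r * e + e - 1 + 1 < B * (D * A) := by
        omega
      calc D * (A * r + B + r * e + e - 1 + 1) < D * (B * (D * A)) :=
            Nat.mul_lt_mul_of_pos_left this hD
        _ = A * D * (B * D) := by ring)
  choose τ hτ using fun q => IsAlgClosed.exists_pow_nat_eq (t q) (n := r) (by omega)
  have hτ0 : τ ≠ 0 := by
    rintro rfl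
    exact ht0 (funext fun q => by rw [← hτ q]; simp [hr0])
  choose τ' hτ' using fun q => IsAlgClosed.exists_pow_nat_eq (τ q) (n := r) (by omega)
  set w : R := ∑ q : (Fin A × κ) × (Fin B × κ),
    (C (τ q) * X ^ (q.1.1 : ℕ) * X ^ ((q.2.1 : ℕ) * r)) •
    (b q.1.2 * b q.2.2 ^ r) with hw
  have hw0 : w ≠ 0 := by
    intro h0
    have hv : ∀ a : Fin A × κ → L, PowerSeries.X ^ p ^ μ ∣
        ∑ j, PowerSeries.C (a j) * Φ ((X : L[X]) ^ (j.1 : ℕ) • b j.2) → a = 0 := by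
      intro a ha
      have h1 : ∑ j, PowerSeries.C (a j) * Φ ((X : L[X]) ^ (j.1 : ℕ) • b j.2) =
          Φ (∑ j, (C (a j) * X ^ (j.1 : ℕ)) • b j.2) := by
        rw [map_sum]
        refine Finset.sum_congr rfl fun j _ => ?_
        rw [mul_smul, hsmul (C _), taylor_C, coe_C]
      rw [h1] at ha
      refine eq_zero_of_sum_C_mul_X_pow_smul b a (by_contra fun hne => ?_)
      have h2 := zero_estimate b Φ hΦ x₀ hΦX hc hc₁ (n := A + c₁) (HasDegLE.sum fun j _ => by
        refine HasDegLE.smul ((natDegree_C_mul_X_pow_le _ _).trans j.1.2.le) (hc₁ _)) hne ha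
      rw [← hr, ← hDdef] at h2
      have h3 : D * (A + c₁ + c₁ + c) ≤ D * (A + e) := Nat.mul_le_mul_left D (by omega)
      omega
    have h1 := eq_zero_of_sum_mul_pow_eq_zero (μ := μ)
      (fun j : Fin A × κ => Φ ((X : L[X]) ^ (j.1 : ℕ) • b j.2))
      (fun j => Φ (∑ i : Fin B × κ, (C (τ' (j, i)) * X ^ (i.1 : ℕ)) • b i.2)) hv (by
        have hsum : w = ∑ j : Fin A × κ, ((X : L[X]) ^ (j.1 : ℕ) • b j.2) *
            (∑ i : Fin B × κ, (C (τ' (j, i)) * X ^ (i.1 : ℕ)) • b i.2) ^ p ^ μ := by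
          rw [hw, Fintype.sum_prod_type]
          refine Finset.sum_congr rfl fun j _ => ?_
          rw [sum_pow_char_pow, Finset.mul_sum]
          refine Finset.sum_congr rfl fun i _ => ?_
          rw [_root_.smul_pow, smul_mul_smul_comm, mul_pow, ← C_pow, ← hr, hτ', ← pow_mul]
          congr 1
          ring
        rw [← map_zero Φ, ← h0, hsum, map_sum]
        simp only [map_mul, map_pow])
    refine hτ0 (funext fun q => ?_)
    have h2 := eq_zero_of_sum_C_mul_X_pow_smul b (fun i => τ' (q.1, i))
      (hΦ ((congrFun h1 q.1).trans (map_zero Φ).symm))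
    rw [← hτ' q, show τ' q = 0 from congrFun h2 q.2, zero_pow hr0, Pi.zero_apply]
  have hwr : w ^ r = ∑ q : (Fin A × κ) × (Fin B × κ),
      C (t q) • ((X : L[X]) ^ ((q.1.1 : ℕ) * r + (q.2.1 : ℕ) * r ^ 2) •
        (b q.1.2 ^ r * b q.2.2 ^ r ^ 2)) := by
    rw [hw, hr, sum_pow_char_pow, ← hr]
    refine Finset.sum_congr rfl fun q _ => ?_
    rw [_root_.smul_pow, mul_pow, mul_pow, mul_pow, ← C_pow, hτ, smul_smul]
    congr 1 <;> ring
  have hvanish : ∀ a ∈ s, ∀ k, (b.repr w k).eval a = 0 := by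
    intro a ha k
    obtain ⟨ha1, ha2⟩ := hs a ha
    have hX : algebraMap L[X] R (X - C a) ∣ algebraMap L[X] R (X ^ r ^ 2 - X) := by
      refine map_dvd _ (dvd_iff_isRoot.mpr ?_)
      simp [ha1]
    have h1 : algebraMap L[X] R (X - C a) ∣ w ^ r := by
      rw [← sub_zero (w ^ r), ← ht, hwr, ← Finset.sum_sub_distrib]
      refine Finset.dvd_sum fun q _ => ?_
      rw [← smul_sub]
      simp only [Algebra.smul_def]
      refine Dvd.dvd.mul_left ?_ _
      have h3 : algebraMap L[X] R (X - C a) ∣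
          (algebraMap L[X] R X ^ r ^ 2) ^ (q.2.1 : ℕ) - algebraMap L[X] R X ^ (q.2.1 : ℕ) := by
        refine dvd_trans ?_ (sub_dvd_pow_sub_pow _ _ _)
        simpa using hX
      obtain ⟨x, hx⟩ := h3
      obtain ⟨y, hy⟩ := ha2 q.2.2
      rw [eq_add_of_sub_eq hy]
      refine ⟨algebraMap L[X] R X ^ ((q.1.1 : ℕ) * r) * b q.1.2 ^ r *
        (algebraMap L[X] R X ^ (r ^ 2 * (q.2.1 : ℕ)) * y + x * σ (b q.2.2)), ?_⟩
      rw [map_pow, map_pow, pow_add, pow_add]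
      rw [← pow_mul] at hx
      rw [mul_comm (q.2.1 : ℕ) (r ^ 2), eq_add_of_sub_eq hx]
      ring
    have h2 : algebraMap L[X] R (X - C a) ∣ w ^ r ^ 2 := by
      rw [pow_two, pow_mul]
      exact h1.trans (dvd_pow_self _ hr0)
    have h3 : algebraMap L[X] R (X - C a) ∣
        σ (∑ k, C ((b.repr w k).eval a ^ r ^ 2) • b k) := by
      rw [map_sum]
      have h4 : w ^ r ^ 2 = ∑ k, (b.repr w k) ^ r ^ 2 • b k ^ r ^ 2 := by
        conv_lhs => rw [← b.sum_repr w]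
        rw [hrr, sum_pow_char_pow]
        simp_rw [_root_.smul_pow]
      rw [h4] at h2
      rw [← dvd_sub_right h2, ← Finset.sum_sub_distrib]
      refine Finset.dvd_sum fun k _ => ?_
      obtain ⟨x, hx⟩ : X - C a ∣ (b.repr w k) ^ r ^ 2 - C ((b.repr w k).eval a ^ r ^ 2) :=
        dvd_iff_isRoot.mpr (by simp)
      obtain ⟨y, hy⟩ := ha2 k
      rw [map_smul, eq_add_of_sub_eq hy, eq_add_of_sub_eq hx, Algebra.smul_def, Algebra.smul_def,
        map_add, map_mul]
      exact ⟨algebraMap L[X] R x * (algebraMap L[X] R (X - C a) * y + σ (b k)) +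
        algebraMap L[X] R (C ((b.repr w k).eval a ^ r ^ 2)) * y, by ring⟩
    obtain ⟨x, hx⟩ := h3
    have h5 : ∑ k, C ((b.repr w k).eval a ^ r ^ 2) • b k = (X - C a) • σ.symm x := by
      apply σ.injective
      rw [hx, map_smul, σ.apply_symm_apply, Algebra.smul_def]
    have h6 := congrArg (fun v => (b.repr v k).eval a) h5
    simpa [hr0, Finsupp.single_apply] using h6
  obtain ⟨k, hk⟩ : ∃ k, b.repr w k ≠ 0 := by
    by_contra! h
    exact hw0 (b.ext_elem fun k => by simp [h k])
  have hcard : s.card ≤ B * r + r * e + A + e := by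
    refine (card_le_degree_of_subset_roots (p := b.repr w k) fun a ha => ?_).trans ?_
    · rw [mem_roots hk]
      exact hvanish a ha k
    · refine HasDegLE.sum (b := b) (n := B * r + r * e + A + e) (fun q _ => ?_) k
      have h1 := hc _ _ _ _ (hc₁ q.1.2) ((hc₁ q.2.2).pow hc r hr0)
      refine (h1.smul (m := q.1.1 + q.2.1 * r) ?_).mono ?_
      · rw [mul_assoc, ← pow_add]
        exact natDegree_C_mul_X_pow_le _ _
      · have h3 := Nat.mul_le_mul_right r q.2.1.2
        have h4 := q.1.1.2
        have h5 : r * (c₁ + c) ≤ r * e := Nat.mul_le_mul_left r (by omega)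
        rw [Nat.succ_mul] at h3
        omega
  have h7 : D * s.card ≤ D * B * r + D * e * r + D * (A + e) := by
    nlinarith [Nat.mul_le_mul_left D hcard]
  nlinarith [Nat.mul_le_mul_right r hB, Nat.zero_le (D * r₀ * r), Nat.zero_le (D * e * r)]

end Stepanov

section KummerArtinSchreier

section Field

variable {F M : Type*} [Field F] [Field M] [Algebra F M]

theorem natDegree_minpoly_of_pow_eq {d : ℕ} (hd : 0 < d) {h : F}
    (hh : ∀ (m : ℕ) (c : F), h ^ m = c ^ d → d ∣ m) {y : M} (hy : y ^ d = algebraMap F M h) :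
    (minpoly F y).natDegree = d := by
  have hmonic : (X ^ d - C h : F[X]).Monic := monic_X_pow_sub_C h hd.ne'
  have hroot : aeval y (X ^ d - C h : F[X]) = 0 := by simp [hy]
  have hint : IsIntegral F y := ⟨_, hmonic, by simpa [aeval_def] using hroot⟩
  have hle : (minpoly F y).natDegree ≤ d := by
    have := natDegree_le_of_dvd (minpoly.dvd F y hroot) hmonic.ne_zero
    rwa [natDegree_X_pow_sub_C] at this
  refine le_antisymm hle (Nat.le_of_dvd (minpoly.natDegree_pos hint) ?_)
  rw [← IntermediateField.adjoin.finrank hint]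
  refine hh _ (Algebra.norm F (IntermediateField.AdjoinSimple.gen F y)) ?_
  rw [← Algebra.norm_algebraMap (S := IntermediateField.adjoin F {y}), ← map_pow]
  congr 1
  apply (algebraMap (IntermediateField.adjoin F {y}) M).injective
  rw [map_pow, IntermediateField.AdjoinSimple.algebraMap_gen, hy]
  rfl

theorem natDegree_minpoly_of_artinSchreier [IsAlgClosed M] {p : ℕ} [Fact p.Prime] [CharP F p]
    {f G : F} (hf : f ≠ 0) (hG : ∀ w : F, w ^ p ≠ f ^ (p - 1) * w + f ^ (p - 1) * G) {z : M}
    (hz : z ^ p = algebraMap F M (f ^ (p - 1)) * z + algebraMap F M (f ^ (p - 1) * G)) :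
    (minpoly F z).natDegree = p := by
  have hp : p.Prime := Fact.out
  have : CharP M p := charP_of_injective_algebraMap (algebraMap F M).injective p
  set P : F[X] := X ^ p - (C (f ^ (p - 1)) * X + C (f ^ (p - 1) * G)) with hP
  have hdeg : (C (f ^ (p - 1)) * X + C (f ^ (p - 1) * G)).degree < (p : WithBot ℕ) :=
    degree_linear_le.trans_lt (by exact_mod_cast hp.one_lt)
  have hmonic : P.Monic := monic_X_pow_sub hdeg
  have hPdeg : P.natDegree = p := by
    rw [hP, natDegree_sub_eq_left_of_natDegree_lt, natDegree_X_pow]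
    rw [natDegree_X_pow]
    exact natDegree_linear_le.trans_lt hp.one_lt
  have hroot : aeval z P = 0 := by simp [hP, hz]
  have hint : IsIntegral F z := ⟨_, hmonic, by simpa [aeval_def] using hroot⟩
  have hle : (minpoly F z).natDegree ≤ p := by
    have := natDegree_le_of_dvd (minpoly.dvd F z hroot) hmonic.ne_zero
    rwa [hPdeg] at this
  refine le_antisymm hle (not_lt.mp fun hlt => ?_)
  set m := (minpoly F z).natDegree with hm
  have hm0 : 0 < m := minpoly.natDegree_pos hint
  have hroots : ∀ r ∈ ((minpoly F z).map (algebraMap F M)).roots,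
      ∃ i : F, r = z + algebraMap F M i := by
    intro r hr
    have h1 : aeval r (minpoly F z) = 0 := by
      have := isRoot_of_mem_roots hr
      rwa [IsRoot.def, eval_map_algebraMap] at this
    have h2 : aeval r P = 0 := by
      obtain ⟨Q, hQ⟩ := minpoly.dvd F z hroot
      rw [hQ, map_mul, h1, zero_mul]
    have h3 : r ^ p = algebraMap F M (f ^ (p - 1)) * r + algebraMap F M (f ^ (p - 1) * G) := by
      simpa [hP, sub_eq_zero] using h2
    have hf' : algebraMap F M f ≠ 0 := by simpa using hf
    have h4 : ((r - z) / algebraMap F M f) ^ p = (r - z) / algebraMap F M f := by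
      rw [div_pow, sub_pow_char, h3, hz, div_eq_div_iff (pow_ne_zero _ hf') hf']
      have : algebraMap F M f ^ p = algebraMap F M f ^ (p - 1) * algebraMap F M f := by
        rw [← pow_succ, Nat.sub_add_cancel hp.one_lt.le]
      rw [this, map_pow]
      ring
    rw [← Subfield.mem_bot_iff_pow_eq_self, _root_.mem_bot_iff_intCast p] at h4
    obtain ⟨n, hn⟩ := h4
    refine ⟨f * n, ?_⟩
    rw [map_mul, map_intCast, hn, mul_div_cancel₀ _ hf']
    ring
  have hsum : ∃ i : F, ((minpoly F z).map (algebraMap F M)).roots.sum =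
      Multiset.card ((minpoly F z).map (algebraMap F M)).roots • z + algebraMap F M i := by
    generalize ((minpoly F z).map (algebraMap F M)).roots = T at hroots
    induction T using Multiset.induction with
    | empty => exact ⟨0, by simp⟩
    | cons a T ih =>
      obtain ⟨i, hi⟩ := ih fun r hr => hroots r (Multiset.mem_cons_of_mem hr)
      obtain ⟨j, hj⟩ := hroots a (Multiset.mem_cons_self a T)
      refine ⟨i + j, ?_⟩
      rw [Multiset.sum_cons, hi, hj, Multiset.card_cons, succ_nsmul, map_add]
      ring
  have hsplit := IsAlgClosed.splits ((minpoly F z).map (algebraMap F M))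
  obtain ⟨i, hi⟩ := hsum
  have h5 := hsplit.nextCoeff_eq_neg_sum_roots_of_monic ((minpoly.monic hint).map _)
  rw [hi, ← hsplit.natDegree_eq_card_roots, natDegree_map, ← hm,
    nextCoeff_map (algebraMap F M).injective, nsmul_eq_mul] at h5
  have hmF : (m : F) ≠ 0 := by
    rw [Ne, CharP.cast_eq_zero_iff F p]
    exact fun hdvd => absurd (Nat.le_of_dvd hm0 hdvd) (by omega)
  have h6 : z = algebraMap F M ((-(minpoly F z).nextCoeff - i) / m) := by
    rw [map_div₀, map_sub, map_neg, h5, map_natCast, eq_div_iff (by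
      simpa using (map_ne_zero (algebraMap F M)).mpr hmF)]
    ring
  refine hG ((-(minpoly F z).nextCoeff - i) / m) ((algebraMap F M).injective ?_)
  rw [map_pow, ← h6, hz, map_add, map_mul _ _ (_ / _), ← h6]

theorem linearIndependent_pow_mul_pow {d e : ℕ} (hde : d.Coprime e) (hd : 0 < d) (he : 0 < e)
    {y z : M} (hy : (minpoly F y).natDegree = d) (hz : (minpoly F z).natDegree = e) :
    LinearIndependent F fun i : Fin d × Fin e => y ^ (i.1 : ℕ) * z ^ (i.2 : ℕ) := by
  have hiy : IsIntegral F y := by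
    by_contra h
    rw [minpoly.eq_zero h, natDegree_zero] at hy
    omega
  have hiz : IsIntegral F z := by
    by_contra h
    rw [minpoly.eq_zero h, natDegree_zero] at hz
    omega
  have H : (IntermediateField.adjoin F {y}).LinearDisjoint (IntermediateField.adjoin F {z}) := by
    apply IntermediateField.LinearDisjoint.of_finrank_coprime
    rw [IntermediateField.adjoin.finrank hiy, IntermediateField.adjoin.finrank hiz, hy, hz]
    exact hde
  have h1 := linearIndependent_pow (K := F) (IntermediateField.AdjoinSimple.gen F y)
  have h2 := linearIndependent_pow (K := F) (IntermediateField.AdjoinSimple.gen F z)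
  rw [IntermediateField.minpoly_gen, hy] at h1
  rw [IntermediateField.minpoly_gen, hz] at h2
  simpa using H.linearIndependent_mul h1 h2

end Field

section Domain

variable {A B : Type*} [CommRing A] [CommRing B] [Algebra A B]

theorem exists_basis_adjoin_pow_mul_pow {d e : ℕ} (hd : 0 < d) (he : 1 < e) {h u v : A}
    {y z : B} (hy : y ^ d = algebraMap A B h)
    (hz : z ^ e = algebraMap A B u * z + algebraMap A B v)
    (hli : LinearIndependent A fun i : Fin d × Fin e => y ^ (i.1 : ℕ) * z ^ (i.2 : ℕ))
    (S : Subalgebra A B) (hS : S = Algebra.adjoin A {y, z}) :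
    ∃ b : Module.Basis (Fin d × Fin e) A S, ∀ i, (b i : B) = y ^ (i.1 : ℕ) * z ^ (i.2 : ℕ) := by
  have hyS : y ∈ S := hS ▸ Algebra.subset_adjoin (by simp)
  have hzS : z ∈ S := hS ▸ Algebra.subset_adjoin (by simp)
  have hmem : ∀ i : Fin d × Fin e, y ^ (i.1 : ℕ) * z ^ (i.2 : ℕ) ∈ S := fun i =>
    S.mul_mem (S.pow_mem hyS _) (S.pow_mem hzS _)
  have hspan : Subalgebra.toSubmodule S ≤
      Submodule.span A (Set.range fun i : Fin d × Fin e => y ^ (i.1 : ℕ) * z ^ (i.2 : ℕ)) := by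
    rw [hS, Algebra.adjoin_eq_span, Submodule.span_le]
    intro w hw
    obtain ⟨m, n, rfl⟩ := (Submonoid.mem_closure_pair _ _ _).mp hw
    rw [SetLike.mem_coe]
    induction n using Nat.strong_induction_on with
    | _ n ih =>
      rcases lt_or_ge n e with hn | hn
      · have h1 : y ^ m * z ^ n = h ^ (m / d) • (y ^ (m % d) * z ^ n) := by
          rw [Algebra.smul_def, map_pow, ← hy, ← pow_mul, ← mul_assoc, ← pow_add,
            Nat.div_add_mod]
        rw [h1]
        exact Submodule.smul_mem _ _
          (Submodule.subset_span ⟨(⟨m % d, Nat.mod_lt _ hd⟩, ⟨n, hn⟩), rfl⟩)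
      · obtain ⟨l, rfl⟩ := Nat.exists_eq_add_of_le hn
        have h1 : y ^ m * z ^ (e + l) = u • (y ^ m * z ^ (l + 1)) + v • (y ^ m * z ^ l) := by
          rw [Algebra.smul_def, Algebra.smul_def, pow_add z, hz]
          ring
        rw [h1]
        refine Submodule.add_mem _ (Submodule.smul_mem _ _ (ih _ (by omega) ?_))
          (Submodule.smul_mem _ _ (ih _ (by omega) ?_)) <;>
        exact (Submonoid.mem_closure_pair _ _ _).mpr ⟨_, _, rfl⟩
  have hli' : LinearIndependent A fun i => (⟨_, hmem i⟩ : S) := by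
    refine LinearIndependent.of_comp S.val.toLinearMap ?_
    exact hli
  refine ⟨Module.Basis.mk hli' ?_, fun i => by rw [Module.Basis.mk_apply]⟩
  rintro ⟨w, hw⟩ -
  have h1 : w ∈ (Submodule.span A (Set.range fun i => (⟨_, hmem i⟩ : S))).map
      S.val.toLinearMap := by
    rw [Submodule.map_span, ← Set.range_comp]
    exact hspan hw
  obtain ⟨w', hw', rfl⟩ := h1
  exact hw'

theorem linearIndependent_pow_mul_pow_of_isDomain [IsDomain A] [IsDomain B]
    (hinj : Function.Injective (algebraMap A B)) {p : ℕ} [Fact p.Prime] [CharP A p]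
    {d : ℕ} (hd : 0 < d) (hdp : d.Coprime p) {h f G : A} (hf : f ≠ 0)
    (hh : ∀ (m : ℕ) (P Q : A), Q ≠ 0 → h ^ m * Q ^ d = P ^ d → d ∣ m)
    (hG : ∀ P Q : A, Q ≠ 0 → P ^ p ≠ f ^ (p - 1) * P * Q ^ (p - 1) + f ^ (p - 1) * G * Q ^ p)
    {y z : B} (hy : y ^ d = algebraMap A B h)
    (hz : z ^ p = algebraMap A B (f ^ (p - 1)) * z + algebraMap A B (f ^ (p - 1) * G)) :
    LinearIndependent A fun i : Fin d × Fin p => y ^ (i.1 : ℕ) * z ^ (i.2 : ℕ) := by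
  have hp : p.Prime := Fact.out
  let M := AlgebraicClosure (FractionRing B)
  let F := FractionRing A
  have hBM : Function.Injective (algebraMap B M) := by
    rw [IsScalarTower.algebraMap_eq B (FractionRing B) M]
    exact (algebraMap (FractionRing B) M).injective.comp (IsFractionRing.injective B _)
  have hAM : Function.Injective (algebraMap A M) := by
    rw [IsScalarTower.algebraMap_eq A B M]
    exact hBM.comp hinj
  have : FaithfulSMul A M := (faithfulSMul_iff_algebraMap_injective A M).mpr hAM
  let : Algebra F M := FractionRing.liftAlgebra A M
  have hAF : Function.Injective (algebraMap A F) := IsFractionRing.injective A F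
  have : CharP F p := charP_of_injective_algebraMap hAF p
  have key : ∀ a : A, algebraMap B M (algebraMap A B a) = algebraMap F M (algebraMap A F a) := by
    intro a
    rw [← IsScalarTower.algebraMap_apply, ← IsScalarTower.algebraMap_apply]
  have h1 : LinearIndependent F fun i : Fin d × Fin p =>
      (algebraMap B M y) ^ (i.1 : ℕ) * (algebraMap B M z) ^ (i.2 : ℕ) := by
    refine linearIndependent_pow_mul_pow hdp hd hp.pos
      (natDegree_minpoly_of_pow_eq (h := algebraMap A F h) hd ?_ ?_)
      (natDegree_minpoly_of_artinSchreier (f := algebraMap A F f) (G := algebraMap A F G) ?_ ?_ ?_)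
    · intro m c hc
      obtain ⟨P, Q, hQ, rfl⟩ := IsFractionRing.div_surjective (A := A) c
      have hQ0 : Q ≠ 0 := nonZeroDivisors.ne_zero hQ
      refine hh m P Q hQ0 (hAF ?_)
      rw [div_pow, eq_div_iff (pow_ne_zero _ (by simpa using hQ0))] at hc
      simpa using hc
    · rw [← map_pow, hy, key]
    · simpa using hf
    · intro w hw
      obtain ⟨P, Q, hQ, rfl⟩ := IsFractionRing.div_surjective (A := A) w
      have hQ0 : Q ≠ 0 := nonZeroDivisors.ne_zero hQ
      have hQ1 : algebraMap A F Q ≠ 0 := by simpa using hQ0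
      refine hG P Q hQ0 (hAF ?_)
      rw [div_pow, div_eq_iff (pow_ne_zero _ hQ1)] at hw
      simp only [map_add, map_mul, map_pow]
      rw [hw]
      have : algebraMap A F Q ^ p = algebraMap A F Q ^ (p - 1) * algebraMap A F Q := by
        rw [← pow_succ, Nat.sub_add_cancel hp.one_lt.le]
      rw [this]
      linear_combination algebraMap A F f ^ (p - 1) * algebraMap A F Q ^ (p - 1) *
        div_mul_cancel₀ (algebraMap A F P) hQ1
    · rw [← map_pow (algebraMap B M), hz, map_add, map_mul, key, key]
      simp only [map_mul, map_pow]
  have h2 := h1.restrict_scalars (R := A) (by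
    intro a b hab
    simpa [Algebra.smul_def] using hab)
  refine LinearIndependent.of_comp (IsScalarTower.toAlgHom A B M).toLinearMap ?_
  convert h2 using 2 with i
  simp

end Domain

end KummerArtinSchreier

section Cover

theorem exists_isRoot_of_constantCoeff {L : Type*} [Field L]
    {P : (PowerSeries L)[X]} (hP : P.Monic) {c : L}
    (hc : (P.map PowerSeries.constantCoeff).eval c = 0)
    (hc' : (Polynomial.derivative (P.map PowerSeries.constantCoeff)).eval c ≠ 0) :
    ∃ y : PowerSeries L, P.eval y = 0 := by
  have hev : ∀ Q : (PowerSeries L)[X], PowerSeries.constantCoeff (Q.eval (PowerSeries.C c)) =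
      (Q.map PowerSeries.constantCoeff).eval c := by
    intro Q
    rw [← Polynomial.eval₂_hom, Polynomial.eval_map, PowerSeries.constantCoeff_C]
  have : HenselianRing (PowerSeries L) (Ideal.span {PowerSeries.X}) :=
    IsAdicComplete.henselianRing _ _
  obtain ⟨y, hy, -⟩ := HenselianRing.is_henselian
    (I := Ideal.span {(PowerSeries.X : PowerSeries L)})
    P hP (PowerSeries.C c) (by
      rw [Ideal.mem_span_singleton, PowerSeries.X_dvd_iff, hev, hc]) (by
      refine IsUnit.map _ ?_
      rw [PowerSeries.isUnit_iff_constantCoeff, hev, ← derivative_map]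
      exact hc'.isUnit)
  exact ⟨y, hy⟩

theorem pow_char_pow_of_artinSchreier {S : Type*} [CommRing S] {p : ℕ} [Fact p.Prime] [CharP S p]
    {z f G : S} (hz : z ^ p = f ^ (p - 1) * z + f ^ (p - 1) * G) (M : ℕ) :
    z ^ p ^ M = f ^ (p ^ M - 1) * z + ∑ i ∈ Finset.range M, f ^ (p ^ M - p ^ i) * G ^ p ^ i := by
  have hp : p.Prime := Fact.out
  induction M with
  | zero => simp
  | succ M ih =>
    have h1 : 0 < p ^ M := pow_pos hp.pos M
    have h2 : (p - 1) + p * (p ^ M - 1) = p ^ (M + 1) - 1 := by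
      have := hp.pos
      rw [Nat.mul_sub, pow_succ']
      have : p * 1 ≤ p * p ^ M := Nat.mul_le_mul_left p h1
      omega
    rw [pow_succ, pow_mul, ih, add_pow_char, sum_pow_char, mul_pow, hz,
      Finset.sum_range_succ', ← pow_mul, pow_zero, pow_one, ← pow_succ, mul_add, ← mul_assoc,
      ← mul_assoc, ← pow_add, mul_comm (p ^ M - 1) p, add_comm (p * _), h2, add_assoc]
    congr 1
    rw [add_comm]
    congr 1
    refine Finset.sum_congr rfl fun i hi => ?_
    rw [mul_pow, ← pow_mul, ← pow_mul, Nat.sub_mul, ← pow_succ, ← pow_succ]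

variable {L : Type*} [Field L] [IsAlgClosed L] {p : ℕ} [Fact p.Prime] [CharP L p]

/-- The cover `y ^ d = h`, `z ^ p - f ^ (p - 1) * z = f ^ (p - 1) * G` of the affine line,
embedded into the power series around a point where it is étale. -/
theorem exists_powerSeries_cover {d : ℕ} (hd : 0 < d) (hdp : d.Coprime p) {h f G : L[X]}
    (hf : f ≠ 0) (hh0 : h ≠ 0) :
    ∃ (x₀ : L) (y z : PowerSeries L), y ^ d = ((taylor x₀ h : L[X]) : PowerSeries L) ∧
      z ^ p = ((taylor x₀ (f ^ (p - 1)) : L[X]) : PowerSeries L) * z +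
        ((taylor x₀ (f ^ (p - 1) * G) : L[X]) : PowerSeries L) := by
  have hp : p.Prime := Fact.out
  obtain ⟨x₀, hx₀⟩ : ∃ x, (h * f).eval x ≠ 0 := by
    by_contra! H
    exact mul_ne_zero hh0 hf (Polynomial.funext fun x => by simpa using H x)
  rw [eval_mul] at hx₀
  have hhx := left_ne_zero_of_mul hx₀
  have hfx := right_ne_zero_of_mul hx₀
  have hcc : ∀ P : L[X], PowerSeries.constantCoeff ((taylor x₀ P : L[X]) : PowerSeries L) =
      P.eval x₀ := by
    intro P
    rw [← PowerSeries.coeff_zero_eq_constantCoeff_apply, Polynomial.coeff_coe, taylor_coeff_zero]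
  have hdL : (d : L) ≠ 0 := by
    rw [Ne, CharP.cast_eq_zero_iff L p]
    intro hdvd
    exact hp.one_lt.ne' (Nat.dvd_one.mp (hdp ▸ Nat.dvd_gcd hdvd dvd_rfl))
  refine ⟨x₀, ?_⟩
  obtain ⟨c, hc⟩ := IsAlgClosed.exists_pow_nat_eq (h.eval x₀) hd
  have hc0 : c ≠ 0 := by
    rintro rfl
    rw [zero_pow hd.ne'] at hc
    exact hhx hc.symm
  obtain ⟨y, hy⟩ := exists_isRoot_of_constantCoeff
    (P := X ^ d - C ((taylor x₀ h : L[X]) : PowerSeries L)) (c := c)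
    (monic_X_pow_sub_C _ hd.ne') (by simp [hcc, hc]) (by simp [derivative_X_pow, hdL, hc0])
  obtain ⟨e, he⟩ := IsAlgClosed.exists_root
    (X ^ p - (C ((f ^ (p - 1)).eval x₀) * X + C ((f ^ (p - 1) * G).eval x₀)) : L[X]) (by
      rw [degree_sub_eq_left_of_degree_lt, degree_X_pow]
      · exact_mod_cast hp.ne_zero
      · rw [degree_X_pow]
        exact degree_linear_le.trans_lt (by exact_mod_cast hp.one_lt))
  obtain ⟨z, hz⟩ := exists_isRoot_of_constantCoeff
    (P := X ^ p - (C ((taylor x₀ (f ^ (p - 1)) : L[X]) : PowerSeries L) * X +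
      C ((taylor x₀ (f ^ (p - 1) * G) : L[X]) : PowerSeries L))) (c := e)
    (monic_X_pow_sub (degree_linear_le.trans_lt (by exact_mod_cast hp.one_lt)))
    (by
      simp only [Polynomial.map_sub, Polynomial.map_add, Polynomial.map_mul, Polynomial.map_pow,
        map_X, map_C, hcc]
      exact he)
    (by
      simp only [Polynomial.map_sub, Polynomial.map_add, Polynomial.map_mul, Polynomial.map_pow,
        map_X, map_C, hcc]
      have hfx' : (f ^ (p - 1)).eval x₀ ≠ 0 := by simp [hfx]
      generalize (f ^ (p - 1)).eval x₀ = u at hfx'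
      generalize (f ^ (p - 1) * G).eval x₀ = v
      simp [derivative_X_pow, hfx'])
  exact ⟨y, z, by simpa [sub_eq_zero] using hy, by simpa [sub_eq_zero] using hz⟩

theorem card_le_of_cover {d : ℕ} (hd : 0 < d) (hdp : d.Coprime p) {h f G : L[X]}
    (hf : f ≠ 0) (hh0 : h ≠ 0)
    (hh : ∀ (m : ℕ) (P Q : L[X]), Q ≠ 0 → h ^ m * Q ^ d = P ^ d → d ∣ m)
    (hG : ∀ P Q : L[X], Q ≠ 0 →
      P ^ p ≠ f ^ (p - 1) * P * Q ^ (p - 1) + f ^ (p - 1) * G * Q ^ p)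
    (c s : L) (hc : c ^ d = 1) (hs : s ^ p = s) :
    ∃ N : ℕ, ∀ μ : ℕ, μ ≠ 0 → d ∣ (p ^ μ) ^ 2 - 1 → ∀ E : Finset L,
      (∀ a ∈ E, a ^ (p ^ μ) ^ 2 = a ∧ f.eval a ≠ 0 ∧ f.eval a ^ (p ^ μ) ^ 2 = f.eval a ∧
        h.eval a ^ (((p ^ μ) ^ 2 - 1) / d) = c ∧
        ∑ i ∈ Finset.range (2 * μ), (G.eval a / f.eval a) ^ p ^ i = s) →
      d * p * E.card ≤ (p ^ μ) ^ 2 + N * p ^ μ := by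
  have hp : p.Prime := Fact.out
  obtain ⟨x₀, y, z, hy, hz⟩ := exists_powerSeries_cover hd hdp (G := G) hf hh0
  let φ : L[X] →+* PowerSeries L := Polynomial.coeToPowerSeries.ringHom.comp
    (taylorAlgHom x₀ : L[X] →ₐ[L] L[X]).toRingHom
  let : Algebra L[X] (PowerSeries L) := φ.toAlgebra
  have hφ : ∀ P : L[X], algebraMap L[X] (PowerSeries L) P =
      ((taylor x₀ P : L[X]) : PowerSeries L) := fun _ => rfl
  have hφinj : Function.Injective (algebraMap L[X] (PowerSeries L)) := fun P Q hPQ =>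
    taylor_injective x₀ (Polynomial.coe_injective L hPQ)
  have : CharP (PowerSeries L) p := charP_of_injective_algebraMap hφinj p
  have hc0 : c ≠ 0 := by
    rintro rfl
    rw [zero_pow hd.ne'] at hc
    exact zero_ne_one hc
  rw [← hφ] at hy
  rw [← hφ, ← hφ] at hz
  let y' := algebraMap L[X] (PowerSeries L) (C c) * y
  let z' := z + algebraMap L[X] (PowerSeries L) (C s * f)
  have hy' : y' ^ d = algebraMap L[X] (PowerSeries L) h := by
    simp only [y']
    rw [mul_pow, hy, ← map_pow, ← C_pow, hc, C_1, map_one, one_mul]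
  have hz' : z' ^ p = algebraMap L[X] (PowerSeries L) (f ^ (p - 1)) * z' +
      algebraMap L[X] (PowerSeries L) (f ^ (p - 1) * G) := by
    simp only [z']
    rw [add_pow_char, hz, ← map_pow, mul_pow, ← C_pow, hs]
    have : f ^ p = f ^ (p - 1) * f := by rw [← pow_succ, Nat.sub_add_cancel hp.one_lt.le]
    rw [this]
    simp only [map_mul]
    ring
  have hli := linearIndependent_pow_mul_pow_of_isDomain hφinj hd hdp hf hh hG hy hz
  have hli' := linearIndependent_pow_mul_pow_of_isDomain hφinj hd hdp hf hh hG hy' hz'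
  let S := Algebra.adjoin L[X] {y, z}
  have hyS : y ∈ S := Algebra.subset_adjoin (by simp)
  have hzS : z ∈ S := Algebra.subset_adjoin (by simp)
  have hS : S = Algebra.adjoin L[X] {y', z'} := by
    refine le_antisymm (Algebra.adjoin_le ?_) (Algebra.adjoin_le ?_)
    · have h1 : y' ∈ Algebra.adjoin L[X] {y', z'} := Algebra.subset_adjoin (by simp)
      have h2 : z' ∈ Algebra.adjoin L[X] {y', z'} := Algebra.subset_adjoin (by simp)
      have h3 : y = algebraMap L[X] (PowerSeries L) (C c⁻¹) * y' := by
        simp only [y']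
        rw [← mul_assoc, ← map_mul, ← C_mul, inv_mul_cancel₀ hc0, C_1, map_one, one_mul]
      have h4 : z = z' - algebraMap L[X] (PowerSeries L) (C s * f) := by simp [z']
      rintro w (rfl | rfl)
      · rw [SetLike.mem_coe, h3]
        exact Subalgebra.mul_mem _ (Subalgebra.algebraMap_mem _ _) h1
      · rw [SetLike.mem_coe, h4]
        exact Subalgebra.sub_mem _ h2 (Subalgebra.algebraMap_mem _ _)
    · rintro w (rfl | rfl)
      · exact Subalgebra.mul_mem _ (Subalgebra.algebraMap_mem _ _) hyS
      · exact Subalgebra.add_mem _ hzS (Subalgebra.algebraMap_mem _ _)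
  obtain ⟨b, hb⟩ := exists_basis_adjoin_pow_mul_pow hd hp.one_lt hy hz hli S rfl
  obtain ⟨b', hb'⟩ := exists_basis_adjoin_pow_mul_pow hd hp.one_lt hy' hz' hli' S hS
  have : Nonempty (Fin d × Fin p) := ⟨(⟨0, hd⟩, ⟨0, hp.pos⟩)⟩
  obtain ⟨N, hN⟩ := stepanov_bound b (S.val : S →+* PowerSeries L) Subtype.val_injective x₀
    (fun P => hφ P) (b.equiv b' (Equiv.refl _))
  refine ⟨N, fun μ hμ hdvd E hE => ?_⟩
  have hcard := hN μ hμ E fun a ha => ?_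
  · simpa using hcard
  obtain ⟨ha, hfa, hfa', hha, hGa⟩ := hE a ha
  refine ⟨ha, fun k => ?_⟩
  rw [Module.Basis.equiv_apply, Equiv.refl_apply]
  have hQ : (p ^ μ) ^ 2 = p ^ (2 * μ) := by rw [← pow_mul, mul_comm]
  generalize hQdef : (p ^ μ) ^ 2 = Q at *
  have hQ0 : 0 < Q := hQ ▸ pow_pos hp.pos _
  set ys : S := ⟨y, hyS⟩ with hys
  set zs : S := ⟨z, hzS⟩ with hzs
  have hval : Function.Injective S.val := Subtype.val_injective
  have hb1 : b k = ys ^ (k.1 : ℕ) * zs ^ (k.2 : ℕ) := hval (by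
    simpa [ys, zs] using hb k)
  have hb2 : b' k = (algebraMap L[X] S (C c) * ys) ^ (k.1 : ℕ) *
      (zs + algebraMap L[X] S (C s * f)) ^ (k.2 : ℕ) := hval (by
    exact hb' k)
  have hmod : ∀ P P' : L[X], P.eval a = P'.eval a →
      algebraMap L[X] S (X - C a) ∣ algebraMap L[X] S P - algebraMap L[X] S P' := by
    intro P P' hPP
    rw [← map_sub]
    exact map_dvd _ (dvd_iff_isRoot.mpr (by simp [hPP]))
  have hys1 : ys ^ d = algebraMap L[X] S h := hval hy
  have hzs1 : zs ^ p = algebraMap L[X] S f ^ (p - 1) * zs +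
      algebraMap L[X] S f ^ (p - 1) * algebraMap L[X] S G := hval (by
    simpa using hz)
  have : CharP S p := charP_of_injective_algebraMap
    (R := L[X]) (A := S) (fun P P' hPP => hφinj (congrArg Subtype.val hPP)) p
  have hy2 : algebraMap L[X] S (X - C a) ∣ ys ^ Q - algebraMap L[X] S (C c) * ys := by
    obtain ⟨x, hx⟩ := hmod (h ^ ((Q - 1) / d)) (C c) (by simpa using hha)
    refine ⟨x * ys, ?_⟩
    have h1 : ys ^ Q = algebraMap L[X] S (h ^ ((Q - 1) / d)) * ys := by
      rw [map_pow, ← hys1, ← pow_mul, Nat.mul_div_cancel' hdvd, ← pow_succ,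
        Nat.sub_add_cancel hQ0]
    rw [h1, ← mul_assoc, ← hx]
    ring
  have hz2 : algebraMap L[X] S (X - C a) ∣ zs ^ Q - (zs + algebraMap L[X] S (C s * f)) := by
    have h1 : f.eval a ^ (Q - 1) = 1 := by
      have : f.eval a ^ (Q - 1) * f.eval a = 1 * f.eval a := by
        rw [← pow_succ, Nat.sub_add_cancel hQ0, hfa', one_mul]
      exact mul_right_cancel₀ hfa this
    obtain ⟨x, hx⟩ := hmod (f ^ (Q - 1)) 1 (by simpa using h1)
    obtain ⟨x', hx'⟩ := hmod (∑ i ∈ Finset.range (2 * μ), f ^ (Q - p ^ i) * G ^ p ^ i) (C s * f) (by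
      rw [eval_finsetSum, eval_mul, eval_C, ← hGa, Finset.sum_mul]
      refine Finset.sum_congr rfl fun i hi => ?_
      have hle : p ^ i ≤ Q := hQ ▸ Nat.pow_le_pow_right hp.pos (Finset.mem_range.mp hi).le
      have hfi : f.eval a ^ p ^ i ≠ 0 := pow_ne_zero _ hfa
      rw [eval_mul, eval_pow, eval_pow, div_pow, div_mul_eq_mul_div, eq_div_iff hfi]
      have : f.eval a ^ (Q - p ^ i) * f.eval a ^ p ^ i = f.eval a := by
        rw [← pow_add, Nat.sub_add_cancel hle, hfa']
      linear_combination G.eval a ^ p ^ i * this)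
    refine ⟨x * zs + x', ?_⟩
    have h2 := pow_char_pow_of_artinSchreier hzs1 (2 * μ)
    rw [← hQ] at h2
    simp only [map_sum, map_mul, map_pow, map_one] at hx hx' ⊢
    rw [h2, mul_add, ← mul_assoc, ← hx, ← hx']
    ring
  rw [hb1, hb2, mul_pow, ← pow_mul, ← pow_mul, mul_comm (k.1 : ℕ), mul_comm (k.2 : ℕ), pow_mul,
    pow_mul]
  obtain ⟨x, hx⟩ := hy2.trans (sub_dvd_pow_sub_pow _ _ (k.1 : ℕ))
  obtain ⟨x', hx'⟩ := hz2.trans (sub_dvd_pow_sub_pow _ _ (k.2 : ℕ))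
  rw [eq_add_of_sub_eq hx, eq_add_of_sub_eq hx']
  exact ⟨x * (algebraMap L[X] S (X - C a) * x' +
    (zs + algebraMap L[X] S (C s * f)) ^ (k.2 : ℕ)) +
    (algebraMap L[X] S (C c) * ys) ^ (k.1 : ℕ) * x', by ring⟩

end Cover

section PowerSums

theorem exists_eq_neg_sum_pow_of_newton {N : ℕ} {l S : ℕ → ℂ} (h0 : l 0 = 1)
    (hN : ∀ k, N < k → l k = 0)
    (hS : ∀ k : ℕ, (k : ℂ) * l k =
      ∑ a ∈ Finset.HasAntidiagonal.antidiagonal k with a.1 < k, l a.1 * S a.2) :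
    ∃ α : Fin N → ℂ, ∀ m, m ≠ 0 → S m = -∑ i, α i ^ m := by
  classical
  set P : ℂ[X] := ∑ k ∈ Finset.range (N + 1), C (l k) * X ^ (N - k) with hP
  have hcoeff : ∀ k ≤ N, P.coeff (N - k) = l k := by
    intro k hk
    rw [hP, finsetSum_coeff, Finset.sum_eq_single k]
    · simp
    · intro j hj hjk
      rw [Finset.mem_range] at hj
      rw [coeff_C_mul_X_pow, if_neg (by omega)]
    · intro hk'
      exact absurd (Finset.mem_range.mpr (by omega)) hk'
  have hdeg : P.natDegree ≤ N := natDegree_sum_le_of_forall_le _ _ fun k _ =>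
    (natDegree_C_mul_X_pow_le _ _).trans (Nat.sub_le _ _)
  have hmonic : P.Monic := monic_of_natDegree_le_of_coeff_eq_one N hdeg (by
    have := hcoeff 0 (Nat.zero_le _)
    rwa [Nat.sub_zero, h0] at this)
  have hdeg' : P.natDegree = N := le_antisymm hdeg (le_natDegree_of_ne_zero (by
    have := hcoeff 0 (Nat.zero_le _)
    rw [Nat.sub_zero, h0] at this
    rw [this]
    exact one_ne_zero))
  have hcard : Multiset.card P.roots = P.natDegree :=
    (IsAlgClosed.splits P).natDegree_eq_card_roots.symm
  have hlen : P.roots.toList.length = N := by rw [Multiset.length_toList, hcard, hdeg']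
  set α : Fin N → ℂ := fun i => P.roots.toList.get (Fin.cast hlen.symm i) with hα
  have hαroots : Multiset.map α Finset.univ.val = P.roots := by
    have h1 : List.ofFn α = P.roots.toList := by
      apply List.ext_get
      · rw [List.length_ofFn, hlen]
      · intro n h1 h2
        simp [hα]
    rw [Fin.univ_val_map, h1, Multiset.coe_toList]
  have hesymm : ∀ k, l k = (-1) ^ k * MvPolynomial.aeval α (MvPolynomial.esymm (Fin N) ℂ k) := by
    intro k
    rw [MvPolynomial.aeval_esymm_eq_multiset_esymm, hαroots]
    rcases le_or_gt k N with hk | hk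
    · rw [← hcoeff k hk, Polynomial.coeff_eq_esymm_roots_of_card hcard (by omega), hdeg',
        hmonic.leadingCoeff, Nat.sub_sub_self hk, one_mul]
    · rw [hN k hk, Multiset.esymm, Multiset.powersetCard_eq_empty _ (by
        rw [hcard, hdeg']; exact hk)]
      simp
  refine ⟨α, fun m => ?_⟩
  have hpsum : ∀ m, MvPolynomial.aeval α (MvPolynomial.psum (Fin N) ℂ m) = ∑ i, α i ^ m := by
    intro m
    simp [MvPolynomial.psum]
  induction m using Nat.strong_induction_on with
  | _ m ih =>
    intro hm
    have h1 := congrArg (MvPolynomial.aeval α) (MvPolynomial.mul_esymm_eq_sum (Fin N) ℂ m)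
    have h2 : (m : ℂ) * l m =
        -∑ a ∈ Finset.HasAntidiagonal.antidiagonal m with a.1 < m, l a.1 * ∑ i, α i ^ a.2 := by
      simp only [map_mul, map_natCast, map_sum, map_pow, map_neg, map_one, hpsum] at h1
      rw [hesymm m, mul_left_comm, h1, ← mul_assoc, ← pow_add, Odd.neg_one_pow ⟨m, by ring⟩,
        neg_one_mul]
      congr 1
      refine Finset.sum_congr rfl fun a _ => ?_
      rw [hesymm a.1]
    rw [hS m, ← Finset.sum_neg_distrib] at h2
    have hmem : (0, m) ∈
      Finset.filter (fun a : ℕ × ℕ => a.1 < m) (Finset.HasAntidiagonal.antidiagonal m) := by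
      simp [Nat.pos_of_ne_zero hm]
    rw [← Finset.add_sum_erase _ _ hmem, ← Finset.add_sum_erase _ _ hmem] at h2
    have h3 : ∑ a ∈ (Finset.filter (fun a : ℕ × ℕ => a.1 < m)
        (Finset.HasAntidiagonal.antidiagonal m)).erase (0, m), l a.1 * S a.2 =
        ∑ a ∈ (Finset.filter (fun a : ℕ × ℕ => a.1 < m)
        (Finset.HasAntidiagonal.antidiagonal m)).erase (0, m), -(l a.1 * ∑ i, α i ^ a.2) := by
      refine Finset.sum_congr rfl fun a ha => ?_
      simp only [Finset.mem_erase, Finset.mem_filter, Finset.HasAntidiagonal.mem_antidiagonal,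
        ne_eq,
        Prod.ext_iff] at ha
      rw [ih a.2 (by omega) (by omega), mul_neg]
    rw [h3] at h2
    simpa [h0] using h2

theorem norm_le_of_norm_sum_pow_le {ι : Type*} [Fintype ι] {β : ι → ℂ} {B C : ℝ} (hB : 0 < B)
    (h : ∀ m, m ≠ 0 → ‖∑ i, β i ^ m‖ ≤ C * B ^ m) (i : ι) : ‖β i‖ ≤ B := by
  classical
  by_contra! hlt
  set ℓ := Lagrange.basis (Finset.univ.image β) id (β i) with hℓ
  have hmem : β i ∈ Finset.univ.image β := Finset.mem_image_of_mem _ (Finset.mem_univ _)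
  have hself : ℓ.eval (β i) = 1 :=
    Lagrange.eval_basis_self (v := id) (Set.injOn_id _) hmem
  have hne : ∀ j, β j ≠ β i → ℓ.eval (β j) = 0 := fun j hj =>
    Lagrange.eval_basis_of_ne (v := id) hj.symm (Finset.mem_image_of_mem _ (Finset.mem_univ _))
  set n : ℕ := (Finset.univ.filter fun j => β j = β i).card with hn
  have hn1 : 1 ≤ n := Finset.card_pos.mpr ⟨i, by simp⟩
  have key : ∀ m, ∑ e ∈ Finset.range (ℓ.natDegree + 1), ℓ.coeff e * ∑ j, β j ^ (m + e) =
      n * β i ^ m := by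
    intro m
    have h1 : ∀ j, β j ^ m * ℓ.eval (β j) = if β j = β i then β i ^ m else 0 := by
      intro j
      split_ifs with hj
      · rw [hj, hself, mul_one]
      · rw [hne j hj, mul_zero]
    calc _ = ∑ j, β j ^ m * ℓ.eval (β j) := by
          simp_rw [eval_eq_sum_range, Finset.mul_sum]
          rw [Finset.sum_comm]
          refine Finset.sum_congr rfl fun j _ => Finset.sum_congr rfl fun e _ => ?_
          rw [pow_add]
          ring
      _ = _ := by
          simp_rw [h1]
          rw [← Finset.sum_filter, Finset.sum_const, nsmul_eq_mul]
  set C' : ℝ := ∑ e ∈ Finset.range (ℓ.natDegree + 1), ‖ℓ.coeff e‖ * (C * B ^ e) with hC'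
  have hbound : ∀ m, m ≠ 0 → ‖β i‖ ^ m ≤ C' * B ^ m := by
    intro m hm
    calc ‖β i‖ ^ m ≤ n * ‖β i‖ ^ m :=
          le_mul_of_one_le_left (by positivity) (by exact_mod_cast hn1)
      _ = ‖(n : ℂ) * β i ^ m‖ := by simp
      _ ≤ ∑ e ∈ Finset.range (ℓ.natDegree + 1), ‖ℓ.coeff e‖ * (C * B ^ (m + e)) := by
          rw [← key m]
          refine (norm_sum_le _ _).trans (Finset.sum_le_sum fun e _ => ?_)
          rw [norm_mul]
          exact mul_le_mul_of_nonneg_left (h _ (by omega)) (norm_nonneg _)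
      _ = C' * B ^ m := by
          rw [hC', Finset.sum_mul]
          exact Finset.sum_congr rfl fun e _ => by rw [pow_add]; ring
  obtain ⟨m, hm⟩ := pow_unbounded_of_one_lt C' ((one_lt_div hB).mpr hlt)
  have hr : 1 < ‖β i‖ / B := (one_lt_div hB).mpr hlt
  have h1 := hbound (m + 1) (Nat.succ_ne_zero m)
  rw [← div_le_iff₀ (pow_pos hB _), ← div_pow] at h1
  exact absurd (hm.trans_le (pow_le_pow_right₀ hr.le (Nat.le_succ m))) (not_lt.mpr h1)

theorem norm_le_mul_sqrt_of_newton {N : ℕ} {l S : ℕ → ℂ} (h0 : l 0 = 1)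
    (hN : ∀ k, N < k → l k = 0)
    (hS : ∀ k : ℕ, (k : ℂ) * l k =
      ∑ a ∈ Finset.HasAntidiagonal.antidiagonal k with a.1 < k, l a.1 * S a.2)
    {q C : ℝ} (hq : 0 < q) (hC : ∀ m, m ≠ 0 → ‖S (2 * m)‖ ≤ C * q ^ m) :
    ‖S 1‖ ≤ N * Real.sqrt q := by
  obtain ⟨α, hα⟩ := exists_eq_neg_sum_pow_of_newton h0 hN hS
  have hβ : ∀ i, ‖α i‖ ≤ Real.sqrt q := by
    intro i
    refine Real.le_sqrt_of_sq_le ?_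
    rw [← norm_pow]
    refine norm_le_of_norm_sum_pow_le (β := fun i => α i ^ 2) hq (C := C) (fun m hm => ?_) i
    have := hC m hm
    rw [hα _ (by omega), norm_neg] at this
    simpa [pow_mul] using this
  rw [hα 1 one_ne_zero, norm_neg]
  calc ‖∑ i, α i ^ 1‖ ≤ ∑ i, ‖α i ^ 1‖ := norm_sum_le _ _
    _ ≤ ∑ _i : Fin N, Real.sqrt q := Finset.sum_le_sum fun i _ => by simpa using hβ i
    _ = N * Real.sqrt q := by simp

end PowerSums

section FrobeniusOrbits

open Function in
theorem Multiset.map_iterate_range_mul {α : Type*} {φ : α → α} {x : α} {e : ℕ}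
    (he : φ^[e] x = x) (j : ℕ) :
    (Multiset.range (e * j)).map (φ^[·] x) = j • (Multiset.range e).map (φ^[·] x) := by
  induction j with
  | zero => simp
  | succ j ih =>
    have hper : φ^[e * j] x = x := by
      rw [iterate_mul]
      exact iterate_fixed he j
    rw [Nat.mul_succ, add_comm, Multiset.range_add, Multiset.map_add, Multiset.map_map, succ_nsmul']
    congr 1
    rw [← ih]
    refine Multiset.map_congr rfl fun i _ => ?_
    rw [comp_apply, add_comm, iterate_add_apply, he]

open Function in
/-- The orbit segments contained in a `φ`-stable multiset `T` that start at `x` are counted by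
the multiplicity of `x`. -/
theorem card_filter_map_iterate_le {α : Type*} [DecidableEq α] {φ : α → α} {T : Multiset α}
    (hT : ∀ x, T.count (φ x) = T.count x) {x : α} (hx : x ∈ periodicPts φ) :
    ((Finset.Icc 1 (Multiset.card T)).filter fun m =>
      φ^[m] x = x ∧ (Multiset.range m).map (φ^[·] x) ≤ T).card = T.count x := by
  set e := minimalPeriod φ x with he
  have he0 : 0 < e := minimalPeriod_pos_of_mem_periodicPts hx
  have hper : φ^[e] x = x := iterate_minimalPeriod
  have hcount : ∀ i, T.count (φ^[i] x) = T.count x := by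
    intro i
    induction i with
    | zero => rfl
    | succ i ih => rw [iterate_succ_apply', hT, ih]
  have hnodup : ((Multiset.range e).map (φ^[·] x)).Nodup := by
    refine (Multiset.nodup_map_iff_of_inj_on ?_).mpr (Multiset.nodup_range e)
    intro i hi j hj hij
    rw [Multiset.mem_range] at hi hj
    exact iterate_injOn_Iio_minimalPeriod (Set.mem_Iio.mpr hi) (Set.mem_Iio.mpr hj) hij
  have hle : ∀ j, (Multiset.range (e * j)).map (φ^[·] x) ≤ T ↔ j ≤ T.count x := by
    intro j
    rw [Multiset.map_iterate_range_mul hper, Multiset.le_iff_count]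
    constructor
    · intro h
      have hx0 : x ∈ (Multiset.range e).map (φ^[·] x) :=
        Multiset.mem_map.mpr ⟨0, Multiset.mem_range.mpr he0, rfl⟩
      simpa [Multiset.count_nsmul, Multiset.count_eq_one_of_mem hnodup hx0] using h x
    · intro h a
      rw [Multiset.count_nsmul]
      by_cases ha : a ∈ (Multiset.range e).map (φ^[·] x)
      · obtain ⟨i, -, rfl⟩ := Multiset.mem_map.mp ha
        rw [Multiset.count_eq_one_of_mem hnodup ha, mul_one, hcount]
        exact h
      · simp [Multiset.count_eq_zero_of_notMem ha]
  have : (Finset.Icc 1 (Multiset.card T)).filter (fun m =>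
      φ^[m] x = x ∧ (Multiset.range m).map (φ^[·] x) ≤ T) =
      (Finset.Icc 1 (T.count x)).image (e * ·) := by
    ext m
    simp only [Finset.mem_filter, Finset.mem_Icc, Finset.mem_image]
    constructor
    · rintro ⟨⟨h1, -⟩, h2, h3⟩
      obtain ⟨j, rfl⟩ : e ∣ m := IsPeriodicPt.minimalPeriod_dvd h2
      exact ⟨j, ⟨Nat.pos_of_mul_pos_left h1 , (hle j).mp h3⟩, rfl⟩
    · rintro ⟨j, ⟨h1, h2⟩, rfl⟩
      have h3 := (hle j).mpr h2
      refine ⟨⟨Nat.mul_pos he0 h1, ?_⟩, ?_, h3⟩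
      · simpa using Multiset.card_le_card h3
      · rw [iterate_mul]
        exact iterate_fixed hper j
  rw [this, Finset.card_image_of_injective _ fun a b h => Nat.eq_of_mul_eq_mul_left he0 h,
    Nat.card_Icc, Nat.add_sub_cancel]

open Function in
theorem sum_card_filter_map_iterate_le {α : Type*} [DecidableEq α] {φ : α → α}
    (hφ : Injective φ) {T : Multiset α} (hT : ∀ x, T.count (φ x) = T.count x) :
    ∑ m ∈ Finset.Icc 1 (Multiset.card T), (T.toFinset.filter fun x =>
      φ^[m] x = x ∧ (Multiset.range m).map (φ^[·] x) ≤ T).card = Multiset.card T := by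
  simp_rw [Finset.card_filter]
  rw [Finset.sum_comm]
  simp_rw [← Finset.card_filter]
  refine Eq.trans ?_ (Multiset.toFinset_sum_count_eq T)
  refine Finset.sum_congr rfl fun x hx => ?_
  rw [Multiset.mem_toFinset] at hx
  refine card_filter_map_iterate_le hT ?_
  have hmem : ∀ i, φ^[i] x ∈ T.toFinset := by
    intro i
    rw [Multiset.mem_toFinset]
    induction i with
    | zero => exact hx
    | succ i ih =>
      rw [iterate_succ_apply', ← Multiset.count_pos, hT, Multiset.count_pos]
      exact ih
  obtain ⟨i, -, j, -, hij, heq⟩ := Set.infinite_univ.exists_ne_map_eq_of_mapsTo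
    (f := fun i : ℕ => φ^[i] x) (t := (T.toFinset : Set α)) (fun i _ => hmem i)
    (Finset.finite_toSet _)
  wlog hlt : i < j generalizing i j
  · exact this j i hij.symm heq.symm (by omega)
  refine mk_mem_periodicPts (n := j - i) (by omega) ?_
  apply hφ.iterate i
  rw [← iterate_add_apply, Nat.add_sub_cancel' hlt.le]
  exact heq.symm

end FrobeniusOrbits

section Newton

variable (K L : Type*) [Field K] [Fintype K] [Field L]

/-- The monic polynomials of degree `k` over a finite field. -/
noncomputable def monicsOfDegree (k : ℕ) : Finset K[X] :=
  (show {M : K[X] | M.Monic ∧ M.natDegree = k}.Finite by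
    have : Finite (degreeLT K (k + 1)) := Module.finite_of_finite K
    refine Set.Finite.subset (Set.toFinite (degreeLT K (k + 1) : Set K[X])) ?_
    rintro M ⟨-, h⟩
    rw [SetLike.mem_coe, mem_degreeLT]
    exact degree_le_natDegree.trans_lt (by exact_mod_cast (by omega))).toFinset

/-- The points of `L` fixed by the `m`-th power of the Frobenius of `K`. -/
noncomputable def frobeniusFixed (m : ℕ) : Finset L :=
  open Classical in (X ^ Fintype.card K ^ m - X : L[X]).roots.toFinset

variable {K L}

theorem mem_monicsOfDegree {k : ℕ} {M : K[X]} :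
    M ∈ monicsOfDegree K k ↔ M.Monic ∧ M.natDegree = k := by
  simp [monicsOfDegree]

theorem mem_frobeniusFixed {m : ℕ} (hm : m ≠ 0) {x : L} :
    x ∈ frobeniusFixed K L m ↔ x ^ Fintype.card K ^ m = x := by
  classical
  rw [frobeniusFixed, Multiset.mem_toFinset, mem_roots
    (FiniteField.X_pow_card_sub_X_ne_zero L (Nat.one_lt_pow hm Fintype.one_lt_card))]
  simp [sub_eq_zero]

variable [Algebra K L]

theorem mem_range_algebraMap_of_pow_card_eq {x : L} (hx : x ^ Fintype.card K = x) :
    x ∈ Set.range (algebraMap K L) := by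
  have h1 : (X ^ Fintype.card K - X : K[X]) = ∏ a : K, (X - C a) := by
    have hroots := FiniteField.roots_X_pow_card_sub_X K
    have hdeg := FiniteField.X_pow_card_sub_X_natDegree_eq K (Fintype.one_lt_card (α := K))
    have hmonic : (X ^ Fintype.card K - X : K[X]).Monic :=
      monic_X_pow_sub (by simpa using Fintype.one_lt_card (α := K))
    have := prod_multiset_X_sub_C_of_monic_of_roots_card_eq hmonic
      (by rw [hroots, hdeg]; rfl)
    rw [hroots] at this
    exact this.symm
  have h2 := congrArg (aeval x) h1
  rw [map_prod] at h2
  simp only [map_sub, map_pow, aeval_X, hx, sub_self, aeval_C] at h2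
  obtain ⟨a, -, ha⟩ := Finset.prod_eq_zero_iff.mp h2.symm
  exact ⟨a, (sub_eq_zero.mp ha).symm⟩

theorem count_aroots_pow_card [DecidableEq L] (M : K[X]) (x : L) :
    (M.aroots L).count (x ^ Fintype.card K) = (M.aroots L).count x := by
  have h := eq_rootMultiplicity_map (p := M.map (algebraMap K L))
    (f := (FiniteField.frobeniusAlgHom K L : L →+* L)) (RingHom.injective _) x
  rw [map_map] at h
  have hc : (FiniteField.frobeniusAlgHom K L : L →+* L).comp (algebraMap K L) = algebraMap K L :=
    AlgHom.comp_algebraMap _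
  rw [hc] at h
  rw [aroots, count_roots, count_roots, h]
  rfl

variable (K) in
/-- The orbit segment of length `m` of `x` under the Frobenius of `K`. -/
noncomputable def frobeniusOrbit (m : ℕ) (x : L) : Multiset L :=
  (Multiset.range m).map fun i => x ^ Fintype.card K ^ i

/-- The characteristic polynomial of the Frobenius orbit of a point. -/
theorem exists_map_eq_prod_X_sub_C {m : ℕ} {x : L} (hx : x ^ Fintype.card K ^ m = x) :
    ∃ P : K[X], P.map (algebraMap K L) =
      ((frobeniusOrbit K m x).map fun a => X - C a).prod := by
  rw [frobeniusOrbit, Multiset.map_map]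
  set P : L[X] := ((Multiset.range m).map fun i => X - C (x ^ Fintype.card K ^ i)).prod with hP
  have h1 : P.map (FiniteField.frobeniusAlgHom K L : L →+* L) = P := by
    have h2 : ∀ i, (X - C (x ^ Fintype.card K ^ i)).map (FiniteField.frobeniusAlgHom K L : L →+* L)
        = X - C (x ^ Fintype.card K ^ (i + 1)) := by
      intro i
      simp [← pow_mul, pow_succ, mul_comm]
    have h3 : P = ∏ i ∈ Finset.range m, (X - C (x ^ Fintype.card K ^ i)) := rfl
    rw [h3, Polynomial.map_prod]
    simp_rw [h2]
    rcases Nat.eq_zero_or_pos m with rfl | hm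
    · simp
    obtain ⟨n, rfl⟩ := Nat.exists_eq_succ_of_ne_zero hm.ne'
    rw [Finset.prod_range_succ, Finset.prod_range_succ' _ n, hx, pow_zero, pow_one]
  have h4 : P ∈ lifts (algebraMap K L) := by
    rw [lifts_iff_coeff_lifts]
    intro n
    apply mem_range_algebraMap_of_pow_card_eq
    conv_rhs => rw [← h1]
    rw [coeff_map]
    rfl
  exact (mem_lifts P).mp h4

theorem sum_filter_frobeniusOrbit_le [DecidableEq L] (lam : L → ℂ) {k m : ℕ} {x : L}
    (hx : x ^ Fintype.card K ^ m = x) (hmk : m ≤ k) :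
    ∑ M ∈ (monicsOfDegree K k).filter (fun M => frobeniusOrbit K m x ≤ M.aroots L),
        ((M.aroots L).map lam).prod =
      (∑ M ∈ monicsOfDegree K (k - m), ((M.aroots L).map lam).prod) *
        ((frobeniusOrbit K m x).map lam).prod := by
  obtain ⟨P, hP⟩ := exists_map_eq_prod_X_sub_C hx
  have hPm : P.Monic := by
    refine monic_of_injective (algebraMap K L).injective ?_
    rw [hP]
    exact monic_multiset_prod_of_monic _ _ fun a _ => monic_X_sub_C a
  have hPr : P.aroots L = frobeniusOrbit K m x := by
    rw [aroots, hP, roots_multiset_prod_X_sub_C]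
  have hPd : P.natDegree = m := by
    rw [← natDegree_map (algebraMap K L), hP, natDegree_multiset_prod_X_sub_C_eq_card]
    simp [frobeniusOrbit]
  rw [Finset.sum_mul]
  symm
  refine Finset.sum_bij (fun M _ => M * P) ?_ ?_ ?_ ?_
  · intro M hM
    rw [mem_monicsOfDegree] at hM
    rw [Finset.mem_filter, mem_monicsOfDegree]
    refine ⟨⟨hM.1.mul hPm, ?_⟩, ?_⟩
    · rw [hM.1.natDegree_mul hPm, hM.2, hPd, Nat.sub_add_cancel hmk]
    · rw [aroots_mul (hM.1.mul hPm).ne_zero, hPr]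
      exact Multiset.le_add_left _ _
  · intro M _ M' _ h
    exact mul_right_cancel₀ hPm.ne_zero h
  · intro M hM
    rw [Finset.mem_filter, mem_monicsOfDegree] at hM
    obtain ⟨⟨hM1, hM2⟩, hM3⟩ := hM
    have hdvd : P ∣ M := by
      rw [← map_dvd_map (algebraMap K L) (algebraMap K L).injective hPm, hP,
        Multiset.prod_X_sub_C_dvd_iff_le_roots (hM1.map _).ne_zero]
      exact hM3
    obtain ⟨M', rfl⟩ := hdvd
    have hM' := hPm.of_mul_monic_left hM1
    refine ⟨M', mem_monicsOfDegree.mpr ⟨hM', ?_⟩, mul_comm _ _⟩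
    rw [hPm.natDegree_mul hM'] at hM2
    omega
  · intro M hM
    rw [mem_monicsOfDegree] at hM
    rw [aroots_mul (hM.1.mul hPm).ne_zero, hPr, Multiset.map_add, Multiset.prod_add]

theorem natCast_mul_sum_monicsOfDegree [IsAlgClosed L] (lam : L → ℂ) (k : ℕ) :
    (k : ℂ) * ∑ M ∈ monicsOfDegree K k, ((M.aroots L).map lam).prod =
      ∑ a ∈ Finset.HasAntidiagonal.antidiagonal k with a.1 < k,
        (∑ M ∈ monicsOfDegree K a.1, ((M.aroots L).map lam).prod) *
          ∑ x ∈ frobeniusFixed K L a.2, ((frobeniusOrbit K a.2 x).map lam).prod := by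
  classical
  have hrhs : ∑ a ∈ Finset.HasAntidiagonal.antidiagonal k with a.1 < k,
        (∑ M ∈ monicsOfDegree K a.1, ((M.aroots L).map lam).prod) *
          ∑ x ∈ frobeniusFixed K L a.2, ((frobeniusOrbit K a.2 x).map lam).prod =
      ∑ m ∈ Finset.Icc 1 k, (∑ M ∈ monicsOfDegree K (k - m), ((M.aroots L).map lam).prod) *
          ∑ x ∈ frobeniusFixed K L m, ((frobeniusOrbit K m x).map lam).prod := by
    refine Finset.sum_bij' (fun a _ => a.2) (fun m _ => (k - m, m)) ?_ ?_ ?_ ?_ ?_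
    · intro a ha
      rw [Finset.mem_filter, Finset.HasAntidiagonal.mem_antidiagonal] at ha
      rw [Finset.mem_Icc]
      omega
    · intro m hm
      rw [Finset.mem_Icc] at hm
      rw [Finset.mem_filter, Finset.HasAntidiagonal.mem_antidiagonal]
      dsimp only
      omega
    · intro a ha
      rw [Finset.mem_filter, Finset.HasAntidiagonal.mem_antidiagonal] at ha
      ext <;> dsimp only
      omega
    · intro m _
      rfl
    · intro a ha
      rw [Finset.mem_filter, Finset.HasAntidiagonal.mem_antidiagonal] at ha
      rw [show k - a.2 = a.1 by omega]
  have hcount : ∀ M ∈ monicsOfDegree K k, (k : ℂ) = ∑ m ∈ Finset.Icc 1 k,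
      ∑ x ∈ frobeniusFixed K L m, if frobeniusOrbit K m x ≤ M.aroots L then 1 else 0 := by
    intro M hM
    rw [mem_monicsOfDegree] at hM
    have hcard : Multiset.card (M.aroots L) = k := by
      rw [← hM.2, ← natDegree_map (algebraMap K L)]
      exact ((IsAlgClosed.splits (M.map (algebraMap K L))).natDegree_eq_card_roots).symm
    have h := sum_card_filter_map_iterate_le (φ := fun x : L => x ^ Fintype.card K)
      (FiniteField.frobeniusAlgHom K L).injective (count_aroots_pow_card M)
    rw [hcard] at h
    conv_lhs => rw [← h, Nat.cast_sum]
    refine Finset.sum_congr rfl fun m hm => ?_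
    rw [Finset.mem_Icc] at hm
    rw [Finset.sum_boole]
    congr 2
    ext x
    simp only [pow_iterate, Finset.mem_filter, Multiset.mem_toFinset,
      mem_frobeniusFixed (K := K) (L := L) (show m ≠ 0 by omega)]
    refine ⟨fun h => h.2, fun h => ⟨?_, h⟩⟩
    refine Multiset.mem_of_le h.2 (Multiset.mem_map.mpr ⟨0, Multiset.mem_range.mpr hm.1, ?_⟩)
    simp
  rw [hrhs, Finset.mul_sum]
  calc ∑ M ∈ monicsOfDegree K k, (k : ℂ) * ((M.aroots L).map lam).prod
      = ∑ M ∈ monicsOfDegree K k, ∑ m ∈ Finset.Icc 1 k, ∑ x ∈ frobeniusFixed K L m,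
          if frobeniusOrbit K m x ≤ M.aroots L then ((M.aroots L).map lam).prod else 0 := by
        refine Finset.sum_congr rfl fun M hM => ?_
        conv_lhs => rw [hcount M hM]
        simp_rw [Finset.sum_mul, ite_mul, one_mul, zero_mul]
    _ = ∑ m ∈ Finset.Icc 1 k, ∑ x ∈ frobeniusFixed K L m, ∑ M ∈ monicsOfDegree K k,
          if frobeniusOrbit K m x ≤ M.aroots L then ((M.aroots L).map lam).prod else 0 := by
        rw [Finset.sum_comm]
        exact Finset.sum_congr rfl fun m _ => Finset.sum_comm
    _ = _ := by
        refine Finset.sum_congr rfl fun m hm => ?_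
        rw [Finset.mem_Icc] at hm
        rw [Finset.mul_sum]
        refine Finset.sum_congr rfl fun x hx => ?_
        rw [mem_frobeniusFixed (by omega)] at hx
        rw [← Finset.sum_filter, sum_filter_frobeniusOrbit_le lam hx hm.2]

theorem sum_monicsOfDegree_zero (lam : L → ℂ) :
    ∑ M ∈ monicsOfDegree K 0, ((M.aroots L).map lam).prod = 1 := by
  have : monicsOfDegree K 0 = {1} := by
    ext M
    rw [mem_monicsOfDegree, Finset.mem_singleton]
    exact ⟨fun h => h.1.natDegree_eq_zero.mp h.2, fun h => h ▸ ⟨monic_one, natDegree_one⟩⟩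
  simp [this]

end Newton

section CharacterCongruence

variable {L : Type*} [Field L]

/-- The product of `lam` over the roots of a monic polynomial depends, up to a power of a constant,
only on the class modulo `F` and on the `e` coefficients following the leading one. -/
def IsCongruenceCharacter (F : L[X]) (e : ℕ) (lam : L → ℂ) : Prop :=
  ∃ κ : ℂ, ∀ (k₀ k : ℕ) (M₁ M₂ : L[X]), M₁.Monic → M₂.Monic → M₁.natDegree = k₀ + k →
    M₂.natDegree = k → e ≤ k → (∀ γ, F.eval γ = 0 → M₁.eval γ ≠ 0) → F ∣ M₁ - M₂ →
    (∀ j ≤ e, M₁.coeff (k₀ + k - j) = M₂.coeff (k - j)) →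
    (M₁.roots.map lam).prod = κ ^ k₀ * (M₂.roots.map lam).prod

variable {F : L[X]} {e : ℕ}

theorem IsCongruenceCharacter.mul {lam mu : L → ℂ} (h1 : IsCongruenceCharacter F e lam)
    (h2 : IsCongruenceCharacter F e mu) : IsCongruenceCharacter F e fun x => lam x * mu x := by
  obtain ⟨κ1, h1⟩ := h1
  obtain ⟨κ2, h2⟩ := h2
  refine ⟨κ1 * κ2, fun k₀ k M₁ M₂ a1 a2 a3 a4 a5 a6 a7 a8 => ?_⟩
  rw [Multiset.prod_map_mul, Multiset.prod_map_mul, h1 k₀ k M₁ M₂ a1 a2 a3 a4 a5 a6 a7 a8,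
    h2 k₀ k M₁ M₂ a1 a2 a3 a4 a5 a6 a7 a8]
  ring

theorem IsCongruenceCharacter.congr {lam mu : L → ℂ} (h1 : IsCongruenceCharacter F e lam)
    (h : ∀ x, F.eval x ≠ 0 → mu x = lam x) : IsCongruenceCharacter F e mu := by
  obtain ⟨κ, h1⟩ := h1
  refine ⟨κ, fun k₀ k M₁ M₂ a1 a2 a3 a4 a5 a6 a7 a8 => ?_⟩
  have e1 : ∀ x ∈ M₁.roots, mu x = lam x := fun x hx =>
    h x fun h0 => a6 x h0 (isRoot_of_mem_roots hx)
  have e2 : ∀ x ∈ M₂.roots, mu x = lam x := fun x hx => h x fun h0 => a6 x h0 <| by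
    have := eval_dvd (x := x) a7
    rw [h0, zero_dvd_iff, eval_sub, show M₂.eval x = 0 from isRoot_of_mem_roots hx,
      sub_zero] at this
    exact this
  rw [Multiset.map_congr rfl e1, Multiset.map_congr rfl e2]
  exact h1 k₀ k M₁ M₂ a1 a2 a3 a4 a5 a6 a7 a8

theorem Multiset.sum_map_pow_eq_of_esymm_eq {s t : Multiset L} (e : ℕ)
    (h : ∀ j ≤ e, s.esymm j = t.esymm j) {j : ℕ} (hj : j ≠ 0) (hje : j ≤ e) :
    (s.map (· ^ j)).sum = (t.map (· ^ j)).sum := by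
  have key : ∀ s : Multiset L, ∀ k, 0 < k → (s.map (· ^ k)).sum =
      (-1) ^ (k + 1) * k * s.esymm k - ∑ a ∈ Finset.HasAntidiagonal.antidiagonal k with
        a.1 ∈ Set.Ioo 0 k, (-1) ^ a.fst * s.esymm a.1 * (s.map (· ^ a.2)).sum := by
    intro s k hk
    obtain ⟨l, rfl⟩ := Quot.exists_rep s
    have hl : (Finset.univ.val.map l.get : Multiset L) = (l : Multiset L) := by
      simp
    have := congrArg (MvPolynomial.aeval (R := L) l.get)
      (MvPolynomial.psum_eq_mul_esymm_sub_sum (Fin l.length) L k hk)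
    have hp : ∀ k, MvPolynomial.aeval (R := L) l.get (MvPolynomial.psum (Fin l.length) L k) =
        ((l : Multiset L).map (· ^ k)).sum := by
      intro k
      rw [← hl, Multiset.map_map, MvPolynomial.psum, map_sum]
      simp only [map_pow, MvPolynomial.aeval_X]
      rfl
    simp only [map_sub, map_mul, map_sum, map_pow, map_neg, map_one, map_natCast, hp,
      MvPolynomial.aeval_esymm_eq_multiset_esymm, hl] at this
    exact this
  induction j using Nat.strong_induction_on with
  | _ j ih =>
    rw [key s j (by omega), key t j (by omega), h j hje]
    congr 1
    refine Finset.sum_congr rfl fun a ha => ?_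
    rw [Finset.mem_filter, Finset.HasAntidiagonal.mem_antidiagonal, Set.mem_Ioo] at ha
    rw [h a.1 (by omega), ih a.2 (by omega) (by omega) (by omega)]

variable [IsAlgClosed L]

theorem isCongruenceCharacter_const (c : ℂ) : IsCongruenceCharacter F e fun _ => c := by
  refine ⟨c, fun k₀ k M₁ M₂ a1 a2 a3 a4 a5 a6 a7 a8 => ?_⟩
  simp only [Multiset.map_const', Multiset.prod_replicate,
    ← (IsAlgClosed.splits _).natDegree_eq_card_roots, a3, a4, pow_add]

theorem IsCongruenceCharacter.finsetProd {ι : Type*} (s : Finset ι) {lam : ι → L → ℂ}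
    (h : ∀ i ∈ s, IsCongruenceCharacter F e (lam i)) :
    IsCongruenceCharacter F e fun x => ∏ i ∈ s, lam i x := by
  classical
  induction s using Finset.induction_on with
  | empty => simpa using isCongruenceCharacter_const 1
  | insert i s hi ih =>
    simp_rw [Finset.prod_insert hi]
    exact (h i (Finset.mem_insert_self i s)).mul
      (ih fun j hj => h j (Finset.mem_insert_of_mem hj))

theorem IsCongruenceCharacter.multisetProd {ι : Type*} (s : Multiset ι) {lam : ι → L → ℂ}
    (h : ∀ i ∈ s, IsCongruenceCharacter F e (lam i)) :
    IsCongruenceCharacter F e fun x => (s.map fun i => lam i x).prod := by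
  induction s using Multiset.induction_on with
  | empty => simpa using isCongruenceCharacter_const 1
  | cons i s ih =>
    simp_rw [Multiset.map_cons, Multiset.prod_cons]
    exact (h i (Multiset.mem_cons_self i s)).mul
      (ih fun j hj => h j (Multiset.mem_cons_of_mem hj))

theorem IsCongruenceCharacter.pow {lam : L → ℂ} (h : IsCongruenceCharacter F e lam) (m : ℕ) :
    IsCongruenceCharacter F e fun x => lam x ^ m := by
  simpa using IsCongruenceCharacter.finsetProd (Finset.range m) (lam := fun _ => lam) fun _ _ => h

theorem isCongruenceCharacter_sub (χ : L →* ℂ) {β : L} (hβ : F.IsRoot β) :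
    IsCongruenceCharacter F e fun x => χ (x - β) := by
  refine ⟨χ (-1), fun k₀ k M₁ M₂ a1 a2 a3 a4 a5 a6 a7 a8 => ?_⟩
  have key : ∀ M : L[X], M.Monic →
      (M.roots.map fun x => χ (x - β)).prod = χ (-1) ^ M.natDegree * χ (M.eval β) := by
    intro M hM
    have h1 := (IsAlgClosed.splits M).eval_eq_prod_roots_of_monic hM β
    have h2 : (M.roots.map fun x => χ (x - β)) = M.roots.map fun x => χ (-1) * χ (β - x) := by
      refine Multiset.map_congr rfl fun x _ => ?_
      rw [← map_mul]
      ring_nf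
    rw [h2, Multiset.prod_map_mul, h1, Multiset.map_const', Multiset.prod_replicate,
      ← (IsAlgClosed.splits _).natDegree_eq_card_roots, map_multiset_prod, Multiset.map_map]
    rfl
  have hev : M₁.eval β = M₂.eval β := by
    have := eval_dvd (x := β) a7
    rwa [hβ.eq_zero, zero_dvd_iff, eval_sub, sub_eq_zero] at this
  rw [key M₁ a1, key M₂ a2, hev, a3, a4, pow_add, mul_assoc]

theorem AddChar.map_multiset_sum_map {A : Type*} [AddCommMonoid A] {ι : Type*} (Ψ : AddChar A ℂ)
    (s : Multiset ι) (f : ι → A) : Ψ (s.map f).sum = (s.map fun i => Ψ (f i)).prod := by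
  induction s using Multiset.induction_on with
  | empty => simp
  | cons i s ih => simp [AddChar.map_add_eq_mul, ih]

theorem AddChar.map_finset_sum {A : Type*} [AddCommMonoid A] {ι : Type*} (Ψ : AddChar A ℂ)
    (s : Finset ι) (f : ι → A) : Ψ (∑ i ∈ s, f i) = ∏ i ∈ s, Ψ (f i) :=
  AddChar.map_multiset_sum_map Ψ s.val f

theorem isCongruenceCharacter_addChar_inv_sub (Ψ : AddChar L ℂ) (c : L) {β : L}
    (hβ : (X - C β) ^ 2 ∣ F) : IsCongruenceCharacter F e fun x => Ψ (c * (x - β)⁻¹) := by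
  refine ⟨1, fun k₀ k M₁ M₂ a1 a2 a3 a4 a5 a6 a7 a8 => ?_⟩
  have hF : F.eval β = 0 := by
    have := eval_dvd (x := β) hβ
    simpa using this
  obtain ⟨R, hR⟩ := hβ.trans a7
  have hM : M₁ = M₂ + (X - C β) ^ 2 * R := by rw [← hR]; ring
  have hev : M₁.eval β = M₂.eval β := by simp [hM]
  have hder : (derivative M₁).eval β = (derivative M₂).eval β := by
    simp [hM, derivative_mul, derivative_pow]
  have h1 : M₁.eval β ≠ 0 := a6 β hF
  have key : ∀ M : L[X], M.eval β ≠ 0 → (M.roots.map fun x => Ψ (c * (x - β)⁻¹)).prod =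
      Ψ (- c * ((derivative M).eval β / M.eval β)) := by
    intro M hM
    rw [← AddChar.map_multiset_sum_map,
      (IsAlgClosed.splits M).eval_derivative_div_eval_of_ne_zero hM, ← Multiset.sum_map_mul_left]
    congr 3
    ext x
    rw [← neg_sub β x, inv_neg, one_div]
    ring
  rw [key M₁ h1, key M₂ (hev ▸ h1), hev, hder, one_pow, one_mul]

theorem isCongruenceCharacter_addChar_pow (Ψ : AddChar L ℂ) (c : L) {j : ℕ} (hj : j ≤ e) :
    IsCongruenceCharacter F e fun x => Ψ (c * x ^ j) := by
  rcases eq_or_ne j 0 with rfl | hj0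
  · simpa using isCongruenceCharacter_const _
  refine ⟨1, fun k₀ k M₁ M₂ a1 a2 a3 a4 a5 a6 a7 a8 => ?_⟩
  rw [one_pow, one_mul, ← AddChar.map_multiset_sum_map, ← AddChar.map_multiset_sum_map,
    Multiset.sum_map_mul_left, Multiset.sum_map_mul_left]
  congr 2
  refine Multiset.sum_map_pow_eq_of_esymm_eq e (fun i hi => ?_) hj0 hj
  have h1 := coeff_eq_esymm_roots_of_card
    ((IsAlgClosed.splits M₁).natDegree_eq_card_roots).symm (k := k₀ + k - i) (by omega)
  have h2 := coeff_eq_esymm_roots_of_card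
    ((IsAlgClosed.splits M₂).natDegree_eq_card_roots).symm (k := k - i) (by omega)
  rw [a1.leadingCoeff, a3, show k₀ + k - (k₀ + k - i) = i by omega] at h1
  rw [a2.leadingCoeff, a4, show k - (k - i) = i by omega] at h2
  have h3 := a8 i hi
  rw [h1, h2, one_mul] at h3
  exact mul_left_cancel₀ (pow_ne_zero _ (neg_ne_zero.mpr one_ne_zero)) h3

theorem isCongruenceCharacter_eval (χ : L →* ℂ) {P : L[X]} (hP : ∀ β ∈ P.roots, F.IsRoot β) :
    IsCongruenceCharacter F e fun x => χ (P.eval x) := by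
  have h : (fun x => χ (P.eval x)) = fun x => χ P.leadingCoeff *
      (P.roots.map fun β => χ (x - β)).prod := by
    ext x
    rw [(IsAlgClosed.splits P).eval_eq_prod_roots, map_mul, map_multiset_prod, Multiset.map_map]
    rfl
  rw [h]
  exact (isCongruenceCharacter_const _).mul
    (IsCongruenceCharacter.multisetProd _ fun β hβ => isCongruenceCharacter_sub χ (hP β hβ))

theorem isCongruenceCharacter_addChar_eval (Ψ : AddChar L ℂ) {P : L[X]} (hP : P.natDegree ≤ e) :
    IsCongruenceCharacter F e fun x => Ψ (P.eval x) := by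
  have h : (fun x => Ψ (P.eval x)) = fun x => ∏ i ∈ Finset.range (P.natDegree + 1),
      Ψ (P.coeff i * x ^ i) := by
    ext x
    rw [eval_eq_sum_range, AddChar.map_finset_sum]
  rw [h]
  exact IsCongruenceCharacter.finsetProd _ fun i hi => isCongruenceCharacter_addChar_pow Ψ _ (by
    rw [Finset.mem_range] at hi
    omega)

theorem isCongruenceCharacter_addChar_eval_div (Ψ : AddChar L ℂ) {P Q : L[X]} (hQ : Q.Separable)
    (hQF : Q ^ 2 ∣ F) (hP : P.natDegree ≤ e) :
    IsCongruenceCharacter F e fun x => Ψ (P.eval x / Q.eval x) := by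
  classical
  have hQ0 : Q ≠ 0 := hQ.ne_zero
  set s := Q.roots.toFinset with hs
  have hQs : Q = C Q.leadingCoeff * Lagrange.nodal s id := by
    conv_lhs => rw [(IsAlgClosed.splits Q).eq_prod_roots]
    rw [Lagrange.nodal_eq, Finset.prod, hs, Multiset.toFinset_val,
      (nodup_roots hQ).dedup]
    rfl
  set R := P % Q with hR
  have hRdeg : R.degree < s.card := by
    have : (s.card : WithBot ℕ) = Q.degree := by
      rw [hs, Multiset.toFinset_card_of_nodup (nodup_roots hQ),
        ← (IsAlgClosed.splits Q).natDegree_eq_card_roots, degree_eq_natDegree hQ0]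
    rw [this]
    exact EuclideanDomain.mod_lt _ hQ0
  have hRi := Lagrange.eq_interpolate (s := s) (v := id) Function.injective_id.injOn hRdeg
  have hdivdeg : (P / Q).natDegree ≤ e := by
    refine le_trans ?_ hP
    exact natDegree_le_natDegree (degree_div_le P Q)
  have hmain : IsCongruenceCharacter F e fun x => Ψ ((P / Q).eval x) *
      ∏ β ∈ s, Ψ (Q.leadingCoeff⁻¹ * Lagrange.nodalWeight s id β * R.eval β * (x - β)⁻¹) := by
    refine (isCongruenceCharacter_addChar_eval Ψ hdivdeg).mul
      (IsCongruenceCharacter.finsetProd _ fun β hβ => ?_)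
    refine isCongruenceCharacter_addChar_inv_sub Ψ _ ?_
    rw [hs, Multiset.mem_toFinset, mem_roots hQ0] at hβ
    exact (pow_dvd_pow_of_dvd (dvd_iff_isRoot.mpr hβ) 2).trans hQF
  refine hmain.congr fun x hx => ?_
  have hQx : Q.eval x ≠ 0 := by
    intro h0
    have := eval_dvd (x := x) hQF
    rw [eval_pow, h0, zero_pow two_ne_zero, zero_dvd_iff] at this
    exact hx this
  rw [← AddChar.map_finset_sum, ← AddChar.map_add_eq_mul]
  congr 1
  have hxs : ∀ β ∈ s, x ≠ id β := by
    rintro β hβ rfl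
    rw [hs, Multiset.mem_toFinset, mem_roots hQ0] at hβ
    exact hQx hβ
  have h1 : R.eval x = (Lagrange.nodal s id).eval x *
      ∑ β ∈ s, Lagrange.nodalWeight s id β * (x - β)⁻¹ * R.eval β := by
    conv_lhs => rw [hRi]
    rw [Lagrange.eval_interpolate_not_at_node _ hxs]
    rfl
  have h2 : P.eval x = (P / Q).eval x * Q.eval x + R.eval x := by
    rw [← eval_mul, ← eval_add, mul_comm, EuclideanDomain.div_add_mod]
  rw [h2, add_div, mul_div_cancel_right₀ _ hQx, h1]
  congr 1
  have h3 : Q.eval x = Q.leadingCoeff * (Lagrange.nodal s id).eval x := by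
    conv_lhs => rw [hQs]
    simp
  have h4 : (Lagrange.nodal s id).eval x ≠ 0 := fun h => hQx (by rw [h3, h, mul_zero])
  have h5 : Q.leadingCoeff ≠ 0 := leadingCoeff_ne_zero.mpr hQ0
  rw [h3, mul_comm Q.leadingCoeff, mul_div_mul_left _ _ h4, Finset.sum_div]
  refine Finset.sum_congr rfl fun β _ => ?_
  field_simp

end CharacterCongruence

section Vanishing

theorem coeff_iterate_divX {R : Type*} [Semiring R] (m : ℕ) (P : R[X]) (j : ℕ) :
    (divX^[m] P).coeff j = P.coeff (j + m) := by
  induction m generalizing P with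
  | zero => rfl
  | succ m ih => rw [Function.iterate_succ_apply, ih, coeff_divX, add_assoc]

variable {K L : Type*} [Field K] [Field L] [Algebra K L]

theorem prod_map_aroots_eq_zero {F M : K[X]} {lam : L → ℂ} (hM : M ≠ 0)
    (h0 : ∀ x, (F.map (algebraMap K L)).eval x = 0 → lam x = 0)
    (h : ∃ x, (F.map (algebraMap K L)).eval x = 0 ∧ (M.map (algebraMap K L)).eval x = 0) :
    ((M.aroots L).map lam).prod = 0 := by
  obtain ⟨x, h1, h2⟩ := h
  refine Multiset.prod_eq_zero (Multiset.mem_map.mpr ⟨x, ?_, h0 x h1⟩)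
  rw [aroots, mem_roots (map_ne_zero hM)]
  exact h2

variable [Fintype K] [IsAlgClosed L]

/-- If `lam` is a congruence character modulo `F` with `e` leading coefficients, then either its
sums over monic polynomials of large degree vanish, or it is trivial. -/
theorem IsCongruenceCharacter.sum_monicsOfDegree_eq_zero_or {F : K[X]} {e : ℕ} (hF : F ≠ 0)
    {lam : L → ℂ} (hlam : IsCongruenceCharacter (F.map (algebraMap K L)) e lam)
    (h0 : ∀ x, (F.map (algebraMap K L)).eval x = 0 → lam x = 0) :
    (∀ k, F.natDegree + e ≤ k → ∑ M ∈ monicsOfDegree K k, ((M.aroots L).map lam).prod = 0) ∨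
      ∃ κ : ℂ, ∀ M : K[X], M.Monic → (∀ x, (F.map (algebraMap K L)).eval x = 0 →
        (M.map (algebraMap K L)).eval x ≠ 0) → ((M.aroots L).map lam).prod = κ ^ M.natDegree := by
  classical
  obtain ⟨κ, hκ⟩ := hlam
  by_contra! hcon
  obtain ⟨⟨k, hk, hne⟩, hM⟩ := hcon
  obtain ⟨M₀, hM₀, hcop, hM₀ne⟩ := hM κ
  apply hne
  set k₀ := M₀.natDegree with hk₀
  let Q₀ : K[X] → K[X] := fun M => divX^[k₀] (M₀ * M)
  have hQ₀ : ∀ M j, (Q₀ M).coeff j = (M₀ * M).coeff (j + k₀) := fun M j =>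
    coeff_iterate_divX k₀ _ j
  let T : K[X] → K[X] := fun M => Q₀ M - (Q₀ M - M₀ * M) % F
  have hTcoeff : ∀ M j, F.natDegree ≤ j → (T M).coeff j = (M₀ * M).coeff (j + k₀) := by
    intro M j hj
    have : ((Q₀ M - M₀ * M) % F).coeff j = 0 := coeff_eq_zero_of_degree_lt <|
      (EuclideanDomain.mod_lt _ hF).trans_le (degree_le_natDegree.trans (by exact_mod_cast hj))
    rw [coeff_sub, this, hQ₀, sub_zero]
  have hTdvd : ∀ M, F ∣ M₀ * M - T M := by
    intro M
    have := EuclideanDomain.div_add_mod (Q₀ M - M₀ * M) F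
    refine ⟨-((Q₀ M - M₀ * M) / F), ?_⟩
    simp only [T]
    linear_combination this
  have hTmem : ∀ M ∈ monicsOfDegree K k, T M ∈ monicsOfDegree K k := by
    intro M hM
    rw [mem_monicsOfDegree] at hM ⊢
    have hdeg : (M₀ * M).natDegree = k₀ + k := by rw [hM₀.natDegree_mul hM.1, hM.2]
    have hle : (T M).natDegree ≤ k := by
      rw [natDegree_le_iff_coeff_eq_zero]
      intro j hj
      rw [hTcoeff M j (by omega)]
      exact coeff_eq_zero_of_natDegree_lt (by omega)
    have hone : (T M).coeff k = 1 := by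
      rw [hTcoeff M k (by omega), add_comm, ← hdeg]
      exact (hM₀.mul hM.1)
    have hmon := monic_of_natDegree_le_of_coeff_eq_one k hle hone
    refine ⟨hmon, le_antisymm hle (le_natDegree_of_ne_zero (by rw [hone]; exact one_ne_zero))⟩
  have hTinj : Set.InjOn T (monicsOfDegree K k) := by
    intro M hM N hN hMN
    have h1 : F ∣ M₀ * (M - N) := by
      have := dvd_sub (hTdvd M) (hTdvd N)
      rw [hMN] at this
      convert this using 1
      ring
    have hco : IsCoprime F M₀ := by
      rw [← isCoprime_map (algebraMap K L), isCoprime_iff_aeval_ne_zero_of_isAlgClosed L L]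
      intro x
      by_cases hx : (F.map (algebraMap K L)).eval x = 0
      · right
        simpa using hcop x hx
      · left
        simpa using hx
    have h2 := hco.dvd_of_dvd_mul_left h1
    have h3 : (M₀ * (M - N)).degree < (k₀ + F.natDegree : ℕ) := by
      rw [degree_lt_iff_coeff_zero]
      intro j hj
      obtain ⟨i, rfl⟩ := Nat.exists_eq_add_of_le hj
      have e1 := hTcoeff M (F.natDegree + i) (by omega)
      have e2 := hTcoeff N (F.natDegree + i) (by omega)
      rw [show k₀ + F.natDegree + i = F.natDegree + i + k₀ by ring, mul_sub, coeff_sub, ← e1, ← e2,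
        hMN, sub_self]
    by_contra hne
    have hne' : M - N ≠ 0 := sub_ne_zero.mpr hne
    rw [degree_eq_natDegree (mul_ne_zero hM₀.ne_zero hne'), natDegree_mul hM₀.ne_zero hne'] at h3
    have h4 := natDegree_le_of_dvd h2 hne'
    have h5 : k₀ + (M - N).natDegree < k₀ + F.natDegree := by exact_mod_cast h3
    omega
  have hTimage : (monicsOfDegree K k).image T = monicsOfDegree K k :=
    Finset.eq_of_subset_of_card_le (Finset.image_subset_iff.mpr hTmem)
      (by rw [Finset.card_image_of_injOn hTinj])
  have hTprod : ∀ M ∈ monicsOfDegree K k, ((M₀.aroots L).map lam).prod * ((M.aroots L).map lam).prod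
      = κ ^ k₀ * (((T M).aroots L).map lam).prod := by
    intro M hM
    have hTM := hTmem M hM
    rw [mem_monicsOfDegree] at hM hTM
    have hdvd : F.map (algebraMap K L) ∣
        (M₀ * M).map (algebraMap K L) - (T M).map (algebraMap K L) := by
      rw [← Polynomial.map_sub]
      exact Polynomial.map_dvd _ (hTdvd M)
    by_cases hMF : ∃ x, (F.map (algebraMap K L)).eval x = 0 ∧ (M.map (algebraMap K L)).eval x = 0
    · rw [prod_map_aroots_eq_zero hM.1.ne_zero h0 hMF, mul_zero]
      obtain ⟨x, hx1, hx2⟩ := hMF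
      rw [prod_map_aroots_eq_zero hTM.1.ne_zero h0 ⟨x, hx1, ?_⟩, mul_zero]
      have := eval_dvd (x := x) hdvd
      rw [hx1, zero_dvd_iff, eval_sub, Polynomial.map_mul, eval_mul, hx2, mul_zero, zero_sub,
        neg_eq_zero] at this
      exact this
    · push Not at hMF
      rw [← Multiset.prod_add, ← Multiset.map_add, ← aroots_mul (hM₀.mul hM.1).ne_zero]
      refine hκ k₀ k _ _ ((hM₀.mul hM.1).map _) (hTM.1.map _) ?_ ?_ (by omega) ?_ hdvd ?_
      · rw [natDegree_map, hM₀.natDegree_mul hM.1, hM.2]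
      · rw [natDegree_map, hTM.2]
      · intro x hx
        rw [Polynomial.map_mul, eval_mul]
        exact mul_ne_zero (hcop x hx) (hMF x hx)
      · intro j hj
        rw [coeff_map, coeff_map, hTcoeff M _ (by omega), show k₀ + k - j = k - j + k₀ by omega]
  have hsum : ((M₀.aroots L).map lam).prod * ∑ M ∈ monicsOfDegree K k, ((M.aroots L).map lam).prod =
      κ ^ k₀ * ∑ M ∈ monicsOfDegree K k, ((M.aroots L).map lam).prod := by
    rw [Finset.mul_sum, Finset.sum_congr rfl hTprod, ← Finset.mul_sum]
    congr 1
    conv_rhs => rw [← hTimage]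
    rw [Finset.sum_image hTinj]
  by_contra hS
  exact hM₀ne (mul_right_cancel₀ hS hsum)

end Vanishing

theorem norm_sum_le_of_card_fiber_le {α ι : Type*} [DecidableEq ι] {E : Finset α} {T : Finset ι}
    {cls : α → ι} (hcls : ∀ x ∈ E, cls x ∈ T) {W : ι → ℂ} (hW : ∀ t ∈ T, ‖W t‖ ≤ 1)
    (hW0 : ∑ t ∈ T, W t = 0) {B : ℝ}
    (hB : ∀ t ∈ T, ((E.filter fun x => cls x = t).card : ℝ) ≤ B) :
    ‖∑ x ∈ E, W (cls x)‖ ≤ T.card * B - E.card := by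
  have h1 : ∑ x ∈ E, W (cls x) = ∑ t ∈ T, ((E.filter fun x => cls x = t).card : ℂ) * W t := by
    rw [← Finset.sum_fiberwise_of_maps_to hcls]
    refine Finset.sum_congr rfl fun t _ => ?_
    rw [← nsmul_eq_mul, ← Finset.sum_const]
    exact Finset.sum_congr rfl fun x hx => by rw [(Finset.mem_filter.mp hx).2]
  have h2 : ∑ x ∈ E, W (cls x) =
      ∑ t ∈ T, (((E.filter fun x => cls x = t).card : ℂ) - (B : ℂ)) * W t := by
    simp_rw [sub_mul, Finset.sum_sub_distrib, ← Finset.mul_sum, hW0, mul_zero, sub_zero]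
    exact h1
  have h3 : (E.card : ℝ) = ∑ t ∈ T, ((E.filter fun x => cls x = t).card : ℝ) := by
    rw [Finset.card_eq_sum_card_fiberwise hcls, Nat.cast_sum]
  rw [h2, h3, ← nsmul_eq_mul, ← Finset.sum_const, ← Finset.sum_sub_distrib]
  refine (norm_sum_le _ _).trans (Finset.sum_le_sum fun t ht => ?_)
  rw [norm_mul]
  have h4 : ‖((E.filter fun x => cls x = t).card : ℂ) - (B : ℂ)‖ =
      B - ((E.filter fun x => cls x = t).card : ℝ) := by
    rw [← Complex.ofReal_natCast, ← Complex.ofReal_sub, Complex.norm_real, Real.norm_eq_abs,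
      abs_sub_comm, abs_of_nonneg (sub_nonneg.mpr (hB t ht))]
  rw [h4]
  exact mul_le_of_le_one_right (sub_nonneg.mpr (hB t ht)) (hW t ht)

section

variable {K L : Type*} [Field K] [Fintype K] [Field L] [Algebra K L]

theorem eval_map_pow_card_pow (P : K[X]) (x : L) (m : ℕ) :
    (P.map (algebraMap K L)).eval (x ^ Fintype.card K ^ m) =
      (P.map (algebraMap K L)).eval x ^ Fintype.card K ^ m := by
  induction m with
  | zero => simp
  | succ m ih =>
    have h := aeval_algHom_apply (FiniteField.frobeniusAlgHom K L) (x ^ Fintype.card K ^ m) P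
    simp only [FiniteField.frobeniusAlgHom_apply] at h
    rw [pow_succ, pow_mul, pow_mul, ← ih, eval_map_algebraMap, eval_map_algebraMap, h]

variable [IsAlgClosed L]

theorem card_frobeniusFixed {m : ℕ} (hm : m ≠ 0) :
    (frobeniusFixed K L m).card = Fintype.card K ^ m := by
  classical
  have hq : ((Fintype.card K ^ m : ℕ) : L) = 0 := by
    rw [Nat.cast_pow, ← map_natCast (algebraMap K L), FiniteField.cast_card_eq_zero, map_zero,
      zero_pow hm]
  have hsep : (X ^ Fintype.card K ^ m - X : L[X]).Separable := by
    obtain ⟨p, hp⟩ := CharP.exists L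
    exact galois_poly_separable p _ ((CharP.cast_eq_zero_iff L p _).mp hq)
  rw [frobeniusFixed, Multiset.toFinset_card_of_nodup (by convert! nodup_roots hsep),
    ← (IsAlgClosed.splits _).natDegree_eq_card_roots,
    FiniteField.X_pow_card_sub_X_natDegree_eq L (Nat.one_lt_pow hm Fintype.one_lt_card)]

open Classical in
/-- Square-root cancellation over the extensions of even degree, up to a constant. -/
theorem exists_norm_sum_frobeniusFixed_le {p r : ℕ} [Fact p.Prime] [CharP L p]
    (hpr : Fintype.card K = p ^ r) {d : ℕ} (hd : d ∣ Fintype.card K - 1) {h f G : K[X]}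
    (hf : f ≠ 0) (hh0 : h ≠ 0)
    (hh : ∀ (m : ℕ) (P Q : L[X]), Q ≠ 0 → h.map (algebraMap K L) ^ m * Q ^ d = P ^ d → d ∣ m)
    (hG : ∀ P Q : L[X], Q ≠ 0 → P ^ p ≠ f.map (algebraMap K L) ^ (p - 1) * P * Q ^ (p - 1) +
      f.map (algebraMap K L) ^ (p - 1) * G.map (algebraMap K L) * Q ^ p)
    {W : L × L → ℂ} (hW : ∀ c s : L, c ^ d = 1 → s ^ p = s → ‖W (c, s)‖ ≤ 1)
    (hW0 : ∑ t ∈ (nthRootsFinset d (1 : L)) ×ˢ (X ^ p - X : L[X]).roots.toFinset, W t = 0) :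
    ∃ B : ℝ, ∀ m : ℕ, m ≠ 0 →
      ‖∑ x ∈ (frobeniusFixed K L (2 * m)).filter (fun x => (f.map (algebraMap K L)).eval x ≠ 0 ∧
          (h.map (algebraMap K L)).eval x ≠ 0),
        W ((h.map (algebraMap K L)).eval x ^ ((Fintype.card K ^ (2 * m) - 1) / d),
          ∑ i ∈ Finset.range (2 * (m * r)), ((G.map (algebraMap K L)).eval x /
            (f.map (algebraMap K L)).eval x) ^ p ^ i)‖ ≤ B * (Fintype.card K : ℝ) ^ m := by
  set q := Fintype.card K with hq
  set h' := h.map (algebraMap K L) with hh'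
  set f' := f.map (algebraMap K L) with hf'
  set G' := G.map (algebraMap K L) with hG'
  have hp : p.Prime := Fact.out
  have hq1 : 1 < q := Fintype.one_lt_card
  have hr : r ≠ 0 := by
    rintro rfl
    rw [pow_zero] at hpr
    omega
  have hd0 : 0 < d := Nat.pos_of_dvd_of_pos hd (by omega)
  have hdp : d.Coprime p := by
    have h1 : (q - 1).Coprime q := by
      have := Nat.coprime_self_add_right (m := q - 1) (n := 1)
      rw [Nat.sub_add_cancel hq1.le] at this
      simpa using this
    rw [hpr] at h1
    rw [hpr] at hd
    exact (h1.coprime_dvd_left hd).coprime_dvd_right (dvd_pow_self p hr)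
  have hcardC : (nthRootsFinset d (1 : L)).card = d := by
    have : NeZero (d : L) := ⟨by
      rw [Ne, CharP.cast_eq_zero_iff L p]
      intro h
      have := Nat.eq_one_of_dvd_coprimes hdp h dvd_rfl
      exact hp.one_lt.ne' this⟩
    obtain ⟨ζ, hζ⟩ := HasEnoughRootsOfUnity.exists_primitiveRoot L d
    exact hζ.card_nthRootsFinset
  have hcardS : (X ^ p - X : L[X]).roots.toFinset.card = p := by
    have hsep : (X ^ p - X : L[X]).Separable := galois_poly_separable p _ dvd_rfl
    rw [Multiset.toFinset_card_of_nodup (nodup_roots hsep),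
      ← (IsAlgClosed.splits _).natDegree_eq_card_roots,
      FiniteField.X_pow_card_sub_X_natDegree_eq L hp.one_lt]
  have hmemC : ∀ c : L, c ∈ nthRootsFinset d (1 : L) ↔ c ^ d = 1 :=
    fun c => mem_nthRootsFinset hd0 _
  have hmemS : ∀ s : L, s ∈ (X ^ p - X : L[X]).roots.toFinset ↔ s ^ p = s := by
    intro s
    rw [Multiset.mem_toFinset, mem_roots (FiniteField.X_pow_card_sub_X_ne_zero L hp.one_lt)]
    simp [sub_eq_zero]
  set T := (nthRootsFinset d (1 : L)) ×ˢ (X ^ p - X : L[X]).roots.toFinset with hT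
  have hmemT : ∀ t, t ∈ T ↔ t.1 ^ d = 1 ∧ t.2 ^ p = t.2 := by
    intro t
    rw [hT, Finset.mem_product, hmemC, hmemS]
  have hcardT : (T.card : ℝ) = d * p := by
    rw [hT, Finset.card_product, hcardC, hcardS, Nat.cast_mul]
  have hf0' : f' ≠ 0 := map_ne_zero hf
  have hh0' : h' ≠ 0 := map_ne_zero hh0
  choose! N hN using fun (t : L × L) (ht : t ∈ T) =>
    card_le_of_cover hd0 hdp hf0' hh0' hh hG t.1 t.2 ((hmemT t).mp ht).1 ((hmemT t).mp ht).2
  set M := T.sup N with hM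
  refine ⟨M + (f'.natDegree + h'.natDegree), fun m hm => ?_⟩
  set E := (frobeniusFixed K L (2 * m)).filter (fun x => f'.eval x ≠ 0 ∧ h'.eval x ≠ 0) with hE
  have hμ : m * r ≠ 0 := mul_ne_zero hm hr
  have hpμ : p ^ (m * r) = q ^ m := by rw [hpr, ← pow_mul, mul_comm]
  have hQ : (p ^ (m * r)) ^ 2 = q ^ (2 * m) := by rw [hpμ, ← pow_mul, mul_comm]
  have hdQ : d ∣ q ^ (2 * m) - 1 := hd.trans (by simpa using Nat.sub_dvd_pow_sub_pow q 1 (2 * m))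
  have hEmem : ∀ x ∈ E, x ^ q ^ (2 * m) = x ∧ f'.eval x ≠ 0 ∧ h'.eval x ≠ 0 := by
    intro x hx
    rw [hE, Finset.mem_filter, mem_frobeniusFixed (by omega)] at hx
    exact hx
  have hfix : ∀ P : K[X], ∀ x ∈ E,
      (P.map (algebraMap K L)).eval x ^ q ^ (2 * m) = (P.map (algebraMap K L)).eval x := by
    intro P x hx
    rw [← eval_map_pow_card_pow, (hEmem x hx).1]
  have hcls : ∀ x ∈ E, (h'.eval x ^ ((q ^ (2 * m) - 1) / d),
      ∑ i ∈ Finset.range (2 * (m * r)), (G'.eval x / f'.eval x) ^ p ^ i) ∈ T := by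
    intro x hx
    rw [hmemT]
    constructor
    · dsimp only
      rw [← pow_mul, Nat.div_mul_cancel hdQ]
      have h1 := hfix h x hx
      have h2 : q ^ (2 * m) = q ^ (2 * m) - 1 + 1 :=
        (Nat.sub_add_cancel (Nat.one_le_pow _ _ (by omega))).symm
      rw [h2, pow_succ] at h1
      exact mul_right_cancel₀ (hEmem x hx).2.2 (h1.trans (one_mul _).symm)
    · dsimp only
      set g := G'.eval x / f'.eval x with hg
      have hgfix : g ^ p ^ (2 * (m * r)) = g := by
        have : p ^ (2 * (m * r)) = q ^ (2 * m) := by rw [← hQ, ← pow_mul, mul_comm]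
        rw [this, hg, div_pow, hfix G x hx, hfix f x hx]
      rw [sum_pow_char p]
      simp_rw [← pow_mul, ← pow_succ]
      have h3 := Finset.sum_range_succ' (fun i => g ^ p ^ i) (2 * (m * r))
      have h4 := Finset.sum_range_succ (fun i => g ^ p ^ i) (2 * (m * r))
      rw [h4, hgfix, pow_zero, pow_one] at h3
      exact (add_right_cancel h3).symm
  have hfiber : ∀ t ∈ T, ((E.filter fun x => ((h'.eval x ^ ((q ^ (2 * m) - 1) / d),
      ∑ i ∈ Finset.range (2 * (m * r)), (G'.eval x / f'.eval x) ^ p ^ i) : L × L) = t).card : ℝ) ≤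
      ((q : ℝ) ^ (2 * m) + M * (q : ℝ) ^ m) / (d * p) := by
    intro t ht
    rw [le_div_iff₀ (by have := hp.pos; positivity), mul_comm]
    have h1 := hN t ht (m * r) hμ (by rw [hQ]; exact hdQ) (E.filter fun x =>
      ((h'.eval x ^ ((q ^ (2 * m) - 1) / d),
        ∑ i ∈ Finset.range (2 * (m * r)), (G'.eval x / f'.eval x) ^ p ^ i) : L × L) = t) (by
      intro x hx
      rw [Finset.mem_filter] at hx
      obtain ⟨hx, rfl⟩ := hx
      rw [hQ]
      exact ⟨(hEmem x hx).1, (hEmem x hx).2.1, hfix f x hx, rfl, rfl⟩)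
    rw [hQ, hpμ] at h1
    have h2 : N t ≤ M := Finset.le_sup ht
    have h3 : q ^ (2 * m) + N t * q ^ m ≤ q ^ (2 * m) + M * q ^ m := by gcongr
    exact_mod_cast h1.trans h3
  have hEcard : (q : ℝ) ^ (2 * m) - (f'.natDegree + h'.natDegree) ≤ E.card := by
    have h1 : frobeniusFixed K L (2 * m) ⊆ E ∪ (f'.roots.toFinset ∪ h'.roots.toFinset) := by
      intro x hx
      by_cases h1 : f'.eval x ≠ 0 ∧ h'.eval x ≠ 0
      · exact Finset.mem_union_left _ (Finset.mem_filter.mpr ⟨hx, h1⟩)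
      · refine Finset.mem_union_right _ ?_
        rw [Finset.mem_union, Multiset.mem_toFinset, Multiset.mem_toFinset, mem_roots hf0',
          mem_roots hh0', IsRoot, IsRoot]
        tauto
    have h2 := Finset.card_le_card h1
    rw [card_frobeniusFixed (by omega), ← hq] at h2
    have h3 := Finset.card_union_le E (f'.roots.toFinset ∪ h'.roots.toFinset)
    have h4 := Finset.card_union_le f'.roots.toFinset h'.roots.toFinset
    have h5 := (Multiset.toFinset_card_le f'.roots).trans (card_roots' f')
    have h6 := (Multiset.toFinset_card_le h'.roots).trans (card_roots' h')
    have h7 : q ^ (2 * m) ≤ E.card + (f'.natDegree + h'.natDegree) := by omega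
    have h8 : (q : ℝ) ^ (2 * m) ≤ E.card + (f'.natDegree + h'.natDegree) := by exact_mod_cast h7
    linarith
  have hmain := norm_sum_le_of_card_fiber_le hcls
    (fun t ht => hW t.1 t.2 ((hmemT t).mp ht).1 ((hmemT t).mp ht).2) hW0 hfiber
  refine hmain.trans ?_
  rw [hcardT, mul_div_cancel₀ _ (by have := hp.pos; positivity)]
  have h9 : (1 : ℝ) ≤ (q : ℝ) ^ m := one_le_pow₀ (by exact_mod_cast hq1.le)
  have h10 : (0 : ℝ) ≤ f'.natDegree + h'.natDegree := by positivity
  nlinarith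

end

section CharacterExtension

/-- Characters of a subgroup of a commutative group extend to the whole group. -/
theorem exists_monoidHom_comp_eq {G H : Type*} [CommGroup G] [CommGroup H] (i : G →* H)
    (hi : Function.Injective i) (χ : G →* ℂˣ) : ∃ χ' : H →* ℂˣ, χ'.comp i = χ := by
  have hsurj : ∀ {n : ℕ}, n ≠ 0 → Function.Surjective fun a : Additive ℂˣ => n • a := by
    intro n hn a
    obtain ⟨z, hz⟩ := IsAlgClosed.exists_pow_nat_eq (a.toMul : ℂ) (Nat.pos_of_ne_zero hn)
    have hz0 : z ≠ 0 := by
      rintro rfl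
      rw [zero_pow hn] at hz
      exact a.toMul.ne_zero hz.symm
    refine ⟨Additive.ofMul (Units.mk0 z hz0), ?_⟩
    apply Additive.toMul.injective
    ext
    simpa using hz
  let _ : DivisibleBy (Additive ℂˣ) ℕ := divisibleByOfSMulRightSurj _ _ hsurj
  let _ : DivisibleBy (Additive ℂˣ) ℤ := AddGroup.divisibleByIntOfDivisibleByNat _
  obtain ⟨h, hh⟩ := (Module.Baer.of_divisible (Additive ℂˣ)).extension_property_addMonoidHom
    (MonoidHom.toAdditive i) hi (MonoidHom.toAdditive χ)
  refine ⟨MonoidHom.toAdditive.symm h, ?_⟩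
  ext x
  exact congrArg (fun f => ((f (Additive.ofMul x)).toMul : ℂ)) hh

variable (K L : Type*) [Field K] [Fintype K] [Field L] [Algebra K L]

/-- A generator of the group of multiplicative characters of a finite field extends to every
field extension. -/
theorem exists_mulChar_extending_generator : ∃ (ω : MulChar L ℂ),
    (∀ χ : MulChar K ℂ, ∃ i : ℕ, ∀ a : K, a ≠ 0 → χ a = ω (algebraMap K L a) ^ i) ∧
    ∀ a : K, ω (algebraMap K L a) = 1 → a = 1 := by
  classical
  have e := (MulChar.mulEquiv_units K ℂ).some
  have hcyc : IsCyclic (MulChar K ℂ) := isCyclic_of_surjective e.symm e.symm.surjective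
  obtain ⟨ω₀, hω₀⟩ := IsCyclic.exists_monoid_generator (α := MulChar K ℂ)
  have hgen : ∀ χ : MulChar K ℂ, ∃ i : ℕ, χ = ω₀ ^ i := fun χ => by
    obtain ⟨i, hi⟩ := Submonoid.mem_powers_iff _ _ |>.mp (hω₀ χ)
    exact ⟨i, hi.symm⟩
  obtain ⟨Ω, hΩ⟩ := exists_monoidHom_comp_eq (Units.map (algebraMap K L : K →* L))
    (Units.map_injective (algebraMap K L).injective) ω₀.toUnitHom
  have hext : ∀ a : K, a ≠ 0 → MulChar.ofUnitHom Ω (algebraMap K L a) = ω₀ a := by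
    intro a ha
    have h1 := congrArg (fun f => ((f (Units.mk0 a ha) : ℂˣ) : ℂ)) hΩ
    have h2 := MulChar.ofUnitHom_coe Ω (Units.map (algebraMap K L : K →* L) (Units.mk0 a ha))
    simpa using h2.trans h1
  refine ⟨MulChar.ofUnitHom Ω, ?_, ?_⟩
  · intro χ
    obtain ⟨i, rfl⟩ := hgen χ
    refine ⟨i, fun a ha => ?_⟩
    rw [hext a ha]
    rcases eq_or_ne i 0 with rfl | hi
    · rw [pow_zero, pow_zero, MulChar.one_apply (isUnit_iff_ne_zero.mpr ha)]
    · rw [MulChar.pow_apply' _ hi]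
  · intro a ha
    have ha0 : a ≠ 0 := by
      rintro rfl
      rw [map_zero, MulChar.map_zero] at ha
      exact zero_ne_one ha
    rw [hext a ha0] at ha
    by_contra hne
    obtain ⟨χ, hχ⟩ := MulChar.exists_apply_ne_one_of_hasEnoughRootsOfUnity K ℂ hne
    obtain ⟨i, rfl⟩ := hgen χ
    rcases eq_or_ne i 0 with rfl | hi
    · rw [pow_zero, MulChar.one_apply (isUnit_iff_ne_zero.mpr ha0)] at hχ
      exact hχ rfl
    · rw [MulChar.pow_apply' _ hi, ha, one_pow] at hχ
      exact hχ rfl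

end CharacterExtension

section Nondegeneracy

variable {L : Type*} [Field L]

theorem exists_eq_mul_pow_sub_self {p : ℕ} (hp : 2 ≤ p) {f G P Q : L[X]} (hf : Squarefree f)
    (hQ : Q ≠ 0)
    (h : P ^ p = f ^ (p - 1) * P * Q ^ (p - 1) + f ^ (p - 1) * G * Q ^ p) :
    ∃ A : L[X], G = f * (A ^ p - A) := by
  classical
  have hf0 : f ≠ 0 := hf.ne_zero
  obtain ⟨k, rfl⟩ : ∃ k, p = k + 1 := ⟨p - 1, by omega⟩
  rw [Nat.add_sub_cancel] at h
  have hD : Q * f ≠ 0 := mul_ne_zero hQ hf0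
  have h1 : f * P ^ (k + 1) = f * P * (Q * f) ^ k + G * (Q * f) ^ (k + 1) := by
    rw [h]
    ring
  set g := EuclideanDomain.gcd P (Q * f) with hg
  have hg0 : g ≠ 0 := fun h0 => hD (EuclideanDomain.gcd_eq_zero_iff.mp h0).2
  obtain ⟨A, hA⟩ := EuclideanDomain.gcd_dvd_left P (Q * f)
  obtain ⟨B, hB⟩ := EuclideanDomain.gcd_dvd_right P (Q * f)
  rw [← hg] at hA hB
  have hAB : IsCoprime A B := by
    have h2 := EuclideanDomain.gcd_eq_gcd_ab P (Q * f)
    rw [← hg] at h2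
    refine ⟨EuclideanDomain.gcdA P (Q * f), EuclideanDomain.gcdB P (Q * f), ?_⟩
    apply mul_left_cancel₀ hg0
    rw [mul_one]
    conv_rhs => rw [h2]
    conv_rhs => rw [hA, hB]
    rw [← hA, ← hB]
    linear_combination (-EuclideanDomain.gcdA P (Q * f)) * hA -
      EuclideanDomain.gcdB P (Q * f) * hB
  have h3 : f * A ^ (k + 1) = f * A * B ^ k + G * B ^ (k + 1) := by
    apply mul_left_cancel₀ (pow_ne_zero (k + 1) hg0)
    rw [hA, hB] at h1
    linear_combination h1
  have h4 : B ^ (k + 1) ∣ f := by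
    have h5 : IsCoprime (B ^ (k + 1)) (A * (A ^ k - B ^ k)) := by
      refine IsCoprime.mul_right hAB.symm.pow_left ?_
      refine IsCoprime.pow_left ?_
      obtain ⟨j, rfl⟩ : ∃ j, k = j + 1 := ⟨k - 1, by omega⟩
      have h6 : IsCoprime B (A ^ (j + 1)) := hAB.symm.pow_right
      have h7 := IsCoprime.add_mul_left_right h6 (-B ^ j)
      rwa [show A ^ (j + 1) + B * -B ^ j = A ^ (j + 1) - B ^ (j + 1) by ring] at h7
    refine h5.dvd_of_dvd_mul_right ⟨G, ?_⟩
    linear_combination h3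
  have hBu : IsUnit B := hf B ((dvd_trans (by
    rw [← sq]
    exact pow_dvd_pow B hp) h4))
  obtain ⟨C, hC⟩ := hBu.exists_right_inv
  refine ⟨A * C, ?_⟩
  have h8 : B ^ (k + 1) * C ^ (k + 1) = 1 := by rw [← mul_pow, hC, one_pow]
  have h9 : B ^ k * C ^ k = 1 := by rw [← mul_pow, hC, one_pow]
  calc G = G * (B ^ (k + 1) * C ^ (k + 1)) := by rw [h8, mul_one]
    _ = (f * A ^ (k + 1) - f * A * B ^ k) * C ^ (k + 1) := by rw [h3]; ring
    _ = f * ((A * C) ^ (k + 1) - A * C * (B ^ k * C ^ k)) := by ring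
    _ = f * ((A * C) ^ (k + 1) - A * C) := by rw [h9, mul_one]

theorem pow_sub_self_ne_C_mul_X {p : ℕ} (hp : 2 ≤ p) {c : L} (hc : c ≠ 0) (A : L[X]) :
    A ^ p - A ≠ C c * X := by
  intro h
  have h1 : (C c * X : L[X]).natDegree = 1 := natDegree_C_mul_X c hc
  rcases Nat.eq_zero_or_pos A.natDegree with h0 | h0
  · have h2 : (A ^ p - A).natDegree ≤ 0 := by
      refine (natDegree_sub_le _ _).trans (max_le ?_ h0.le)
      rw [natDegree_pow, h0, mul_zero]
    rw [h, h1] at h2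
    omega
  · have h2 : A.natDegree < (A ^ p).natDegree := by
      rw [natDegree_pow]
      nlinarith
    have h3 := natDegree_sub_eq_left_of_natDegree_lt h2
    rw [h, h1, natDegree_pow] at h3
    nlinarith

theorem artinSchreier_ne {p : ℕ} (hp : 2 ≤ p) {f₁ f₂ : L[X]} (hf₂ : Squarefree f₂)
    (hf₂u : ¬ IsUnit f₂) (hcop : IsCoprime f₁ f₂) {u v : L} (huv : u ≠ 0 ∨ v ≠ 0) (P Q : L[X])
    (hQ : Q ≠ 0) : P ^ p ≠ f₂ ^ (p - 1) * P * Q ^ (p - 1) +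
      f₂ ^ (p - 1) * (C u * X * f₂ + C v * f₁) * Q ^ p := by
  intro h
  obtain ⟨A, hA⟩ := exists_eq_mul_pow_sub_self hp hf₂ hQ h
  have hv : v = 0 := by
    by_contra hv
    have h1 : f₂ ∣ C v * f₁ := ⟨A ^ p - A - C u * X, by linear_combination hA⟩
    have h2 : f₂ ∣ f₁ := (IsUnit.dvd_mul_left (isUnit_C.mpr (isUnit_iff_ne_zero.mpr hv))).mp h1
    exact hf₂u (hcop.isUnit_of_dvd' h2 dvd_rfl)
  subst hv
  refine pow_sub_self_ne_C_mul_X hp (huv.resolve_right (by simp)) A ?_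
  apply mul_left_cancel₀ hf₂.ne_zero
  rw [← hA]
  simp
  ring

theorem artinSchreier_ne_X {p : ℕ} (hp : 2 ≤ p) (P Q : L[X]) (hQ : Q ≠ 0) :
    P ^ p ≠ 1 ^ (p - 1) * P * Q ^ (p - 1) + 1 ^ (p - 1) * X * Q ^ p := by
  intro h
  obtain ⟨A, hA⟩ := exists_eq_mul_pow_sub_self hp squarefree_one hQ h
  exact pow_sub_self_ne_C_mul_X hp one_ne_zero A (by rw [map_one, one_mul, hA, one_mul])

theorem rootMultiplicity_pow_eq (f : L[X]) (m : ℕ) (β : L) :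
    (f ^ m).rootMultiplicity β = m * f.rootMultiplicity β := by
  classical
  rw [← count_roots, roots_pow, Multiset.count_nsmul, count_roots]

theorem rootMultiplicity_eq_one_of_separable {f : L[X]} (hf : f.Separable) {β : L}
    (hβ : f.IsRoot β) : f.rootMultiplicity β = 1 :=
  le_antisymm (rootMultiplicity_le_one_of_separable hf β)
    ((rootMultiplicity_pos hf.ne_zero).mpr hβ)

theorem dvd_of_pow_mul_eq_pow {d : ℕ} {h : L[X]} (hh : h ≠ 0) {m : ℕ} {P Q : L[X]} (hQ : Q ≠ 0)
    (heq : h ^ m * Q ^ d = P ^ d) (β : L) : d ∣ m * h.rootMultiplicity β := by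
  have hP : P ^ d ≠ 0 := heq ▸ mul_ne_zero (pow_ne_zero _ hh) (pow_ne_zero _ hQ)
  have h1 := congrArg (rootMultiplicity β) heq
  rw [rootMultiplicity_mul (heq ▸ hP), rootMultiplicity_pow_eq, rootMultiplicity_pow_eq,
    rootMultiplicity_pow_eq] at h1
  rw [← Nat.dvd_add_left (Dvd.intro _ rfl : d ∣ d * Q.rootMultiplicity β), h1]
  exact Dvd.intro _ rfl

variable [IsAlgClosed L]

theorem dvd_of_X_pow_mul_pow_mul_pow {d i j a₁ a₂ a₃ : ℕ} (hij : (i.gcd j).Coprime d)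
    (h₁ : a₁ ≡ i [MOD d]) (h₂ : a₂ ≡ j [MOD d]) (h₃ : a₃ + j ≡ 0 [MOD d]) {f₁ f₂ : L[X]}
    (hf₁ : f₁.Separable) (hf₂ : f₂.Separable) (hd₁ : f₁.degree ≠ 0) (hd₂ : f₂.degree ≠ 0)
    (hcop : IsCoprime f₁ f₂) {m : ℕ} {P Q : L[X]} (hQ : Q ≠ 0)
    (heq : (X ^ a₁ * f₁ ^ a₂ * f₂ ^ a₃) ^ m * Q ^ d = P ^ d) : d ∣ m := by
  have h12 : X ^ a₁ * f₁ ^ a₂ ≠ 0 := mul_ne_zero (pow_ne_zero _ X_ne_zero)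
    (pow_ne_zero _ hf₁.ne_zero)
  have hh : X ^ a₁ * f₁ ^ a₂ * f₂ ^ a₃ ≠ 0 := mul_ne_zero h12 (pow_ne_zero _ hf₂.ne_zero)
  have hroot : ∀ β, d ∣ m * (a₁ * (X : L[X]).rootMultiplicity β + a₂ * f₁.rootMultiplicity β +
      a₃ * f₂.rootMultiplicity β) := by
    intro β
    have := dvd_of_pow_mul_eq_pow hh hQ heq β
    rwa [rootMultiplicity_mul hh, rootMultiplicity_mul h12, rootMultiplicity_pow_eq,
      rootMultiplicity_pow_eq, rootMultiplicity_pow_eq] at this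
  have hX : ∀ β : L, β ≠ 0 → (X : L[X]).rootMultiplicity β = 0 := by
    intro β hβ
    rw [rootMultiplicity_eq_zero_iff]
    intro h
    exact absurd (by simpa using h) hβ
  have hne : ∀ β, f₁.IsRoot β → f₂.IsRoot β → False := by
    rintro β hb₁ hb₂
    obtain ⟨s, t, hst⟩ := hcop
    have := congrArg (eval β) hst
    simp [hb₁.eq_zero, hb₂.eq_zero] at this
  have hmult : ∀ f : L[X], ∀ β, ¬ f.IsRoot β → f.rootMultiplicity β = 0 := fun f β h =>
    rootMultiplicity_eq_zero h
  have e₁ : m * a₁ ≡ m * i [MOD d] := h₁.mul_left m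
  have e₂ : m * a₂ ≡ m * j [MOD d] := h₂.mul_left m
  have e₃ : m * a₃ + m * j ≡ 0 [MOD d] := by
    simpa [mul_add] using h₃.mul_left m
  have e₂' : d ∣ m * a₂ ↔ d ∣ m * j := by
    rw [← Nat.modEq_zero_iff_dvd, ← Nat.modEq_zero_iff_dvd]
    exact ⟨fun h => e₂.symm.trans h, fun h => e₂.trans h⟩
  have e₃' : d ∣ m * a₃ ↔ d ∣ m * j := by
    rw [Nat.modEq_zero_iff_dvd] at e₃
    exact ⟨fun h => (Nat.dvd_add_right h).mp e₃, fun h => (Nat.dvd_add_left h).mp e₃⟩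
  have hj : d ∣ m * j := by
    obtain ⟨β₁, hβ₁⟩ := IsAlgClosed.exists_root f₁ hd₁
    obtain ⟨β₂, hβ₂⟩ := IsAlgClosed.exists_root f₂ hd₂
    by_cases h0 : β₁ = 0
    · have hb : β₂ ≠ 0 := by
        rintro rfl
        exact hne 0 (h0 ▸ hβ₁) hβ₂
      have := hroot β₂
      rw [hX β₂ hb, hmult f₁ β₂ fun h => hne β₂ h hβ₂,
        rootMultiplicity_eq_one_of_separable hf₂ hβ₂] at this
      simpa [e₃'] using this
    · have := hroot β₁
      rw [hX β₁ h0, hmult f₂ β₁ fun h => hne β₁ hβ₁ h,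
        rootMultiplicity_eq_one_of_separable hf₁ hβ₁] at this
      simpa [e₂'] using this
  have hi : d ∣ m * i := by
    have h0 := hroot 0
    have hX0 : (X : L[X]).rootMultiplicity 0 = 1 :=
      rootMultiplicity_eq_one_of_separable separable_X (by simp)
    rw [hX0, mul_one, mul_add, mul_add, ← mul_assoc m a₂, ← mul_assoc m a₃] at h0
    have h1 := (Nat.dvd_add_left ((e₃'.mpr hj).mul_right _)).mp h0
    have h2 := (Nat.dvd_add_left ((e₂'.mpr hj).mul_right _)).mp h1
    rw [← Nat.modEq_zero_iff_dvd] at h2 ⊢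
    exact e₁.symm.trans h2
  have h3 := Nat.dvd_gcd hi hj
  rw [Nat.gcd_mul_left] at h3
  exact hij.symm.dvd_of_dvd_mul_right h3

end Nondegeneracy

theorem sum_range_sum_range_pow_pow {R : Type*} [Semiring R] (p r M : ℕ) (y : R) :
    ∑ k ∈ Finset.range M, ∑ l ∈ Finset.range r, (y ^ (p ^ r) ^ k) ^ p ^ l =
      ∑ t ∈ Finset.range (M * r), y ^ p ^ t := by
  induction M with
  | zero => simp
  | succ M ih =>
    rw [Finset.sum_range_succ, ih, Nat.succ_mul, Finset.sum_range_add]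
    congr 1
    refine Finset.sum_congr rfl fun l _ => ?_
    rw [← pow_mul, ← pow_mul, ← pow_add, mul_comm r M]

theorem prod_mulChar_pow_eq {L : Type*} [Field L] (Ω : MulChar L ℂ) {q M d e i j : ℕ} (hq : 1 < q)
    (hde : d * e = q - 1) {x a b : L} (hx : x ≠ 0) (ha : a ≠ 0) (hb : b ≠ 0)
    (hxM : x ^ q ^ M = x) (haM : a ^ q ^ M = a) (hbM : b ^ q ^ M = b) :
    ∏ k ∈ Finset.range M, (Ω (x ^ q ^ k) ^ (i * e) * Ω ((a / b) ^ q ^ k) ^ (j * e)) =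
      Ω ((x ^ (i + d) * a ^ (j + d) * b ^ ((d - 1) * j + d)) ^ ((q ^ M - 1) / d)) := by
  have hd : 0 < d := by
    rcases Nat.eq_zero_or_pos d with rfl | h
    · omega
    · exact h
  set S := ∑ k ∈ Finset.range M, q ^ k with hS
  have hgeom : d * (e * S) = q ^ M - 1 := by
    rw [← mul_assoc, hde, hS]
    have h := mul_geom_sum (q : ℤ) M
    zify [hq.le, Nat.one_le_pow M q (by omega)]
    exact h
  have hE : (q ^ M - 1) / d = e * S := by
    rw [← hgeom, Nat.mul_div_cancel_left _ hd]
  have hone : ∀ y : L, y ≠ 0 → y ^ q ^ M = y → y ^ (d * (e * S)) = 1 := by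
    intro y hy h
    rw [hgeom]
    have h2 : q ^ M = q ^ M - 1 + 1 := (Nat.sub_add_cancel (Nat.one_le_pow _ _ (by omega))).symm
    rw [h2, pow_succ] at h
    exact mul_right_cancel₀ hy (h.trans (one_mul _).symm)
  have key : ∀ (y : L) (s : ℕ), ∏ k ∈ Finset.range M, Ω (y ^ q ^ k) ^ (s * e) =
      Ω (y ^ (s * (e * S))) := by
    intro y s
    simp_rw [map_pow, ← pow_mul]
    rw [Finset.prod_pow_eq_pow_sum, ← Finset.sum_mul, ← hS]
    congr 1
    ring
  rw [Finset.prod_mul_distrib, key, key, ← map_mul, hE]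
  congr 1
  have hb1 : b ^ (((d - 1) * j + d) * (e * S)) * b ^ (j * (e * S)) = 1 := by
    rw [← pow_add]
    have : ((d - 1) * j + d) * (e * S) + j * (e * S) = (d * (e * S)) * (j + 1) := by
      obtain ⟨d, rfl⟩ := Nat.exists_eq_succ_of_ne_zero hd.ne'
      simp only [Nat.succ_eq_add_one, Nat.add_sub_cancel]
      ring
    rw [this, pow_mul, hone b hb hbM, one_pow]
  have hx1 : x ^ ((i + d) * (e * S)) = x ^ (i * (e * S)) := by
    rw [add_mul, pow_add, hone x hx hxM, mul_one]
  have ha1 : a ^ ((j + d) * (e * S)) = a ^ (j * (e * S)) := by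
    rw [add_mul, pow_add, hone a ha haM, mul_one]
  rw [mul_pow, mul_pow, ← pow_mul, ← pow_mul, ← pow_mul, hx1, ha1, div_pow,
    eq_div_of_mul_eq (pow_ne_zero _ hb) hb1]
  ring

section

variable {K L : Type*} [Field K] [Fintype K] [Field L] [Algebra K L] [IsAlgClosed L]

open Classical in
theorem card_pow_le_card_filter_add_natDegree {F : K[X]} (hF : F ≠ 0) {m : ℕ} (hm : m ≠ 0) :
    Fintype.card K ^ m ≤ ((frobeniusFixed K L m).filter fun x =>
      (F.map (algebraMap K L)).eval x ≠ 0).card + F.natDegree := by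
  have hF' : F.map (algebraMap K L) ≠ 0 := map_ne_zero hF
  rw [← card_frobeniusFixed (L := L) hm, ← Finset.card_filter_add_card_filter_not
    (s := frobeniusFixed K L m) (fun x => (F.map (algebraMap K L)).eval x ≠ 0)]
  refine Nat.add_le_add_left ?_ _
  rw [← natDegree_map (algebraMap K L)]
  refine le_trans (Finset.card_le_card ?_)
    ((Multiset.toFinset_card_le _).trans (card_roots' (F.map (algebraMap K L))))
  intro x hx
  rw [Multiset.mem_toFinset, mem_roots hF']
  simpa using (Finset.mem_filter.mp hx).2

/-- If the sums of a function over all points of even degree are as small as square-root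
cancellation predicts, then its sum over the rational points satisfies the Weil bound. -/
theorem norm_sum_frobeniusFixed_one_le {F : K[X]} {e : ℕ} (hF : F ≠ 0) {lam : L → ℂ}
    (hlam : IsCongruenceCharacter (F.map (algebraMap K L)) e lam)
    (h0 : ∀ x, (F.map (algebraMap K L)).eval x = 0 → lam x = 0)
    (h1 : ∀ m x, m ≠ 0 → x ∈ frobeniusFixed K L (2 * m) → (F.map (algebraMap K L)).eval x ≠ 0 →
      ‖((frobeniusOrbit K (2 * m) x).map lam).prod‖ = 1)
    {B : ℝ} (hB : ∀ m, m ≠ 0 → ‖∑ x ∈ frobeniusFixed K L (2 * m),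
      ((frobeniusOrbit K (2 * m) x).map lam).prod‖ ≤ B * (Fintype.card K : ℝ) ^ m) {N : ℕ}
    (hN : F.natDegree + e ≤ N + 1) :
    ‖∑ x ∈ frobeniusFixed K L 1, lam x‖ ≤ N * Real.sqrt (Fintype.card K) := by
  classical
  set q := Fintype.card K with hq
  have hq1 : 1 < q := Fintype.one_lt_card
  have hq0 : (0 : ℝ) < q := by positivity
  have hvanish : ∀ k, F.natDegree + e ≤ k →
      ∑ M ∈ monicsOfDegree K k, ((M.aroots L).map lam).prod = 0 := by
    refine (hlam.sum_monicsOfDegree_eq_zero_or hF h0).resolve_right ?_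
    rintro ⟨κ, hκ⟩
    have horbit : ∀ m x, m ≠ 0 → x ∈ frobeniusFixed K L (2 * m) →
        (F.map (algebraMap K L)).eval x ≠ 0 →
        ((frobeniusOrbit K (2 * m) x).map lam).prod = κ ^ (2 * m) := by
      intro m x hm hx hFx
      rw [mem_frobeniusFixed (by omega)] at hx
      obtain ⟨P, hP⟩ := exists_map_eq_prod_X_sub_C hx
      have hPm : P.Monic := by
        refine monic_of_injective (algebraMap K L).injective ?_
        rw [hP]
        exact monic_multiset_prod_of_monic _ _ fun a _ => monic_X_sub_C a
      have hPr : P.aroots L = frobeniusOrbit K (2 * m) x := by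
        rw [aroots, hP, roots_multiset_prod_X_sub_C]
      have hPd : P.natDegree = 2 * m := by
        rw [← natDegree_map (algebraMap K L), hP, natDegree_multiset_prod_X_sub_C_eq_card]
        simp [frobeniusOrbit]
      have := hκ P hPm (fun y hy hPy => by
        have hmem : y ∈ P.aroots L := by
          rw [aroots, mem_roots (map_ne_zero hPm.ne_zero)]
          exact hPy
        rw [hPr] at hmem
        obtain ⟨k, -, rfl⟩ := Multiset.mem_map.mp hmem
        rw [eval_map_pow_card_pow] at hy
        exact hFx (eq_zero_of_pow_eq_zero hy))
      rwa [hPr, hPd] at this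
    have hlow : ∀ m, m ≠ 0 → (q : ℝ) ^ (2 * m) ≤ B * q ^ m + F.natDegree := by
      intro m hm
      set E := (frobeniusFixed K L (2 * m)).filter fun x =>
        (F.map (algebraMap K L)).eval x ≠ 0 with hE
      have hsum : ∑ x ∈ frobeniusFixed K L (2 * m),
          ((frobeniusOrbit K (2 * m) x).map lam).prod = E.card * κ ^ (2 * m) := by
        rw [← nsmul_eq_mul, ← Finset.sum_const, hE, Finset.sum_filter]
        refine Finset.sum_congr rfl fun x hx => ?_
        split_ifs with h
        · exact horbit m x hm hx h
        · refine Multiset.prod_eq_zero (Multiset.mem_map.mpr ⟨x, ?_, h0 x (not_not.mp h)⟩)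
          exact Multiset.mem_map.mpr ⟨0, Multiset.mem_range.mpr (by omega), by simp⟩
      have hnorm : ‖(E.card : ℂ) * κ ^ (2 * m)‖ = E.card := by
        rcases Finset.eq_empty_or_nonempty E with h | ⟨x, hx⟩
        · simp [h]
        · rw [hE, Finset.mem_filter] at hx
          rw [norm_mul, ← horbit m x hm hx.1 hx.2, h1 m x hm hx.1 hx.2, mul_one,
            Complex.norm_natCast]
      have h2 := hB m hm
      rw [hsum, hnorm] at h2
      have h3 := card_pow_le_card_filter_add_natDegree (L := L) hF (show 2 * m ≠ 0 by omega)
      have h4 : (q : ℝ) ^ (2 * m) ≤ E.card + F.natDegree := by exact_mod_cast h3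
      linarith
    obtain ⟨m, hm⟩ := exists_nat_gt (B + F.natDegree)
    have h2 := hlow (m + 1) m.succ_ne_zero
    have h3 : ((m + 1 : ℕ) : ℝ) < (q : ℝ) ^ (m + 1) := by exact_mod_cast Nat.lt_pow_self hq1
    have h4 : (q : ℝ) ^ (2 * (m + 1)) = q ^ (m + 1) * q ^ (m + 1) := by rw [← pow_add]; ring_nf
    have h5 : (1 : ℝ) ≤ (q : ℝ) ^ (m + 1) := one_le_pow₀ (by exact_mod_cast hq1.le)
    have h6 : (0 : ℝ) ≤ F.natDegree := by positivity
    push_cast at h3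
    nlinarith
  have h := norm_le_mul_sqrt_of_newton (N := N)
    (l := fun k => ∑ M ∈ monicsOfDegree K k, ((M.aroots L).map lam).prod)
    (S := fun m => ∑ x ∈ frobeniusFixed K L m, ((frobeniusOrbit K m x).map lam).prod)
    (sum_monicsOfDegree_zero lam) (fun k hk => hvanish k (by omega))
    (natCast_mul_sum_monicsOfDegree lam) hq0 hB
  convert h using 2
  refine Finset.sum_congr rfl fun x _ => ?_
  simp [frobeniusOrbit]

end

section

variable {K L : Type*} [Field K] [Fintype K] [Field L] [Algebra K L]

theorem sum_frobeniusFixed_one [IsAlgClosed L] (g : L → ℂ) :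
    ∑ x ∈ frobeniusFixed K L 1, g x = ∑ y : K, g (algebraMap K L y) := by
  symm
  refine Finset.sum_bij (fun y _ => algebraMap K L y) ?_ ?_ ?_ ?_
  · intro y _
    rw [mem_frobeniusFixed one_ne_zero, pow_one, ← map_pow, FiniteField.pow_card]
  · intro y _ z _ h
    exact (algebraMap K L).injective h
  · intro x hx
    rw [mem_frobeniusFixed one_ne_zero, pow_one] at hx
    obtain ⟨y, hy⟩ := mem_range_algebraMap_of_pow_card_eq hx
    exact ⟨y, Finset.mem_univ _, hy⟩
  · intro y _
    rfl

open Classical in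
theorem norm_sum_mixed_le_of_sum_eq_zero [IsAlgClosed L] {p r : ℕ} [Fact p.Prime] [CharP L p]
    (hpr : Fintype.card K = p ^ r) {d e i j : ℕ} (hde : d * e = Fintype.card K - 1)
    (hij : (i.gcd j).Coprime d) {f₁ f₂ : K[X]} (hf₁ : f₁.Separable) (hf₂ : f₂.Separable)
    (hd₁ : f₁.degree ≠ 0) (hd₂ : f₂.degree ≠ 0) (hcop : IsCoprime f₁ f₂) {f G : K[X]}
    (hf : f ∣ f₂)
    (hG : ∀ P Q : L[X], Q ≠ 0 → P ^ p ≠ f.map (algebraMap K L) ^ (p - 1) * P * Q ^ (p - 1) +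
      f.map (algebraMap K L) ^ (p - 1) * G.map (algebraMap K L) * Q ^ p)
    (Ω : MulChar L ℂ) (Θ : AddChar L ℂ)
    (hW0 : (∑ c ∈ nthRootsFinset d (1 : L), Ω c) *
      ∑ s ∈ (X ^ p - X : L[X]).roots.toFinset, Θ s = 0)
    (hΘ : IsCongruenceCharacter ((X * f₁ * f₂ ^ 2).map (algebraMap K L)) f₁.natDegree fun x =>
      Θ (∑ l ∈ Finset.range r, ((G.map (algebraMap K L)).eval x /
        (f.map (algebraMap K L)).eval x) ^ p ^ l)) :
    ‖∑ y ∈ Finset.univ.filter (fun y : K => (X * f₁ * f₂ ^ 2).eval y ≠ 0),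
      Ω (algebraMap K L y) ^ (i * e) * Ω (algebraMap K L (f₁.eval y / f₂.eval y)) ^ (j * e) *
        Θ (∑ l ∈ Finset.range r, (algebraMap K L (G.eval y / f.eval y)) ^ p ^ l)‖ ≤
      (2 * (f₁.natDegree + f₂.natDegree) : ℕ) * Real.sqrt (Fintype.card K) := by
  set q := Fintype.card K with hq
  have hq1 : 1 < q := Fintype.one_lt_card
  have hd : 0 < d := by
    rcases Nat.eq_zero_or_pos d with rfl | h
    · omega
    · exact h
  have hf₁0 := hf₁.ne_zero
  have hf₂0 := hf₂.ne_zero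
  set F : K[X] := X * f₁ * f₂ ^ 2 with hF
  have hF0 : F ≠ 0 := mul_ne_zero (mul_ne_zero X_ne_zero hf₁0) (pow_ne_zero _ hf₂0)
  set h : K[X] := X ^ (i + d) * f₁ ^ (j + d) * f₂ ^ ((d - 1) * j + d) with hh
  have hh0 : h ≠ 0 := mul_ne_zero (mul_ne_zero (pow_ne_zero _ X_ne_zero) (pow_ne_zero _ hf₁0))
    (pow_ne_zero _ hf₂0)
  have hFeval : ∀ x : L, (F.map (algebraMap K L)).eval x = x * (f₁.map (algebraMap K L)).eval x *
      (f₂.map (algebraMap K L)).eval x ^ 2 := by simp [hF]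
  have hheval : ∀ x : L, (h.map (algebraMap K L)).eval x = x ^ (i + d) *
      (f₁.map (algebraMap K L)).eval x ^ (j + d) *
      (f₂.map (algebraMap K L)).eval x ^ ((d - 1) * j + d) := by simp [hh]
  have hgood : ∀ x : L, (F.map (algebraMap K L)).eval x ≠ 0 ↔ x ≠ 0 ∧
      (f₁.map (algebraMap K L)).eval x ≠ 0 ∧ (f₂.map (algebraMap K L)).eval x ≠ 0 := by
    intro x
    rw [hFeval]
    simp [and_assoc]
  have hgood2 : ∀ x : L, (f.map (algebraMap K L)).eval x ≠ 0 ∧ (h.map (algebraMap K L)).eval x ≠ 0 ↔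
      (F.map (algebraMap K L)).eval x ≠ 0 := by
    intro x
    rw [hgood, hheval]
    have h1 : (f₂.map (algebraMap K L)).eval x ≠ 0 → (f.map (algebraMap K L)).eval x ≠ 0 := by
      intro h2 h3
      exact h2 (eval_eq_zero_of_dvd_of_eval_eq_zero (Polynomial.map_dvd _ hf) h3)
    have hid : i + d ≠ 0 := by omega
    have hjd : j + d ≠ 0 := by omega
    have hjd2 : (d - 1) * j + d ≠ 0 := by omega
    simp only [ne_eq, mul_eq_zero, pow_eq_zero_iff hid, pow_eq_zero_iff hjd, pow_eq_zero_iff hjd2]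
    tauto
  set g : L → L := fun x => (G.map (algebraMap K L)).eval x / (f.map (algebraMap K L)).eval x
    with hg
  set ρ : L → L := fun x => (f₁.map (algebraMap K L)).eval x / (f₂.map (algebraMap K L)).eval x
    with hρ
  set lam : L → ℂ := fun x => if (F.map (algebraMap K L)).eval x = 0 then 0 else
    Ω x ^ (i * e) * Ω (ρ x) ^ (j * e) * Θ (∑ l ∈ Finset.range r, g x ^ p ^ l) with hlam
  have hcong : IsCongruenceCharacter (F.map (algebraMap K L)) f₁.natDegree lam := by
    have hroot : ∀ P : K[X], P ∣ F → ∀ β ∈ (P.map (algebraMap K L)).roots,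
        (F.map (algebraMap K L)).IsRoot β := fun P hP β hβ =>
      (isRoot_of_mem_roots hβ).dvd (Polynomial.map_dvd _ hP)
    have c1 : IsCongruenceCharacter (F.map (algebraMap K L)) f₁.natDegree fun x => Ω x := by
      simpa using isCongruenceCharacter_eval (e := f₁.natDegree) (Ω : L →* ℂ)
        (hroot X ⟨f₁ * f₂ ^ 2, by rw [hF, mul_assoc]⟩)
    have c2 := isCongruenceCharacter_eval (e := f₁.natDegree) (Ω : L →* ℂ)
      (hroot f₁ ⟨X * f₂ ^ 2, by rw [hF]; ring⟩)
    have c3 := isCongruenceCharacter_eval (e := f₁.natDegree)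
      ((Ω : L →* ℂ).comp (invMonoidWithZeroHom : L →*₀ L).toMonoidHom)
      (hroot f₂ ⟨X * f₁ * f₂, by rw [hF]; ring⟩)
    refine (((c1.pow (i * e)).mul ((c2.mul c3).pow (j * e))).mul hΘ).congr fun x hx => ?_
    rw [hlam]
    dsimp only
    rw [if_neg hx, hρ]
    dsimp only
    rw [div_eq_mul_inv, map_mul]
    rfl
  set W : L × L → ℂ := fun t => Ω t.1 * Θ t.2 with hW
  have horb : ∀ m x, m ≠ 0 → x ∈ frobeniusFixed K L (2 * m) →
      (F.map (algebraMap K L)).eval x ≠ 0 → ((frobeniusOrbit K (2 * m) x).map lam).prod =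
        W ((h.map (algebraMap K L)).eval x ^ ((q ^ (2 * m) - 1) / d),
          ∑ i ∈ Finset.range (2 * (m * r)), g x ^ p ^ i) := by
    intro m x hm hx hFx
    rw [mem_frobeniusFixed (by omega), ← hq] at hx
    have hfix : ∀ P : K[X], (P.map (algebraMap K L)).eval x ^ q ^ (2 * m) =
        (P.map (algebraMap K L)).eval x := by
      intro P
      rw [← eval_map_pow_card_pow, ← hq, hx]
    obtain ⟨hx0, h1, h2⟩ := (hgood x).mp hFx
    have h3 : ((frobeniusOrbit K (2 * m) x).map lam).prod =
        ∏ k ∈ Finset.range (2 * m), lam (x ^ q ^ k) := by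
      rw [frobeniusOrbit, Multiset.map_map]
      rfl
    have h4 : ∀ k, lam (x ^ q ^ k) = Ω (x ^ q ^ k) ^ (i * e) * Ω ((ρ x) ^ q ^ k) ^ (j * e) *
        Θ (∑ l ∈ Finset.range r, (g x ^ (p ^ r) ^ k) ^ p ^ l) := by
      intro k
      rw [hlam, ← hpr]
      dsimp only
      rw [eval_map_pow_card_pow, if_neg (pow_ne_zero _ hFx), hρ, hg]
      dsimp only
      rw [eval_map_pow_card_pow, eval_map_pow_card_pow, eval_map_pow_card_pow,
        eval_map_pow_card_pow, ← div_pow, ← div_pow]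
    rw [h3, Finset.prod_congr rfl fun k _ => h4 k, Finset.prod_mul_distrib, hρ]
    dsimp only
    rw [prod_mulChar_pow_eq Ω hq1 hde hx0 h1 h2 hx (hfix f₁) (hfix f₂), ← hheval,
      ← AddChar.map_finset_sum, sum_range_sum_range_pow_pow, mul_assoc]
  have hWnorm : ∀ (k : ℕ) (c s : L), k ≠ 0 → c ^ k = 1 → ‖W (c, s)‖ = 1 := by
    intro k c s hk hc
    rw [hW]
    dsimp only
    rw [norm_mul, Complex.norm_eq_one_of_pow_eq_one (n := k) (by rw [← map_pow, hc, map_one]) hk,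
      Complex.norm_eq_one_of_pow_eq_one (n := p) (by
        rw [← AddChar.map_nsmul_eq_pow, nsmul_eq_mul, CharP.cast_eq_zero, zero_mul,
          AddChar.map_zero_eq_one]) (Fact.out : p.Prime).ne_zero, mul_one]
  have hdvd : ∀ (m : ℕ) (P Q : L[X]), Q ≠ 0 →
      h.map (algebraMap K L) ^ m * Q ^ d = P ^ d → d ∣ m := by
    intro m P Q hQ heq
    have hmap : h.map (algebraMap K L) = X ^ (i + d) * (f₁.map (algebraMap K L)) ^ (j + d) *
      (f₂.map (algebraMap K L)) ^ ((d - 1) * j + d) := by simp [hh]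
    rw [hmap] at heq
    refine dvd_of_X_pow_mul_pow_mul_pow hij ?_ ?_ ?_ hf₁.map hf₂.map ?_ ?_
      (hcop.map (mapRingHom (algebraMap K L))) hQ heq
    · simp [Nat.ModEq]
    · simp [Nat.ModEq]
    · have : (d - 1) * j + d + j = d * (j + 1) := by
        obtain ⟨d, rfl⟩ := Nat.exists_eq_succ_of_ne_zero hd.ne'
        simp only [Nat.succ_eq_add_one, Nat.add_sub_cancel]
        ring
      rw [this]
      simp [Nat.ModEq]
    · rwa [degree_map]
    · rwa [degree_map]
  have hWsum : ∑ t ∈ (nthRootsFinset d (1 : L)) ×ˢ (X ^ p - X : L[X]).roots.toFinset, W t = 0 := by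
    rw [← hW0, Finset.sum_mul_sum, Finset.sum_product]
  obtain ⟨B, hB⟩ := exists_norm_sum_frobeniusFixed_le hpr (Dvd.intro _ hde)
    (ne_zero_of_dvd_ne_zero hf₂0 hf) hh0 hdvd hG (fun c s hc _ => (hWnorm d c s hd.ne' hc).le) hWsum
  have hclass : ∀ m x, x ∈ frobeniusFixed K L (2 * m) → m ≠ 0 →
      (F.map (algebraMap K L)).eval x ≠ 0 →
      ‖W ((h.map (algebraMap K L)).eval x ^ ((q ^ (2 * m) - 1) / d),
          ∑ i ∈ Finset.range (2 * (m * r)), g x ^ p ^ i)‖ = 1 := by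
    intro m x hx hm hFx
    have hQ : 1 < q ^ (2 * m) := Nat.one_lt_pow (by omega) hq1
    refine hWnorm (q ^ (2 * m) - 1) _ _ (by omega) ?_
    rw [← pow_mul, mul_comm, pow_mul]
    rw [mem_frobeniusFixed (by omega), ← hq] at hx
    have h1 := eval_map_pow_card_pow h x (2 * m)
    rw [← hq, hx, ← Nat.sub_add_cancel hQ.le, pow_succ] at h1
    rw [mul_right_cancel₀ ((hgood2 x).mpr hFx).2 (h1.symm.trans (one_mul _).symm), one_pow]
  have hmain := norm_sum_frobeniusFixed_one_le (N := 2 * (f₁.natDegree + f₂.natDegree)) hF0 hcong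
    (fun x hx => if_pos hx) (fun m x hm hx hFx => by
      rw [horb m x hm hx hFx]
      exact hclass m x hx hm hFx) (B := B) (fun m hm => by
      convert hB m hm using 2
      rw [Finset.sum_filter]
      refine Finset.sum_congr rfl fun x hx => ?_
      by_cases hFx : (F.map (algebraMap K L)).eval x = 0
      · rw [if_neg (fun h => (hgood2 x).mp h hFx)]
        refine Multiset.prod_eq_zero (Multiset.mem_map.mpr ⟨x, ?_, if_pos hFx⟩)
        exact Multiset.mem_map.mpr ⟨0, Multiset.mem_range.mpr (by omega), by simp⟩
      · rw [if_pos ((hgood2 x).mpr hFx)]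
        exact horb m x hm hx hFx) (by
      rw [hF, natDegree_mul (mul_ne_zero X_ne_zero hf₁0) (pow_ne_zero _ hf₂0),
        natDegree_mul X_ne_zero hf₁0, natDegree_pow, natDegree_X]
      omega)
  rw [sum_frobeniusFixed_one] at hmain
  convert hmain using 2
  rw [Finset.sum_filter]
  refine Finset.sum_congr rfl fun y _ => ?_
  have hev : ∀ P : K[X], (P.map (algebraMap K L)).eval (algebraMap K L y) =
      algebraMap K L (P.eval y) := fun P => by
    rw [eval_map_algebraMap, aeval_algebraMap_apply_eq_algebraMap_eval]
  rw [hlam]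
  dsimp only
  rw [hρ, hg]
  dsimp only
  simp only [hev, map_div₀, ne_eq, map_eq_zero, ite_not]

end

section

/-- The map `z ↦ ∑ i < r, z ^ p ^ i` in characteristic `p`. -/
noncomputable def frobeniusSum (L : Type*) [CommRing L] (p r : ℕ) [Fact p.Prime] [CharP L p] :
    L →+ L :=
  ∑ i ∈ Finset.range r, (iterateFrobenius L p i).toAddMonoidHom

theorem frobeniusSum_apply {L : Type*} [CommRing L] (p r : ℕ) [Fact p.Prime] [CharP L p] (z : L) :
    frobeniusSum L p r z = ∑ i ∈ Finset.range r, z ^ p ^ i := by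
  simp [frobeniusSum, AddMonoidHom.finsetSum_apply, iterateFrobenius_def]

theorem sum_nthRootsFinset_eq_zero {L : Type*} [Field L] {d : ℕ} (hd : 0 < d) (Ω : MulChar L ℂ)
    {a : L} (ha : a ^ d = 1) (hΩ : Ω a ≠ 1) : ∑ c ∈ nthRootsFinset d (1 : L), Ω c = 0 := by
  have ha0 : a ≠ 0 := by
    rintro rfl
    rw [zero_pow hd.ne'] at ha
    exact zero_ne_one ha
  have h : ∑ c ∈ nthRootsFinset d (1 : L), Ω c = ∑ c ∈ nthRootsFinset d (1 : L), Ω (a * c) := by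
    symm
    refine Finset.sum_bij (fun c _ => a * c) ?_ ?_ ?_ fun _ _ => rfl
    · intro c hc
      rw [mem_nthRootsFinset hd] at hc ⊢
      rw [_root_.mul_pow, ha, hc, one_mul]
    · intro c _ c' _ h
      exact mul_left_cancel₀ ha0 h
    · intro c hc
      rw [mem_nthRootsFinset hd] at hc
      refine ⟨a⁻¹ * c, ?_, mul_inv_cancel_left₀ ha0 c⟩
      rw [mem_nthRootsFinset hd, _root_.mul_pow, inv_pow, ha, hc, inv_one, one_mul]
  simp_rw [map_mul, ← Finset.mul_sum] at h
  by_contra h0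
  exact hΩ (mul_right_cancel₀ h0 (h.symm.trans (one_mul _).symm))

theorem exists_ne_one_pow_eq_one {K : Type*} [Field K] [Fintype K] {d : ℕ}
    (hd : d ∣ Fintype.card K - 1) (hd1 : d ≠ 1) : ∃ a : K, a ≠ 1 ∧ a ^ d = 1 := by
  classical
  obtain ⟨g, hg⟩ := IsCyclic.exists_ofOrder_eq_natCard (α := Kˣ)
  rw [Nat.card_eq_fintype_card, Fintype.card_units] at hg
  obtain ⟨e, he⟩ := hd
  have hq : 1 < Fintype.card K := Fintype.one_lt_card
  refine ⟨((g ^ e : Kˣ) : K), ?_, ?_⟩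
  · intro h
    have h1 : g ^ e = 1 := Units.ext h
    have h2 := orderOf_dvd_of_pow_eq_one h1
    rw [hg, he] at h2
    have he0 : 0 < e := Nat.pos_of_ne_zero fun h => by
      rw [h, mul_zero] at he
      omega
    have hd0 : d ≠ 0 := by
      rintro rfl
      omega
    have h3 := Nat.le_of_dvd he0 h2
    have h4 : 2 * e ≤ d * e := Nat.mul_le_mul_right _ (by omega)
    omega
  · rw [← Units.val_pow_eq_pow_val, ← pow_mul, mul_comm, ← he, ← hg, pow_orderOf_eq_one,
      Units.val_one]

variable {K : Type*} [Field K] [Fintype K] {p : ℕ} [Fact p.Prime] [Algebra (ZMod p) K]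

open Classical in
/-- The Weil bound for mixed character sums along the rational function `f₁ / f₂`. -/
theorem norm_sum_mixed_le {f₁ f₂ : K[X]} (h₁ : Irreducible f₁) (h₂ : Irreducible f₂)
    (hcop : IsCoprime f₁ f₂) {ψ : AddChar (ZMod p) ℂ} (hψ : ψ ≠ 1) (χ₁ χ₂ : MulChar K ℂ) (u v : K)
    (hne : χ₁ ≠ 1 ∨ χ₂ ≠ 1 ∨ u ≠ 0 ∨ v ≠ 0) :
    ‖∑ y ∈ Finset.univ.filter (fun y : K => (X * f₁ * f₂ ^ 2).eval y ≠ 0),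
      χ₁ y * χ₂ (f₁.eval y / f₂.eval y) *
        ψ (Algebra.trace (ZMod p) K (u * y + v * (f₁.eval y / f₂.eval y)))‖ ≤
      (2 * (f₁.natDegree + f₂.natDegree) : ℕ) * Real.sqrt (Fintype.card K) := by
  set L := AlgebraicClosure K
  have hpp : p.Prime := Fact.out
  have : CharP L p := charP_of_injective_algebraMap (algebraMap (ZMod p) L).injective p
  set r := Module.finrank (ZMod p) K with hr
  have hpr : Fintype.card K = p ^ r := by
    rw [Module.card_eq_pow_finrank (K := ZMod p) (V := K), ZMod.card]
  obtain ⟨Ω, hΩ, hΩ1⟩ := exists_mulChar_extending_generator K L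
  obtain ⟨I, hI⟩ := hΩ χ₁
  obtain ⟨J, hJ⟩ := hΩ χ₂
  set q := Fintype.card K with hq
  have hq1 : 1 < q := Fintype.one_lt_card
  set e := ((I.gcd J).gcd (q - 1)) with he
  have he0 : 0 < e := Nat.gcd_pos_of_pos_right _ (by omega)
  have heI : e ∣ I := (Nat.gcd_dvd_left _ _).trans (Nat.gcd_dvd_left _ _)
  have heJ : e ∣ J := (Nat.gcd_dvd_left _ _).trans (Nat.gcd_dvd_right _ _)
  have heq : e ∣ q - 1 := Nat.gcd_dvd_right _ _
  have hcopd : ((I / e).gcd (J / e)).Coprime ((q - 1) / e) := by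
    rw [Nat.gcd_div heI heJ, he]
    exact Nat.coprime_div_gcd_div_gcd he0
  have hde : (q - 1) / e * e = q - 1 := Nat.div_mul_cancel heq
  set d := (q - 1) / e with hd
  have hd0 : 0 < d := Nat.pos_of_ne_zero fun h => by
    rw [h, zero_mul] at hde
    omega
  obtain ⟨σ, hσ⟩ := LinearMap.exists_leftInverse_of_injective (Algebra.linearMap (ZMod p) L)
    (LinearMap.ker_eq_bot.mpr (algebraMap (ZMod p) L).injective)
  have hσ1 : ∀ c : ZMod p, σ (algebraMap (ZMod p) L c) = c := fun c => LinearMap.congr_fun hσ c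
  set f₁' := f₁.map (algebraMap K L)
  set f₂' := f₂.map (algebraMap K L)
  have hs₁ : f₁.Separable := PerfectField.separable_of_irreducible h₁
  have hs₂ : f₂.Separable := PerfectField.separable_of_irreducible h₂
  have hd₁ : f₁.degree ≠ 0 := (degree_pos_of_irreducible h₁).ne'
  have hd₂ : f₂.degree ≠ 0 := (degree_pos_of_irreducible h₂).ne'
  have hgood : ∀ y : K, (X * f₁ * f₂ ^ 2).eval y ≠ 0 →
      y ≠ 0 ∧ f₁.eval y ≠ 0 ∧ f₂.eval y ≠ 0 := by
    intro y hy
    simpa [and_assoc] using hy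
  have hχ : ∀ y : K, (X * f₁ * f₂ ^ 2).eval y ≠ 0 → χ₁ y * χ₂ (f₁.eval y / f₂.eval y) =
      Ω (algebraMap K L y) ^ (I / e * e) *
        Ω (algebraMap K L (f₁.eval y / f₂.eval y)) ^ (J / e * e) := by
    intro y hy
    obtain ⟨hy0, hy1, hy2⟩ := hgood y hy
    rw [Nat.div_mul_cancel heI, Nat.div_mul_cancel heJ, hI y hy0, hJ _ (div_ne_zero hy1 hy2)]
  by_cases huv : u ≠ 0 ∨ v ≠ 0
  · set Θ : AddChar L ℂ := ψ.compAddMonoidHom σ.toAddMonoidHom with hΘ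
    have hG : (C u * X * f₂ + C v * f₁).map (algebraMap K L) =
        C (algebraMap K L u) * X * f₂' + C (algebraMap K L v) * f₁' := by simp [f₁', f₂']
    have hb := norm_sum_mixed_le_of_sum_eq_zero (L := L) (p := p) hpr hde hcopd hs₁ hs₂ hd₁ hd₂ hcop
      (f := f₂) (G := C u * X * f₂ + C v * f₁) dvd_rfl (by
        rw [hG]
        refine artinSchreier_ne hpp.two_le hs₂.map.squarefree ?_
          (hcop.map (mapRingHom (algebraMap K L))) ?_
        · intro h
          refine hd₂ ?_
          rw [← degree_map f₂ (algebraMap K L)]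
          exact degree_eq_zero_of_isUnit h
        · simpa using huv) Ω Θ (by
        refine mul_eq_zero_of_right _ ?_
        have h := sum_frobeniusFixed_one (K := ZMod p) (L := L) fun s => Θ s
        rw [frobeniusFixed, ZMod.card, pow_one] at h
        rw [h]
        simp only [hΘ, AddChar.compAddMonoidHom_apply, LinearMap.toAddMonoidHom_coe, hσ1]
        exact AddChar.sum_eq_zero_of_ne_one hψ) (by
        set Ψ : AddChar L ℂ := Θ.compAddMonoidHom (frobeniusSum L p r) with hΨ
        have c1 : IsCongruenceCharacter ((X * f₁ * f₂ ^ 2).map (algebraMap K L)) f₁.natDegree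
            fun x => Ψ ((C (algebraMap K L u) * X).eval x) :=
          isCongruenceCharacter_addChar_eval Ψ
            ((natDegree_C_mul_le _ _).trans (natDegree_X_le.trans h₁.natDegree_pos))
        have c2 : IsCongruenceCharacter ((X * f₁ * f₂ ^ 2).map (algebraMap K L)) f₁.natDegree
            fun x => Ψ ((C (algebraMap K L v) * f₁').eval x / f₂'.eval x) :=
          isCongruenceCharacter_addChar_eval_div Ψ hs₂.map
            (by
              rw [Polynomial.map_mul, Polynomial.map_pow]
              exact Dvd.intro_left _ rfl)
            ((natDegree_C_mul_le _ _).trans (natDegree_map _).le)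
        refine (c1.mul c2).congr fun x hx => ?_
        have hx2 : f₂'.eval x ≠ 0 := by
          intro h
          apply hx
          simp [f₂'] at h
          simp [h]
        rw [← AddChar.map_add_eq_mul, hΨ, AddChar.compAddMonoidHom_apply, ← frobeniusSum_apply, hG]
        simp only [eval_add, eval_mul, eval_C, eval_X]
        rw [add_div, mul_div_cancel_right₀ _ hx2]
        rfl)
    convert hb using 2
    refine Finset.sum_congr rfl fun y hy => ?_
    have hy' := (Finset.mem_filter.mp hy).2
    obtain ⟨hy0, hy1, hy2⟩ := hgood y hy'
    rw [hχ y hy']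
    congr 1
    have h1 : (C u * X * f₂ + C v * f₁).eval y / f₂.eval y =
        u * y + v * (f₁.eval y / f₂.eval y) := by
      simp only [eval_add, eval_mul, eval_C, eval_X]
      field_simp
    have h2 := congrArg (algebraMap K L) (FiniteField.algebraMap_trace_eq_sum_pow (ZMod p) K
      (u * y + v * (f₁.eval y / f₂.eval y)))
    rw [← IsScalarTower.algebraMap_apply, map_sum, Nat.card_eq_fintype_card, ZMod.card] at h2
    simp_rw [map_pow] at h2
    rw [h1, ← h2, hΘ, AddChar.compAddMonoidHom_apply, LinearMap.toAddMonoidHom_coe, hσ1]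
  · push Not at huv
    obtain ⟨rfl, rfl⟩ := huv
    have hd1 : d ≠ 1 := by
      intro h
      rw [h, one_mul] at hde
      have hone : ∀ (χ : MulChar K ℂ) (i : ℕ), e ∣ i →
          (∀ a : K, a ≠ 0 → χ a = Ω (algebraMap K L a) ^ i) → χ = 1 := by
        intro χ i hi hχi
        refine MulChar.ext fun a => ?_
        obtain ⟨i', rfl⟩ := hi
        rw [hχi a a.ne_zero, pow_mul, ← map_pow Ω, ← map_pow (algebraMap K L), hde, hq,
          FiniteField.pow_card_sub_one_eq_one _ a.ne_zero, map_one, map_one, one_pow,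
          MulChar.one_apply_coe]
      rcases hne with h | h | h | h
      · exact h (hone _ I heI hI)
      · exact h (hone _ J heJ hJ)
      · exact h rfl
      · exact h rfl
    obtain ⟨a, ha1, had⟩ := exists_ne_one_pow_eq_one (K := K) (Dvd.intro _ hde) hd1
    have hb := norm_sum_mixed_le_of_sum_eq_zero (L := L) (p := p) hpr hde hcopd hs₁ hs₂ hd₁ hd₂ hcop
      (f := 1) (G := X) (one_dvd _) (by
        simpa using artinSchreier_ne_X (L := L) hpp.two_le) Ω 1 (by
        refine mul_eq_zero_of_left (sum_nthRootsFinset_eq_zero hd0 Ω (a := algebraMap K L a) ?_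
          fun h => ha1 (hΩ1 a h)) _
        rw [← map_pow, had, map_one]) (by
        simpa using isCongruenceCharacter_const 1)
    convert hb using 2
    refine Finset.sum_congr rfl fun y hy => ?_
    rw [hχ y (Finset.mem_filter.mp hy).2]
    simp

end

theorem dvd_of_dvd_sum_div_mul {N : ℕ} (hN : 0 < N) {s : Finset ℕ} (hs : s ⊆ N.primeFactors)
    {c : ℕ → ℕ} (h : N ∣ ∑ l ∈ s, N / l * c l) {l : ℕ} (hl : l ∈ s) : l ∣ c l := by
  have hlN := Nat.dvd_of_mem_primeFactors (hs hl)
  have hlp := Nat.prime_of_mem_primeFactors (hs hl)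
  set m := ∏ l' ∈ s.erase l, l' with hm
  have h1 : N ∣ (∑ l' ∈ s, N / l' * c l') * m := Dvd.dvd.mul_right h m
  rw [← Finset.add_sum_erase s _ hl, add_mul] at h1
  have h2 : N ∣ (∑ l' ∈ s.erase l, N / l' * c l') * m := by
    rw [Finset.sum_mul]
    refine Finset.dvd_sum fun l' hl' => ?_
    obtain ⟨m', hm'⟩ := Finset.dvd_prod_of_mem (fun l => l) hl'
    rw [← hm] at hm'
    rw [hm']
    refine ⟨c l' * m', ?_⟩
    have h3 := Nat.div_mul_cancel (Nat.dvd_of_mem_primeFactors (hs (Finset.mem_of_mem_erase hl')))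
    calc N / l' * c l' * (l' * m') = N / l' * l' * (c l' * m') := by ring
      _ = _ := by rw [h3]
  rw [← Nat.dvd_add_iff_left h2, mul_assoc] at h1
  have h4 : N / l * l ∣ N / l * (c l * m) := by rwa [Nat.div_mul_cancel hlN]
  have h5 := Nat.dvd_of_mul_dvd_mul_left
    (Nat.div_pos (Nat.le_of_dvd hN hlN) hlp.pos) h4
  refine (hlp.dvd_mul.mp h5).resolve_right fun h6 => ?_
  rw [hm, hlp.prime.dvd_finsetProd_iff] at h6
  obtain ⟨l', hl', hdvd⟩ := h6
  have hl'p := Nat.prime_of_mem_primeFactors (hs (Finset.mem_of_mem_erase hl'))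
  exact Finset.ne_of_mem_erase hl' ((Nat.prime_dvd_prime_iff_eq hlp hl'p).mp hdvd).symm

/-- The characteristic function of the primitive elements of a finite field as a combination of
multiplicative characters. -/
theorem exists_sum_mulChar_eq_primitive_indicator (K : Type*) [Field K] [Fintype K] :
    ∃ (ι : Type) (I : Finset ι) (i₀ : ι) (c : ι → ℂ) (χ : ι → MulChar K ℂ) (θ : ℝ),
      i₀ ∈ I ∧ 0 < θ ∧ c i₀ = θ ∧ χ i₀ = 1 ∧ (∀ i ∈ I, i ≠ i₀ → χ i ≠ 1) ∧
      ∑ i ∈ I, ‖c i‖ = θ * 2 ^ (Fintype.card K - 1).primeFactors.card ∧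
      ∀ x : K, x ≠ 0 → orderOf x ≠ Fintype.card K - 1 → ∑ i ∈ I, c i * χ i x = 0 := by
  classical
  obtain ⟨ω, -, hω⟩ := exists_mulChar_extending_generator K K
  simp only [Algebra.algebraMap_self, RingHom.id_apply] at hω
  set N := Fintype.card K - 1 with hN
  have hq1 : 1 < Fintype.card K := Fintype.one_lt_card
  have hN0 : 0 < N := by omega
  set a : ℕ → ℕ → ℂ := fun l j => (if j = 0 then 1 else 0) - (l : ℂ)⁻¹ with ha
  set E : (N.primeFactors → ℕ) → ℕ := fun f => ∑ l : N.primeFactors, N / l * f l with hE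
  have hl2 : ∀ l : N.primeFactors, 2 ≤ (l : ℕ) :=
    fun l => (Nat.prime_of_mem_primeFactors l.2).two_le
  have hpow : ∀ (x : K) (n : ℕ), x ≠ 0 → (ω ^ n) x = ω x ^ n := by
    intro x n hx
    have := MulChar.pow_apply_coe ω n (Units.mk0 x hx)
    simpa using this
  refine ⟨N.primeFactors → ℕ, Fintype.piFinset fun l => Finset.range l, 0,
    fun f => ∏ l : N.primeFactors, a l (f l), fun f => ω ^ E f,
      ∏ l : N.primeFactors, (1 - (l : ℝ)⁻¹), ?_, ?_, ?_,
    ?_, ?_, ?_, ?_⟩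
  · rw [Fintype.mem_piFinset]
    intro l
    rw [Finset.mem_range]
    exact two_pos.trans_le (hl2 l)
  · refine Finset.prod_pos fun l _ => ?_
    have : (2 : ℝ) ≤ (l : ℕ) := by exact_mod_cast hl2 l
    rw [sub_pos]
    exact inv_lt_one_of_one_lt₀ (by linarith)
  · simp [ha]
  · simp [hE]
  · intro f hf hf0 h1
    dsimp only at h1
    obtain ⟨g, hg⟩ := IsCyclic.exists_ofOrder_eq_natCard (α := Kˣ)
    rw [Nat.card_eq_fintype_card, Fintype.card_units, ← hN] at hg
    have h2 : ω ((g : K) ^ E f) = 1 := by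
      rw [map_pow, ← hpow _ _ g.ne_zero, h1, MulChar.one_apply_coe]
    have h3 : g ^ E f = 1 := Units.ext (by simpa using hω _ h2)
    have h4 := orderOf_dvd_of_pow_eq_one h3
    rw [hg] at h4
    set c : ℕ → ℕ := fun l => if h : l ∈ N.primeFactors then f ⟨l, h⟩ else 0 with hc
    have h5 : E f = ∑ l ∈ N.primeFactors, N / l * c l := by
      rw [← Finset.sum_coe_sort, hE]
      refine Finset.sum_congr rfl fun l _ => ?_
      rw [hc]
      simp
    rw [h5] at h4
    apply hf0
    ext l
    have h6 := dvd_of_dvd_sum_div_mul hN0 subset_rfl h4 l.2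
    have h7 : c l = f l := dif_pos l.2
    rw [h7] at h6
    rw [Fintype.mem_piFinset] at hf
    exact Nat.eq_zero_of_dvd_of_lt h6 (Finset.mem_range.mp (hf l))
  · simp_rw [norm_prod]
    rw [← Finset.prod_univ_sum (fun l : N.primeFactors => Finset.range l) fun l j => ‖a l j‖,
      ← Fintype.card_coe, ← Finset.card_univ, ← Finset.prod_const, ← Finset.prod_mul_distrib]
    refine Finset.prod_congr rfl fun l _ => ?_
    obtain ⟨m, hm⟩ := Nat.exists_eq_succ_of_ne_zero (show (l : ℕ) ≠ 0 by have := hl2 l; omega)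
    have h2 : (0 : ℝ) < (l : ℕ) := by
      have := hl2 l
      exact_mod_cast (by omega : 0 < (l : ℕ))
    have h3 : ((l : ℕ) : ℝ) = m + 1 := by rw [hm]; push_cast; ring
    have h4 : ‖a l 0‖ = 1 - ((l : ℕ) : ℝ)⁻¹ := by
      have h5 : a l 0 = ((1 - ((l : ℕ) : ℝ)⁻¹ : ℝ) : ℂ) := by simp [ha]
      rw [h5, Complex.norm_real, Real.norm_of_nonneg]
      rw [sub_nonneg]
      exact inv_le_one_of_one_le₀ (by rw [h3]; linarith [(Nat.cast_nonneg m : (0 : ℝ) ≤ m)])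
    have h5 : ∀ j, ‖a l (j + 1)‖ = ((l : ℕ) : ℝ)⁻¹ := by
      intro j
      simp [ha]
    rw [show Finset.range (l : ℕ) = Finset.range (m + 1) by rw [hm], Finset.sum_range_succ', h4]
    simp_rw [h5]
    rw [Finset.sum_const, Finset.card_range, nsmul_eq_mul, h3]
    field_simp
    ring
  · intro x hx hord
    have hxN : x ^ N = 1 := FiniteField.pow_card_sub_one_eq_one x hx
    have hroot : ∀ l : N.primeFactors, (ω (x ^ (N / l))) ^ (l : ℕ) = 1 := by
      intro l
      rw [← map_pow, ← pow_mul, Nat.div_mul_cancel (Nat.dvd_of_mem_primeFactors l.2), hxN, map_one]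
    have h1 : ∀ f : N.primeFactors → ℕ, (∏ l : N.primeFactors, a l (f l)) * (ω ^ E f) x =
        ∏ l : N.primeFactors, a l (f l) * ω (x ^ (N / l)) ^ f l := by
      intro f
      rw [hpow x _ hx, hE, ← Finset.prod_pow_eq_pow_sum, Finset.prod_mul_distrib]
      congr 1
      refine Finset.prod_congr rfl fun l _ => ?_
      rw [pow_mul, map_pow]
    simp_rw [h1]
    rw [← Finset.prod_univ_sum (fun l : N.primeFactors => Finset.range l) fun l j =>
      a l j * ω (x ^ (N / l)) ^ j]
    have h2 : ∃ l : N.primeFactors, x ^ (N / l) = 1 := by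
      by_contra! h
      refine hord (orderOf_eq_of_pow_and_pow_div_prime hN0 hxN fun l hl hlN => ?_)
      exact h ⟨l, Nat.mem_primeFactors.mpr ⟨hl, hlN, hN0.ne'⟩⟩
    obtain ⟨l, hl⟩ := h2
    refine Finset.prod_eq_zero (Finset.mem_univ l) ?_
    have h3 : ((l : ℕ) : ℂ) ≠ 0 := by
      have := hl2 l
      exact_mod_cast (by omega : (l : ℕ) ≠ 0)
    have h4 : 0 < (l : ℕ) := two_pos.trans_le (hl2 l)
    simp [hl, ha, Finset.sum_sub_distrib, h3, h4]

theorem norm_mul_norm_le_of_sum_eq_zero {α : Type*} {s : Finset α} {t₀ : α} (ht₀ : t₀ ∈ s)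
    {c S : α → ℂ} {B : ℝ} (h : ∑ t ∈ s, c t * S t = 0) (hB : ∀ t ∈ s, t ≠ t₀ → ‖S t‖ ≤ B) :
    ‖c t₀‖ * ‖S t₀‖ ≤ (∑ t ∈ s, ‖c t‖ - ‖c t₀‖) * B := by
  classical
  rw [← Finset.add_sum_erase s _ ht₀] at h
  rw [← norm_mul, eq_neg_of_add_eq_zero_left h, norm_neg, ← Finset.add_sum_erase s _ ht₀,
    add_sub_cancel_left, Finset.sum_mul]
  refine (norm_sum_le _ _).trans (Finset.sum_le_sum fun t ht => ?_)
  rw [norm_mul]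
  exact mul_le_mul_of_nonneg_left (hB t (Finset.mem_of_mem_erase ht) (Finset.ne_of_mem_erase ht))
    (norm_nonneg _)

section

variable {k K : Type*} [Field k] [Fintype k] [Field K] [Fintype K] [Algebra k K]

theorem exists_orderOf_eq_and_trace_eq {p : ℕ} [Fact p.Prime] [Algebra (ZMod p) k]
    [Algebra (ZMod p) K] [IsScalarTower (ZMod p) k K] {f₁ f₂ : K[X]} (h₁ : Irreducible f₁)
    (h₂ : Irreducible f₂) (hcop : IsCoprime f₁ f₂)
    (h : (2 * (f₁.natDegree + f₂.natDegree) + 1 : ℝ) *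
      (2 ^ (Fintype.card K - 1).primeFactors.card) ^ 2 * (Fintype.card k) ^ 2 <
        Real.sqrt (Fintype.card K)) (a b : k) :
    ∃ ε : K, f₁.eval ε ≠ 0 ∧ f₂.eval ε ≠ 0 ∧
      orderOf ε = Fintype.card K - 1 ∧
      orderOf (f₁.eval ε / f₂.eval ε) = Fintype.card K - 1 ∧
      Algebra.trace k K ε = a ∧
      Algebra.trace k K (f₁.eval ε / f₂.eval ε) = b := by
  classical
  obtain ⟨ι, I, i₀, c, χ, θ, hi₀, hθ, hc₀, hχ₀, hχ, hsum, hprim⟩ :=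
    exists_sum_mulChar_eq_primitive_indicator K
  set ψ : AddChar (ZMod p) ℂ := ZMod.stdAddChar with hψdef
  have hψ : ψ ≠ 1 := by
    intro h1
    have h2 := ZMod.isPrimitive_stdAddChar p one_ne_zero
    rw [AddChar.mulShift_one] at h2
    exact h2 h1
  set ψk : AddChar k ℂ := ψ.compAddMonoidHom (Algebra.trace (ZMod p) k).toAddMonoidHom with hψk
  have hψk1 : ψk ≠ 1 := by
    obtain ⟨z, hz⟩ := AddChar.ne_one_iff.mp hψ
    obtain ⟨y, rfl⟩ := Algebra.trace_surjective (ZMod p) k z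
    exact AddChar.ne_one_iff.mpr ⟨y, hz⟩
  have hψksum : ∀ y : k, y ≠ 0 → ∑ u, ψk (u * y) = 0 := by
    intro y hy
    rw [AddChar.sum_mulShift y (AddChar.IsPrimitive.of_ne_one hψk1), if_neg hy, Nat.cast_zero]
  set R : K → K := fun x => f₁.eval x / f₂.eval x with hR
  set F : K[X] := X * f₁ * f₂ ^ 2 with hF
  have hF0 : F ≠ 0 := mul_ne_zero (mul_ne_zero X_ne_zero h₁.ne_zero) (pow_ne_zero _ h₂.ne_zero)
  set E := Finset.univ.filter (fun y : K => F.eval y ≠ 0) with hE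
  have hgood : ∀ y ∈ E, y ≠ 0 ∧ f₁.eval y ≠ 0 ∧ f₂.eval y ≠ 0 := by
    intro y hy
    simpa [hE, hF, and_assoc] using hy
  by_contra hcon
  have hzero : ∀ x ∈ E, (∑ i ∈ I, c i * χ i x) * (∑ j ∈ I, c j * χ j (R x)) *
      ((∑ u, ψk (u * (Algebra.trace k K x - a))) *
        ∑ v, ψk (v * (Algebra.trace k K (R x) - b))) = 0 := by
    intro x hx
    obtain ⟨hx0, hx1, hx2⟩ := hgood x hx
    by_contra hne
    refine hcon ⟨x, hx1, hx2, ?_, ?_, ?_, ?_⟩ <;> by_contra h3 <;> apply hne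
    · rw [hprim x hx0 h3, zero_mul, zero_mul]
    · rw [hprim (R x) (div_ne_zero hx1 hx2) h3, mul_zero, zero_mul]
    · rw [hψksum _ (sub_ne_zero.mpr h3), zero_mul, mul_zero]
    · rw [hψksum _ (sub_ne_zero.mpr h3), mul_zero, mul_zero]
  set s := (I ×ˢ I) ×ˢ (Finset.univ : Finset (k × k)) with hs
  set cc : (ι × ι) × (k × k) → ℂ := fun t =>
    c t.1.1 * c t.1.2 * (ψk (-(t.2.1 * a)) * ψk (-(t.2.2 * b))) with hcc
  set S : (ι × ι) × (k × k) → ℂ := fun t => ∑ x ∈ E, χ t.1.1 x * χ t.1.2 (R x) *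
    ψ (Algebra.trace (ZMod p) K (algebraMap k K t.2.1 * x + algebraMap k K t.2.2 * R x)) with hS
  have htrace : ∀ (u : k) (x : K), ψ (Algebra.trace (ZMod p) K (algebraMap k K u * x)) =
      ψk (u * Algebra.trace k K x) := by
    intro u x
    rw [← Algebra.trace_trace (S := k), ← Algebra.smul_def, map_smul, smul_eq_mul]
    rfl
  have hterm : ∀ (i j : ι) (u v : k) (x : K), cc ((i, j), (u, v)) * (χ i x * χ j (R x) *
      ψ (Algebra.trace (ZMod p) K (algebraMap k K u * x + algebraMap k K v * R x))) =
      (c i * χ i x) * (c j * χ j (R x)) * (ψk (u * (Algebra.trace k K x - a)) *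
        ψk (v * (Algebra.trace k K (R x) - b))) := by
    intro i j u v x
    rw [map_add, AddChar.map_add_eq_mul, htrace, htrace, mul_sub, mul_sub, sub_eq_add_neg,
      sub_eq_add_neg, AddChar.map_add_eq_mul, AddChar.map_add_eq_mul, hcc]
    ring
  have htotal : ∑ t ∈ s, cc t * S t = 0 := by
    simp_rw [hS, Finset.mul_sum]
    rw [Finset.sum_comm]
    refine Finset.sum_eq_zero fun x hx => ?_
    rw [← hzero x hx, Finset.sum_mul_sum, Finset.sum_mul_sum, ← Finset.sum_product',
      ← Finset.sum_product', Finset.sum_mul_sum, hs,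
        ← Finset.sum_product', Finset.univ_product_univ]
    exact Finset.sum_congr rfl fun t _ => hterm t.1.1 t.1.2 t.2.1 t.2.2 x
  have hbound : ∀ t ∈ s, t ≠ ((i₀, i₀), (0, 0)) → ‖S t‖ ≤
      (2 * (f₁.natDegree + f₂.natDegree) : ℕ) * Real.sqrt (Fintype.card K) := by
    rintro ⟨⟨i, j⟩, u, v⟩ ht hne
    simp only [hs, Finset.mem_product] at ht
    have := norm_sum_mixed_le h₁ h₂ hcop hψ (χ i) (χ j) (algebraMap k K u) (algebraMap k K v) (by
      by_contra! h5
      obtain ⟨h6, h7, h8, h9⟩ := h5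
      apply hne
      rw [not_imp_comm.mp (hχ i ht.1.1) (by simpa using h6),
        not_imp_comm.mp (hχ j ht.1.2) (by simpa using h7), (map_eq_zero _).mp h8,
        (map_eq_zero _).mp h9])
    convert this
  have hmain := norm_mul_norm_le_of_sum_eq_zero (t₀ := ((i₀, i₀), (0, 0)))
    (by simp [hs, hi₀]) htotal hbound
  set P : ℝ := ((Fintype.card k : ℕ) : ℝ) with hP
  set W : ℝ := 2 ^ (Fintype.card K - 1).primeFactors.card with hW
  set q := Fintype.card K with hq
  have hcc₀ : ‖cc ((i₀, i₀), (0, 0))‖ = θ ^ 2 := by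
    rw [hcc]
    simp only [hc₀, zero_mul, neg_zero, AddChar.map_zero_eq_one, mul_one, norm_mul,
      Complex.norm_real, Real.norm_of_nonneg hθ.le]
    ring
  have hccsum : ∑ t ∈ s, ‖cc t‖ = (θ * W) ^ 2 * P ^ 2 := by
    simp only [hcc, norm_mul, AddChar.norm_apply, mul_one]
    rw [hs, Finset.sum_product]
    simp only [Finset.sum_const, Finset.card_univ, Fintype.card_prod]
    rw [← Finset.smul_sum, Finset.sum_product]
    dsimp only
    rw [← Finset.sum_mul_sum, hsum, nsmul_eq_mul]
    push_cast
    ring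
  have hS₀ : ‖S ((i₀, i₀), (0, 0))‖ = E.card := by
    rw [hS]
    dsimp only
    rw [hχ₀]
    have : ∀ x ∈ E, (1 : MulChar K ℂ) x * (1 : MulChar K ℂ) (R x) * ψ (Algebra.trace (ZMod p) K
        (algebraMap k K 0 * x + algebraMap k K 0 * R x)) = 1 := by
      intro x hx
      obtain ⟨hx0, hx1, hx2⟩ := hgood x hx
      rw [MulChar.one_apply hx0.isUnit, MulChar.one_apply (div_ne_zero hx1 hx2).isUnit]
      simp
    rw [Finset.sum_congr rfl this]
    simp
  have hEcard : q ≤ E.card + (2 * (f₁.natDegree + f₂.natDegree) + 1) := by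
    have h1 : E.card + (Finset.univ.filter fun x : K => ¬ F.eval x ≠ 0).card = q := by
      rw [hE, Finset.card_filter_add_card_filter_not, Finset.card_univ]
    have h2 : (Finset.univ.filter fun x : K => ¬ F.eval x ≠ 0).card ≤ F.natDegree := by
      refine le_trans (Finset.card_le_card ?_)
        ((Multiset.toFinset_card_le _).trans (card_roots' F))
      intro x hx
      rw [Multiset.mem_toFinset, mem_roots hF0]
      simpa using hx
    have h3 : F.natDegree = 1 + f₁.natDegree + 2 * f₂.natDegree := by
      rw [hF, natDegree_mul (mul_ne_zero X_ne_zero h₁.ne_zero) (pow_ne_zero _ h₂.ne_zero),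
        natDegree_mul X_ne_zero h₁.ne_zero, natDegree_pow, natDegree_X]
    omega
  rw [hcc₀, hccsum, hS₀] at hmain
  push_cast at hmain
  set n : ℝ := (f₁.natDegree : ℝ) + f₂.natDegree with hn
  have hn0 : 0 ≤ n := by positivity
  have hE' : (q : ℝ) ≤ E.card + (2 * n + 1) := by
    rw [hn]
    exact_mod_cast hEcard
  have hP1 : 1 ≤ P := by
    rw [hP]
    exact_mod_cast Fintype.card_pos (α := k)
  have hW1 : 1 ≤ W := one_le_pow₀ (by norm_num)
  have hmain' : (E.card : ℝ) ≤ (W ^ 2 * P ^ 2 - 1) * (2 * n * Real.sqrt q) := by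
    have h4 : 0 < θ ^ 2 := by positivity
    refine le_of_mul_le_mul_left (hmain.trans (le_of_eq ?_)) h4
    ring
  set y := Real.sqrt q with hy
  have hy2 : y * y = q := Real.mul_self_sqrt (Nat.cast_nonneg q)
  have hY : 1 ≤ W ^ 2 * P ^ 2 := by
    have := one_le_pow₀ hW1 (n := 2)
    have := one_le_pow₀ hP1 (n := 2)
    nlinarith
  set Y := W ^ 2 * P ^ 2 with hYdef
  have h5 : (2 * n + 1) * Y < y := by
    rw [hYdef, ← mul_assoc]
    exact h
  have hy1 : 1 < y := by nlinarith
  nlinarith [mul_lt_mul_of_pos_right h5 (by linarith : 0 < y),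
    mul_nonneg hn0 (by linarith : 0 ≤ y - 1), mul_pos (by linarith : 0 < Y) (by linarith : 0 < y)]

end

theorem stmt_14 (p t n : ℕ) (hp : ∃ q r : ℕ, q.Prime ∧ 0 < r ∧ p = q ^ r)
    (ht : 0 < t) (hn : 0 < n)
    (h : ((2 * n + 1 : ℕ) : ℝ) * 2 ^ (2 * (p ^ t - 1).primeFactors.card) <
      (p : ℝ) ^ ((t : ℝ) / 2 - 2))
    (k K : Type*) [Field k] [Fintype k] [Field K] [Fintype K] [Algebra k K]
    (hk : Fintype.card k = p) (hK : Fintype.card K = p ^ t)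
    (f₁ f₂ : K[X]) (h₁ : Irreducible f₁) (h₂ : Irreducible f₂) (hcop : IsCoprime f₁ f₂)
    (hdeg : f₁.natDegree + f₂.natDegree = n) (a b : k) :
    ∃ ε : K, f₁.eval ε ≠ 0 ∧ f₂.eval ε ≠ 0 ∧
      orderOf ε = Fintype.card K - 1 ∧
      orderOf (f₁.eval ε / f₂.eval ε) = Fintype.card K - 1 ∧
      Algebra.trace k K ε = a ∧
      Algebra.trace k K (f₁.eval ε / f₂.eval ε) = b := by
  obtain ⟨l, hl⟩ := CharP.exists k
  have : Fact l.Prime := ⟨CharP.char_is_prime k l⟩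
  have : CharP K l := charP_of_injective_algebraMap (algebraMap k K).injective l
  let _ : Algebra (ZMod l) k := ZMod.algebra k l
  let _ : Algebra (ZMod l) K := ZMod.algebra K l
  have : IsScalarTower (ZMod l) k K := IsScalarTower.of_algebraMap_eq' (Subsingleton.elim _ _)
  refine exists_orderOf_eq_and_trace_eq (p := l) h₁ h₂ hcop ?_ a b
  have hp0 : (0 : ℝ) < p := by
    rw [← hk]
    exact_mod_cast Fintype.card_pos
  have hsqrt : (p : ℝ) ^ ((t : ℝ) / 2 - 2) * p ^ 2 = Real.sqrt ((p ^ t : ℕ) : ℝ) := by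
    rw [Real.rpow_sub hp0, Real.rpow_two, div_mul_cancel₀ _ (by positivity), Nat.cast_pow,
      Real.sqrt_eq_rpow, ← Real.rpow_natCast_mul hp0.le]
    congr 1
    ring
  rw [hk, hK, ← hsqrt]
  have hdeg' : (f₁.natDegree : ℝ) + f₂.natDegree = n := by exact_mod_cast hdeg
  rw [hdeg', ← pow_mul, mul_comm _ 2]
  push_cast at h
  exact mul_lt_mul_of_pos_right h (by positivity)
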